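/- arXiv:1912.11911 — 5 statements merged into one kernel-verified Lean document; each statement's English description precedes it below -/
import Mathlib

section
/- Let D be a finite-dimensional graded-division algebra over the field F = Z(D) ∩ D_e (so D is graded-central over F), graded by a group with support T = Supp(D), which is a finite group. Let L = Z(D_e) be the center of the identity component D_e (a division algebra), and let K = Supp(Cent_D(L)), where Cent_D(L) = {x ∈ D : xy = yx for all y ∈ L} is a graded subalgebra of D. Then L is a Galois field extension of F, K is a normal subgroup of T, and the Galois group Gal(L/F) is isomorphic to T/K via the map sending the coset tK to the restriction to L of the inner automorphism Int(X_t): y ↦ X_t y X_t^{-1}, for any nonzero homogeneous X_t ∈ D_t. -/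
/-- In a graded-division algebra, the inverse of a homogeneous unit of degree `t` is homogeneous
of degree `t⁻¹`. -/
theorem inv_mem_of_homogeneous {T : Type*} [Group T]
    {F : Type*} [Field F] {D : Type*} [Ring D] [Algebra F D] [FiniteDimensional F D]
    (comp : T → Submodule F D)
    (hone : (1 : D) ∈ comp 1)
    (hmul : ∀ {g h : T} {x y : D}, x ∈ comp g → y ∈ comp h → x * y ∈ comp (g * h))
    (hsupp : ∀ t : T, comp t ≠ ⊥)
    (hdiv : ∀ (t : T), ∀ x ∈ comp t, x ≠ 0 → IsUnit x)
    {t : T} {u : Dˣ} (hu : (u : D) ∈ comp t) : ((u⁻¹ : Dˣ) : D) ∈ comp t⁻¹ := by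
  obtain ⟨z, hz, hz0⟩ := Submodule.exists_mem_ne_zero_of_ne_bot (hsupp t⁻¹)
  have hw : (u : D) * z ∈ comp 1 := by simpa using hmul hu hz
  have hw0 : (u : D) * z ≠ 0 := fun h => hz0 ((Units.mul_right_eq_zero u).1 h)
  obtain ⟨w, hwu⟩ := hdiv 1 _ hw hw0
  have hmaps : ∀ x ∈ comp 1, LinearMap.mulLeft F (w : D) x ∈ comp 1 := fun x hx => by
    simpa [hwu, mul_assoc] using hmul hw hx
  have hinj : Function.Injective ((LinearMap.mulLeft F (w : D)).restrict hmaps) := by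
    intro x y hxy
    have h : (w : D) * x = w * y := congrArg Subtype.val hxy
    exact Subtype.ext (w.mul_right_inj.1 h)
  obtain ⟨v, hv⟩ := LinearMap.injective_iff_surjective.1 hinj ⟨1, hone⟩
  have hv' : (w : D) * v = 1 := congrArg Subtype.val hv
  have huv : (u : D) * (z * v) = 1 := by rw [← mul_assoc, ← hwu, hv']
  rw [Units.inv_eq_of_mul_eq_one_right huv]
  simpa using hmul hz v.2

/-- Let `D` be a finite-dimensional graded-division algebra over the
field `F = Z(D) ∩ D_e` (graded-central), graded by its support `T` (all components
nonzero).  Let `L = Z(D_e)`, realized as a field `L` with an `F`-algebra embedding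
`ι : L → D` whose range is the center of `D_e`.  Then `L/F` is a Galois extension, the
support `K` of `Cent_D(L)` is a normal subgroup of `T`, and `Gal(L/F) ≅ T/K` via
`tK ↦ (Int X_t)|_L` for nonzero homogeneous `X_t ∈ D_t` — formalized by the existence
of a surjective homomorphism `φ : T →* Gal(L/F)` with kernel set `K` satisfying
`ι (φ t l) = X_t · ι l · X_t⁻¹`. -/
theorem stmt1 {T : Type*} [Group T] [DecidableEq T]
    {F : Type*} [Field F] {D : Type*} [Ring D] [Algebra F D] [FiniteDimensional F D]
    (comp : T → Submodule F D)
    (hinternal : DirectSum.IsInternal comp)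
    (hone : (1 : D) ∈ comp 1)
    (hmul : ∀ {g h : T} {x y : D}, x ∈ comp g → y ∈ comp h → x * y ∈ comp (g * h))
    (hsupp : ∀ t : T, comp t ≠ ⊥)
    (hdiv : ∀ (t : T), ∀ x ∈ comp t, x ≠ 0 → IsUnit x)
    (hcentral : ∀ x : D, (x ∈ comp 1 ∧ ∀ y : D, x * y = y * x) ↔
      x ∈ Set.range (algebraMap F D))
    (L : Type*) [Field L] [Algebra F L] (ι : L →ₐ[F] D)
    (hι : Set.range ⇑ι = {x : D | x ∈ comp 1 ∧ ∀ y ∈ comp 1, x * y = y * x}) :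
    IsGalois F L ∧
    ∃ φ : T →* (L ≃ₐ[F] L),
      Function.Surjective φ ∧
      ({t : T | φ t = 1} =
        {t : T | ∃ x ∈ comp t, x ≠ 0 ∧ ∀ l : L, x * ι l = ι l * x}) ∧
      ∀ (t : T) (u : Dˣ), (u : D) ∈ comp t →
        ∀ l : L, ι (φ t l) = (u : D) * ι l * ((u⁻¹ : Dˣ) : D) := by
  have : Nontrivial D := by
    obtain ⟨z, -, hz0⟩ := Submodule.exists_mem_ne_zero_of_ne_bot (hsupp 1)
    exact ⟨z, 0, hz0⟩
  have hιinj : Function.Injective ι := ι.toRingHom.injective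
  have : FiniteDimensional F L := FiniteDimensional.of_injective ι.toLinearMap hιinj
  have hinv : ∀ {t : T} {u : Dˣ}, (u : D) ∈ comp t → ((u⁻¹ : Dˣ) : D) ∈ comp t⁻¹ :=
    fun hu => inv_mem_of_homogeneous comp hone hmul hsupp hdiv hu
  have hunit : ∀ t : T, ∃ u : Dˣ, (u : D) ∈ comp t := fun t => by
    obtain ⟨z, hz, hz0⟩ := Submodule.exists_mem_ne_zero_of_ne_bot (hsupp t)
    obtain ⟨u, rfl⟩ := hdiv t z hz hz0
    exact ⟨u, hz⟩
  have hL : ∀ l : L, ι l ∈ comp 1 ∧ ∀ y ∈ comp 1, ι l * y = y * ι l := fun l => by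
    have h : ι l ∈ Set.range ⇑ι := ⟨l, rfl⟩
    rwa [hι] at h
  have hconj : ∀ {t : T} {u : Dˣ}, (u : D) ∈ comp t →
      ∀ l : L, ∃ m : L, ι m = (u : D) * ι l * ((u⁻¹ : Dˣ) : D) := by
    intro t u hu l
    suffices h : (u : D) * ι l * ((u⁻¹ : Dˣ) : D) ∈ Set.range ⇑ι from h
    rw [hι]
    refine ⟨by simpa using hmul (hmul hu (hL l).1) (hinv hu), fun y hy => ?_⟩
    have hy' : ((u⁻¹ : Dˣ) : D) * y * u ∈ comp 1 := by
      simpa using hmul (hmul (hinv hu) hy) hu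
    have h := (hL l).2 _ hy'
    calc (u : D) * ι l * ((u⁻¹ : Dˣ) : D) * y
        = u * (ι l * (((u⁻¹ : Dˣ) : D) * y * u)) * ((u⁻¹ : Dˣ) : D) := by simp [mul_assoc]
      _ = y * (u * ι l * ((u⁻¹ : Dˣ) : D)) := by rw [h]; simp [mul_assoc]
  have hindep : ∀ {t : T} {u v : Dˣ}, (u : D) ∈ comp t → (v : D) ∈ comp t →
      ∀ l : L, (u : D) * ι l * ((u⁻¹ : Dˣ) : D) = v * ι l * ((v⁻¹ : Dˣ) : D) := by
    intro t u v hu hv l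
    have h := (hL l).2 (((v⁻¹ : Dˣ) : D) * u) (by simpa using hmul (hinv hv) hu)
    calc (u : D) * ι l * ((u⁻¹ : Dˣ) : D)
        = v * (((v⁻¹ : Dˣ) : D) * u * ι l) * ((u⁻¹ : Dˣ) : D) := by simp [mul_assoc]
      _ = v * ι l * ((v⁻¹ : Dˣ) : D) := by rw [← h]; simp [mul_assoc]
  choose X hX using hunit
  choose f hf using fun t => hconj (hX t)
  let ψ (t : T) : L →ₐ[F] L :=
    { toFun := f t
      map_one' := hιinj (by simp [hf])
      map_mul' := fun a b => hιinj (by simp [hf, mul_assoc])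
      map_zero' := hιinj (by simp [hf])
      map_add' := fun a b => hιinj (by simp [hf, mul_add, add_mul])
      commutes' := fun r => hιinj (by
        rw [hf, ι.commutes, ← Algebra.commutes]; simp [mul_assoc]) }
  have hψ : ∀ {t : T} {u : Dˣ}, (u : D) ∈ comp t →
      ∀ l : L, ι (ψ t l) = (u : D) * ι l * ((u⁻¹ : Dˣ) : D) :=
    fun {t u} hu l => (hf t l).trans (hindep (hX t) hu l)
  let φ : T →* (L ≃ₐ[F] L) :=
    (algEquivEquivAlgHom F L).symm.toMonoidHom.comp
      { toFun := ψ
        map_one' := AlgHom.ext fun l => hιinj (by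
          rw [hψ (u := 1) (by simpa using hone)]; simp)
        map_mul' := fun s t => AlgHom.ext fun l => hιinj (by
          rw [hψ (u := X s * X t) (by simpa using hmul (hX s) (hX t)), AlgHom.mul_apply,
            hψ (hX s), hψ (hX t)]
          simp [mul_assoc]) }
  have hφ : ∀ (t : T) (u : Dˣ), (u : D) ∈ comp t →
      ∀ l : L, ι (φ t l) = (u : D) * ι l * ((u⁻¹ : Dˣ) : D) :=
    fun t u hu l => hψ hu l
  have hfix : IntermediateField.fixedField φ.range = (⊥ : IntermediateField F L) := by
    refine eq_bot_iff.2 fun l hl => ?_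
    have hl' : ∀ t, φ t l = l := fun t => hl ⟨φ t, t, rfl⟩
    have hcomm : ∀ y : D, ι l * y = y * ι l := fun y => by
      have hy : y ∈ ⨆ t, comp t := hinternal.submodule_iSup_eq_top ▸ Submodule.mem_top
      induction hy using Submodule.iSup_induction' with
      | mem t x hx =>
        rcases eq_or_ne x 0 with rfl | hx0
        · simp
        obtain ⟨u, rfl⟩ := hdiv t x hx hx0
        have h := hφ t u hx l
        rw [hl', Units.eq_mul_inv_iff_mul_eq] at h
        exact h
      | zero => simp
      | add x y _ _ hx hy => rw [mul_add, add_mul, hx, hy]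
    obtain ⟨r, hr⟩ := (hcentral (ι l)).1 ⟨(hL l).1, hcomm⟩
    exact IntermediateField.mem_bot.2 ⟨r, hιinj (by rw [ι.commutes, hr])⟩
  refine ⟨?_, φ, ?_, ?_, hφ⟩
  · refine IsGalois.of_fixedField_eq_bot F L (eq_bot_iff.2 ?_)
    rw [← hfix]
    exact fun l hl g => hl ⟨g.1, trivial⟩
  · rw [← MonoidHom.range_eq_top, ← IntermediateField.fixingSubgroup_fixedField φ.range, hfix,
      IntermediateField.fixingSubgroup_bot]
  · ext t
    constructor
    · intro ht
      refine ⟨X t, hX t, (X t).ne_zero, fun l => ?_⟩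
      have h := hφ t (X t) (hX t) l
      rw [show φ t = 1 from ht, Units.eq_mul_inv_iff_mul_eq] at h
      exact h.symm
    · rintro ⟨x, hx, hx0, hxl⟩
      obtain ⟨u, rfl⟩ := hdiv t x hx hx0
      refine AlgEquiv.ext fun l => hιinj ?_
      rw [hφ t u hx l, hxl, AlgEquiv.one_apply, Units.mul_inv_cancel_right]
end

section
/- Let A be a unital G-graded algebra over a field F and let K be any field extension of F. Equip A ⊗_F K with the G-grading whose component of degree g is A_g ⊗_F K. Then A is graded-central-simple over F (i.e., Z(A) ∩ A_e = F·1 and A has no graded two-sided ideals other than 0 and A, with A² ≠ 0) if and only if A ⊗_F K is graded-central-simple over K. -/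
open scoped TensorProduct DirectSum

/-- A two-sided ideal of a `G`-graded algebra is *graded* if, whenever a sum of
homogeneous components lies in the ideal, each of the components lies in the ideal. -/
def IsGradedTwoSidedIdeal {G : Type*} [Group G] [DecidableEq G]
    {F : Type*} [Field F] {A : Type*} [Ring A] [Algebra F A]
    (𝒜 : G → Submodule F A) (I : TwoSidedIdeal A) : Prop :=
  ∀ x : ⨁ g, 𝒜 g, DirectSum.coeAddMonoidHom 𝒜 x ∈ I → ∀ g, ((x g : A) ∈ I)

/-- A `G`-graded algebra `A` over `F` is *graded-central-simple* if
`Z(A) ∩ A_e = F·1`, `A² ≠ 0`, and the only graded two-sided ideals of `A` are `0` and `A`. -/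
def IsGradedCentralSimple {G : Type*} [Group G] [DecidableEq G]
    (F : Type*) [Field F] {A : Type*} [Ring A] [Algebra F A]
    (𝒜 : G → Submodule F A) : Prop :=
  (∀ x : A, (x ∈ 𝒜 1 ∧ ∀ y : A, x * y = y * x) ↔ x ∈ Set.range (algebraMap F A)) ∧
  (∃ x y : A, x * y ≠ 0) ∧
  (∀ I : TwoSidedIdeal A, IsGradedTwoSidedIdeal 𝒜 I → I = ⊥ ∨ I = ⊤)

section Grading

variable {G : Type*} [DecidableEq G] {F : Type*} [Field F] {A : Type*} [Ring A]
  [Algebra F A]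

/-- An internally graded module has a system of linear projections onto its components. -/
theorem DirectSum.IsInternal.exists_projections {𝒜 : G → Submodule F A}
    (h : DirectSum.IsInternal 𝒜) :
    ∃ P : G → A →ₗ[F] A, (∀ g a, P g a ∈ 𝒜 g) ∧ (∀ g, ∀ a ∈ 𝒜 g, P g a = a) ∧
      ∀ g k, k ≠ g → ∀ a ∈ 𝒜 k, P g a = 0 := by
  let e : (⨁ g, 𝒜 g) ≃ₗ[F] A := LinearEquiv.ofBijective (DirectSum.coeLinearMap 𝒜) h
  have he (g : G) (a : 𝒜 g) : e.symm (a : A) = DirectSum.lof F G (fun g => 𝒜 g) g a := by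
    rw [LinearEquiv.symm_apply_eq]
    exact (DirectSum.coeLinearMap_lof 𝒜 g a).symm
  refine ⟨fun g => (𝒜 g).subtype ∘ₗ DirectSum.component F G (fun g => 𝒜 g) g ∘ₗ
    e.symm.toLinearMap, fun g a => Submodule.coe_mem _, fun g a ha => ?_, fun g k hk a ha => ?_⟩
  · simp [he g ⟨a, ha⟩, DirectSum.component.lof_self]
  · simp [he k ⟨a, ha⟩, DirectSum.component.of, hk]

/-- With a system of projections onto the components at hand, a two-sided ideal is graded iff it
is stable under these projections. -/
theorem isGradedTwoSidedIdeal_iff [Group G] {𝒜 : G → Submodule F A} {P : G → A →ₗ[F] A}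
    (hself : ∀ g, ∀ a ∈ 𝒜 g, P g a = a) (hne : ∀ g k, k ≠ g → ∀ a ∈ 𝒜 k, P g a = 0)
    (hsurj : Function.Surjective (DirectSum.coeAddMonoidHom 𝒜)) (I : TwoSidedIdeal A) :
    IsGradedTwoSidedIdeal 𝒜 I ↔ ∀ a ∈ I, ∀ g, P g a ∈ I := by
  have key (g : G) (x : ⨁ g, 𝒜 g) : P g (DirectSum.coeAddMonoidHom 𝒜 x) = x g := by
    induction x using DirectSum.induction_on with
    | zero => simp
    | of k a =>
      rw [DirectSum.coeAddMonoidHom_of]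
      by_cases hk : k = g
      · subst hk
        rw [hself k a a.2, DirectSum.of_eq_same]
      · rw [hne g k hk a a.2, DirectSum.of_eq_of_ne _ _ _ (Ne.symm hk), Submodule.coe_zero]
    | add x y hx hy => rw [map_add, map_add, hx, hy, DirectSum.add_apply, Submodule.coe_add]
  constructor
  · intro hI a ha g
    obtain ⟨x, rfl⟩ := hsurj a
    rw [key]
    exact hI x ha g
  · intro hI x hx g
    rw [← key]
    exact hI _ hx g

end Grading

section BaseChange

variable {F K A ι : Type*} [Field F] [Field K] [Algebra F K] [DecidableEq ι]
  (b : Module.Basis ι F K)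

section Module

variable [AddCommGroup A] [Module F A]

theorem coord_smul_mem {p : Submodule F A}
    {w : K ⊗[F] A} (hw : ∀ i, TensorProduct.equivFinsuppOfBasisLeft b w i ∈ p) (k : K) (i : ι) :
    TensorProduct.equivFinsuppOfBasisLeft b (k • w) i ∈ p := by
  rw [← (TensorProduct.equivFinsuppOfBasisLeft b).symm_apply_apply w,
    TensorProduct.equivFinsuppOfBasisLeft_symm_apply, Finsupp.sum, Finset.smul_sum, map_sum,
    Finsupp.finsetSum_apply]
  refine p.sum_mem fun j _ => ?_
  rw [TensorProduct.smul_tmul', TensorProduct.equivFinsuppOfBasisLeft_apply_tmul_apply]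
  exact p.smul_mem _ (hw j)

theorem mem_baseChange_iff_coord (p : Submodule F A) (w : K ⊗[F] A) :
    w ∈ p.baseChange K ↔ ∀ i, TensorProduct.equivFinsuppOfBasisLeft b w i ∈ p := by
  constructor
  · intro hw
    rw [Submodule.baseChange_eq_span] at hw
    induction hw using Submodule.span_induction with
    | mem x hx =>
      obtain ⟨a, ha, rfl⟩ := hx
      intro i
      rw [TensorProduct.mk_apply, TensorProduct.equivFinsuppOfBasisLeft_apply_tmul_apply]
      exact p.smul_mem _ ha
    | zero => simp
    | add x y _ _ hx hy =>
      intro i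
      rw [map_add, Finsupp.add_apply]
      exact p.add_mem (hx i) (hy i)
    | smul k x _ hx => exact coord_smul_mem b hx k
  · intro hw
    rw [← (TensorProduct.equivFinsuppOfBasisLeft b).symm_apply_apply w,
      TensorProduct.equivFinsuppOfBasisLeft_symm_apply]
    exact Submodule.sum_mem _ fun i _ => Submodule.tmul_mem_baseChange_of_mem _ (hw i)

theorem one_tmul_mem_baseChange_iff (p : Submodule F A) (a : A) :
    (1 : K) ⊗ₜ[F] a ∈ p.baseChange K ↔ a ∈ p := by
  classical
  refine ⟨fun h => ?_, Submodule.tmul_mem_baseChange_of_mem 1⟩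
  let b := Module.Basis.ofVectorSpace F K
  rw [mem_baseChange_iff_coord b] at h
  obtain ⟨i, hi⟩ : ∃ i, b.repr 1 i ≠ 0 := by
    by_contra! h0
    exact one_ne_zero (b.repr.map_eq_zero_iff.1 (Finsupp.ext h0))
  have := h i
  rw [TensorProduct.equivFinsuppOfBasisLeft_apply_tmul_apply] at this
  exact (p.smul_mem_iff hi).1 this

theorem coord_baseChange (f : A →ₗ[F] A) (w : K ⊗[F] A) (i : ι) :
    TensorProduct.equivFinsuppOfBasisLeft b (f.baseChange K w) i =
      f (TensorProduct.equivFinsuppOfBasisLeft b w i) := by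
  induction w with
  | zero => simp
  | tmul k a => simp only [LinearMap.baseChange_tmul,
      TensorProduct.equivFinsuppOfBasisLeft_apply_tmul_apply, map_smul]
  | add x y hx hy => simp only [map_add, Finsupp.add_apply, hx, hy]

end Module

section Ring

variable [Ring A] [Algebra F A]

theorem coord_one_tmul_mul (y : A) (w : K ⊗[F] A) (i : ι) :
    TensorProduct.equivFinsuppOfBasisLeft b ((1 ⊗ₜ y) * w) i =
      y * TensorProduct.equivFinsuppOfBasisLeft b w i := by
  induction w with
  | zero => simp
  | tmul k a => simp only [Algebra.TensorProduct.tmul_mul_tmul, one_mul,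
      TensorProduct.equivFinsuppOfBasisLeft_apply_tmul_apply, mul_smul_comm]
  | add u v hu hv => simp only [map_add, mul_add, Finsupp.add_apply, hu, hv]

theorem coord_mul_one_tmul (y : A) (w : K ⊗[F] A) (i : ι) :
    TensorProduct.equivFinsuppOfBasisLeft b (w * (1 ⊗ₜ y)) i =
      TensorProduct.equivFinsuppOfBasisLeft b w i * y := by
  induction w with
  | zero => simp
  | tmul k a => simp only [Algebra.TensorProduct.tmul_mul_tmul, mul_one,
      TensorProduct.equivFinsuppOfBasisLeft_apply_tmul_apply, smul_mul_assoc]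
  | add u v hu hv => simp only [map_add, add_mul, Finsupp.add_apply, hu, hv]

theorem mul_comm_iff_coord (w : K ⊗[F] A) :
    (∀ z, w * z = z * w) ↔
      ∀ i y, TensorProduct.equivFinsuppOfBasisLeft b w i * y =
        y * TensorProduct.equivFinsuppOfBasisLeft b w i := by
  constructor
  · intro h i y
    rw [← coord_one_tmul_mul, ← coord_mul_one_tmul, h]
  · intro h z
    have h1 (y : A) : w * (1 ⊗ₜ y) = (1 ⊗ₜ y) * w := by
      apply (TensorProduct.equivFinsuppOfBasisLeft b).injective
      ext i
      rw [coord_one_tmul_mul, coord_mul_one_tmul, h]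
    induction z with
    | zero => simp
    | tmul k a =>
      have : k ⊗ₜ[F] a = k • ((1 : K) ⊗ₜ[F] a) := by
        rw [TensorProduct.smul_tmul', smul_eq_mul, mul_one]
      rw [this, mul_smul_comm, smul_mul_assoc, h1]
    | add u v hu hv => rw [mul_add, add_mul, hu, hv]

theorem mem_range_algebraMap_iff_mem_span {R B : Type*} [Field R] [Ring B] [Algebra R B] (x : B) :
    x ∈ Set.range (algebraMap R B) ↔ x ∈ Submodule.span R {(1 : B)} := by
  simp [Submodule.mem_span_singleton, Algebra.algebraMap_eq_smul_one]

theorem mem_range_algebraMap_iff_coord (w : K ⊗[F] A) :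
    w ∈ Set.range (algebraMap K (K ⊗[F] A)) ↔
      ∀ i, TensorProduct.equivFinsuppOfBasisLeft b w i ∈ Set.range (algebraMap F A) := by
  simp only [mem_range_algebraMap_iff_mem_span, ← mem_baseChange_iff_coord b,
    Submodule.baseChange_span, Set.image_singleton, TensorProduct.mk_apply,
    Algebra.TensorProduct.one_def]

theorem TwoSidedIdeal.smul_mem_of_algebra {R B : Type*} [Field R] [Ring B] [Algebra R B]
    (I : TwoSidedIdeal B) (r : R) {x : B} (hx : x ∈ I) : r • x ∈ I := by
  rw [Algebra.smul_def]
  exact I.mul_mem_left _ _ hx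

/-- The scalar extension of a two-sided ideal. -/
theorem exists_baseChange_twoSidedIdeal (I : TwoSidedIdeal A) :
    ∃ (p : Submodule F A) (J : TwoSidedIdeal (K ⊗[F] A)),
      (∀ a, a ∈ p ↔ a ∈ I) ∧ ∀ w, w ∈ J ↔ w ∈ p.baseChange K := by
  classical
  let p : Submodule F A :=
    { carrier := I
      add_mem' := I.add_mem
      zero_mem' := I.zero_mem
      smul_mem' := fun r _ hx => I.smul_mem_of_algebra r hx }
  have hp (a : A) : a ∈ p ↔ a ∈ I := Iff.rfl
  let b := Module.Basis.ofVectorSpace F K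
  have hpure (k : K) (a : A) : k ⊗ₜ[F] a = k • ((1 : K) ⊗ₜ[F] a) := by
    rw [TensorProduct.smul_tmul', smul_eq_mul, mul_one]
  refine ⟨p, TwoSidedIdeal.mk' (p.baseChange K : Set (K ⊗[F] A)) (zero_mem _) (add_mem)
    (neg_mem) ?_ ?_, hp, fun w => TwoSidedIdeal.mem_mk' _ _ _ _ _ _ _⟩
  · intro z w hw
    induction z with
    | zero => rw [zero_mul]; exact zero_mem _
    | tmul k a =>
      rw [hpure, smul_mul_assoc]
      refine Submodule.smul_mem _ _ ((mem_baseChange_iff_coord b p _).2 fun i => ?_)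
      rw [coord_one_tmul_mul]
      exact I.mul_mem_left _ _ ((mem_baseChange_iff_coord b p _).1 hw i)
    | add u v hu hv => rw [add_mul]; exact add_mem hu hv
  · intro w z hw
    induction z with
    | zero => rw [mul_zero]; exact zero_mem _
    | tmul k a =>
      rw [hpure, mul_smul_comm]
      refine Submodule.smul_mem _ _ ((mem_baseChange_iff_coord b p _).2 fun i => ?_)
      rw [coord_mul_one_tmul]
      exact I.mul_mem_right _ _ ((mem_baseChange_iff_coord b p _).1 hw i)
    | add u v hu hv => rw [mul_add]; exact add_mem hu hv

/-- The `i`-th coordinates of the elements of a two-sided ideal of `K ⊗ A` whose coordinates are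
supported in `s` form a two-sided ideal of `A`. -/
theorem exists_coord_twoSidedIdeal (J : TwoSidedIdeal (K ⊗[F] A)) (s : Finset ι) (i : ι) :
    ∃ I : TwoSidedIdeal A, ∀ a, a ∈ I ↔
      ∃ w ∈ J, (∀ j ∉ s, TensorProduct.equivFinsuppOfBasisLeft b w j = 0) ∧
        TensorProduct.equivFinsuppOfBasisLeft b w i = a := by
  refine ⟨TwoSidedIdeal.mk' {a | ∃ w ∈ J,
      (∀ j ∉ s, TensorProduct.equivFinsuppOfBasisLeft b w j = 0) ∧
        TensorProduct.equivFinsuppOfBasisLeft b w i = a} ?_ ?_ ?_ ?_ ?_,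
    fun a => TwoSidedIdeal.mem_mk' _ _ _ _ _ _ _⟩
  · exact ⟨0, J.zero_mem, by simp, by simp⟩
  · rintro _ _ ⟨u, hu, hus, rfl⟩ ⟨v, hv, hvs, rfl⟩
    exact ⟨u + v, J.add_mem hu hv,
      fun j hj => by rw [map_add, Finsupp.add_apply, hus j hj, hvs j hj, add_zero], by simp⟩
  · rintro _ ⟨u, hu, hus, rfl⟩
    exact ⟨-u, J.neg_mem hu, fun j hj => by rw [map_neg, Finsupp.neg_apply, hus j hj, neg_zero],
      by simp⟩
  · rintro y _ ⟨u, hu, hus, rfl⟩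
    exact ⟨(1 ⊗ₜ y) * u, J.mul_mem_left _ _ hu,
      fun j hj => by rw [coord_one_tmul_mul, hus j hj, mul_zero], coord_one_tmul_mul b y u i⟩
  · rintro _ y ⟨u, hu, hus, rfl⟩
    exact ⟨u * (1 ⊗ₜ y), J.mul_mem_right _ _ hu,
      fun j hj => by rw [coord_mul_one_tmul, hus j hj, zero_mul], coord_mul_one_tmul b y u i⟩

end Ring

end BaseChange

section GradedBaseChange

variable {G : Type*} [DecidableEq G] {F : Type*} [Field F] {A : Type*} [Ring A]
  [Algebra F A] (K : Type*) [Field K] [Algebra F K] {𝒜 : G → Submodule F A}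

theorem coeAddMonoidHom_baseChange_surjective
    (h : Function.Surjective (DirectSum.coeAddMonoidHom 𝒜)) :
    Function.Surjective (DirectSum.coeAddMonoidHom fun g => (𝒜 g).baseChange K) := by
  intro w
  rw [← AddMonoidHom.mem_mrange]
  induction w with
  | zero => exact zero_mem _
  | tmul k a =>
    obtain ⟨x, rfl⟩ := h a
    induction x using DirectSum.induction_on with
    | zero => rw [map_zero, TensorProduct.tmul_zero]; exact zero_mem _
    | of g a =>
      rw [DirectSum.coeAddMonoidHom_of]
      exact ⟨DirectSum.of (fun g => (𝒜 g).baseChange K) g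
        ⟨k ⊗ₜ a, Submodule.tmul_mem_baseChange_of_mem k a.2⟩, DirectSum.coeAddMonoidHom_of _ _ _⟩
    | add x y hx hy => rw [map_add, TensorProduct.tmul_add]; exact add_mem hx hy
  | add u v hu hv => exact add_mem hu hv

/-- Stability under projections characterises graded ideals of the scalar extension as well. -/
theorem isGradedTwoSidedIdeal_baseChange_iff [Group G] {P : G → A →ₗ[F] A}
    (hself : ∀ g, ∀ a ∈ 𝒜 g, P g a = a) (hne : ∀ g k, k ≠ g → ∀ a ∈ 𝒜 k, P g a = 0)
    (hsurj : Function.Surjective (DirectSum.coeAddMonoidHom 𝒜)) (J : TwoSidedIdeal (K ⊗[F] A)) :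
    IsGradedTwoSidedIdeal (fun g => (𝒜 g).baseChange K) J ↔
      ∀ w ∈ J, ∀ g, (P g).baseChange K w ∈ J := by
  classical
  let b := Module.Basis.ofVectorSpace F K
  refine isGradedTwoSidedIdeal_iff (P := fun g => (P g).baseChange K) (fun g w hw => ?_)
    (fun g k hk w hw => ?_) (coeAddMonoidHom_baseChange_surjective K hsurj) J <;>
  apply (TensorProduct.equivFinsuppOfBasisLeft b).injective <;> ext i <;>
  rw [mem_baseChange_iff_coord b] at hw <;> rw [coord_baseChange]
  · exact hself g _ (hw i)
  · rw [hne g k hk _ (hw i), map_zero, Finsupp.zero_apply]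

/-- The homogeneous central scalars condition is invariant under scalar extension. -/
theorem center_inter_eq_baseChange_iff (p : Submodule F A) :
    (∀ x : A, (x ∈ p ∧ ∀ y : A, x * y = y * x) ↔ x ∈ Set.range (algebraMap F A)) ↔
      ∀ x : K ⊗[F] A, (x ∈ p.baseChange K ∧ ∀ y, x * y = y * x) ↔
        x ∈ Set.range (algebraMap K (K ⊗[F] A)) := by
  classical
  let b := Module.Basis.ofVectorSpace F K
  have hcoord (x : K ⊗[F] A) : (x ∈ p.baseChange K ∧ ∀ y, x * y = y * x) ↔
      ∀ i, TensorProduct.equivFinsuppOfBasisLeft b x i ∈ p ∧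
        ∀ y, TensorProduct.equivFinsuppOfBasisLeft b x i * y =
          y * TensorProduct.equivFinsuppOfBasisLeft b x i := by
    rw [mem_baseChange_iff_coord b, mul_comm_iff_coord b, forall_and]
  simp only [hcoord, mem_range_algebraMap_iff_coord b]
  constructor
  · intro h x
    simp only [h]
  · intro h x
    obtain ⟨i, -⟩ : ∃ i, b.repr 1 i ≠ 0 := by
      by_contra! h0
      exact one_ne_zero (b.repr.map_eq_zero_iff.1 (Finsupp.ext h0))
    have hb (j : _) : TensorProduct.equivFinsuppOfBasisLeft b (b i ⊗ₜ[F] x) j =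
        if i = j then x else 0 := by
      rw [TensorProduct.equivFinsuppOfBasisLeft_apply_tmul_apply, b.repr_self,
        Finsupp.single_apply]
      split_ifs <;> simp
    have h0 : (0 : A) ∈ Set.range (algebraMap F A) := ⟨0, map_zero _⟩
    have := h (b i ⊗ₜ[F] x)
    simp only [hb] at this
    constructor
    · intro hx
      have := this.1 fun j => by split_ifs <;> simp [hx.1, hx.2]
      simpa only [if_pos] using this i
    · intro hx
      have := this.2 fun j => by split_ifs <;> assumption
      simpa only [if_pos] using this i

/-- If the scalar extension has no proper nonzero graded ideals, neither does the algebra. -/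
theorem gradedSimple_of_baseChange [Group G] (hinternal : DirectSum.IsInternal 𝒜)
    (h : ∀ J : TwoSidedIdeal (K ⊗[F] A),
      IsGradedTwoSidedIdeal (fun g => (𝒜 g).baseChange K) J → J = ⊥ ∨ J = ⊤)
    (I : TwoSidedIdeal A) (hI : IsGradedTwoSidedIdeal 𝒜 I) : I = ⊥ ∨ I = ⊤ := by
  classical
  obtain ⟨P, -, hself, hne⟩ := hinternal.exists_projections
  rw [isGradedTwoSidedIdeal_iff hself hne hinternal.surjective] at hI
  obtain ⟨p, J, hp, hJ⟩ := exists_baseChange_twoSidedIdeal (F := F) (K := K) I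
  have hmem (a : A) : (1 : K) ⊗ₜ[F] a ∈ J ↔ a ∈ I := by
    rw [hJ, one_tmul_mem_baseChange_iff, hp]
  let b := Module.Basis.ofVectorSpace F K
  refine (h J ?_).imp (fun hbot => ?_) fun htop => ?_
  · rw [isGradedTwoSidedIdeal_baseChange_iff K hself hne hinternal.surjective]
    intro w hw g
    rw [hJ, mem_baseChange_iff_coord b] at hw ⊢
    intro i
    rw [coord_baseChange, hp]
    exact hI _ ((hp _).1 (hw i)) g
  · rw [eq_bot_iff]
    intro a ha
    rw [← hmem, hbot, TwoSidedIdeal.mem_bot] at ha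
    have h0 : (1 : K) ⊗ₜ[F] a ∈ (⊥ : Submodule F A).baseChange K := by
      rw [ha]; exact zero_mem _
    rw [one_tmul_mem_baseChange_iff, Submodule.mem_bot] at h0
    exact (TwoSidedIdeal.mem_bot A).2 h0
  · rw [← TwoSidedIdeal.one_mem_iff, ← hmem, htop]
    exact trivial

/-- A graded-central-simple algebra has no proper nonzero graded ideals after scalar extension. -/
theorem gradedSimple_baseChange [Group G] (hinternal : DirectSum.IsInternal 𝒜) (hone : (1 : A) ∈ 𝒜 1)
    (h : IsGradedCentralSimple F 𝒜) (J : TwoSidedIdeal (K ⊗[F] A))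
    (hJ : IsGradedTwoSidedIdeal (fun g => (𝒜 g).baseChange K) J) : J = ⊥ ∨ J = ⊤ := by
  classical
  obtain ⟨hcentral, ⟨x, y, hxy⟩, hsimple⟩ := h
  have : Nontrivial A := nontrivial_of_ne _ _ hxy
  obtain ⟨P, hP, hself, hne⟩ := hinternal.exists_projections
  rw [isGradedTwoSidedIdeal_baseChange_iff K hself hne hinternal.surjective] at hJ
  let b := Module.Basis.ofVectorSpace F K
  let E : K ⊗[F] A ≃ₗ[F] _ →₀ A := TensorProduct.equivFinsuppOfBasisLeft b
  refine or_iff_not_imp_left.2 fun hbot => ?_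
  obtain ⟨z, ⟨hzJ, hz0⟩, hzmin⟩ : ∃ z, (z ∈ J ∧ z ≠ 0) ∧
      ∀ w, (w ∈ J ∧ w ≠ 0) → (E z).support.card ≤ (E w).support.card := by
    have hex : {z | z ∈ J ∧ z ≠ 0}.Nonempty := by
      by_contra! hempty
      refine hbot (eq_bot_iff.2 fun z hz => ?_)
      by_contra hz0
      exact Set.eq_empty_iff_forall_notMem.1 hempty z ⟨hz, hz0⟩
    obtain ⟨z, hz, hmin⟩ := exists_minimalFor_of_wellFoundedLT
      (fun z => z ∈ J ∧ z ≠ 0) (fun z => (E z).support.card) hex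
    exact ⟨z, hz, fun w hw => (le_total _ _).elim id (hmin hw)⟩
  obtain ⟨i, hi⟩ : ∃ i, E z i ≠ 0 := by
    by_contra! h0
    exact hz0 (E.map_eq_zero_iff.1 (Finsupp.ext h0))
  obtain ⟨I, hI⟩ := exists_coord_twoSidedIdeal b J (E z).support i
  have hIgr : IsGradedTwoSidedIdeal 𝒜 I := by
    rw [isGradedTwoSidedIdeal_iff hself hne hinternal.surjective]
    intro a ha g
    rw [hI] at ha ⊢
    obtain ⟨w, hw, hws, rfl⟩ := ha
    exact ⟨(P g).baseChange K w, hJ w hw g,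
      fun j hj => by rw [coord_baseChange, hws j hj, map_zero], coord_baseChange b _ _ _⟩
  have hItop : I = ⊤ := by
    refine (hsimple I hIgr).resolve_left fun hb => hi ?_
    have : E z i ∈ I := (hI _).2 ⟨z, hzJ, fun j hj => Finsupp.notMem_support_iff.1 hj, rfl⟩
    rwa [hb, TwoSidedIdeal.mem_bot] at this
  obtain ⟨w₀, hw₀, hw₀s, hw₀i⟩ := (hI 1).1 (hItop ▸ trivial)
  obtain ⟨w, hwJ, hws, hwi, hw1⟩ : ∃ w ∈ J, (∀ j ∉ (E z).support, E w j = 0) ∧ E w i = 1 ∧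
      ∀ j, E w j ∈ 𝒜 1 := by
    refine ⟨(P 1).baseChange K w₀, hJ w₀ hw₀ 1, fun j hj => ?_, ?_, fun j => ?_⟩ <;>
    simp only [E, coord_baseChange]
    · rw [hw₀s j hj, map_zero]
    · rw [hw₀i, hself 1 1 hone]
    · exact hP _ _
  have hcomm (y : A) : w * (1 ⊗ₜ y) - (1 ⊗ₜ y) * w = 0 := by
    by_contra hne0
    have hcoord (j) : E (w * (1 ⊗ₜ y) - (1 ⊗ₜ y) * w) j = E w j * y - y * E w j := by
      simp only [E]
      rw [map_sub, Finsupp.sub_apply, coord_mul_one_tmul, coord_one_tmul_mul]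
    refine (hzmin _ ⟨J.sub_mem (J.mul_mem_right _ _ hwJ) (J.mul_mem_left _ _ hwJ), hne0⟩).not_gt
      (Finset.card_lt_card ((Finset.ssubset_iff_of_subset fun j hj => ?_).2
        ⟨i, Finsupp.mem_support_iff.2 hi, ?_⟩))
    · by_contra hjs
      rw [Finsupp.mem_support_iff, hcoord, hws j hjs] at hj
      simp at hj
    · rw [Finsupp.notMem_support_iff, hcoord, hwi, one_mul, mul_one, sub_self]
  obtain ⟨k, rfl⟩ : w ∈ Set.range (algebraMap K (K ⊗[F] A)) := by
    rw [mem_range_algebraMap_iff_coord b]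
    refine fun j => (hcentral _).1 ⟨hw1 j, fun y => ?_⟩
    rw [← coord_one_tmul_mul, ← coord_mul_one_tmul, sub_eq_zero.1 (hcomm y)]
  have hk : k ≠ 0 := by
    rintro rfl
    simp at hwi
  rw [← TwoSidedIdeal.one_mem_iff]
  have := J.mul_mem_left (algebraMap K _ k⁻¹) _ hwJ
  rwa [← map_mul, inv_mul_cancel₀ hk, map_one] at this

end GradedBaseChange

/-- Graded-central-simplicity is invariant under scalar extension:
for a unital `G`-graded algebra `A` over a field `F` and any field extension `K/F`,
`A` is graded-central-simple over `F` iff `K ⊗_F A` (with components `K ⊗_F A_g`)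
is graded-central-simple over `K`. -/
theorem stmt2 {G : Type*} [Group G] [DecidableEq G]
    {F : Type*} [Field F] {A : Type*} [Ring A] [Algebra F A]
    (K : Type*) [Field K] [Algebra F K]
    (𝒜 : G → Submodule F A)
    (hinternal : DirectSum.IsInternal 𝒜)
    (hone : (1 : A) ∈ 𝒜 1)
    (hmul : ∀ {g h : G} {x y : A}, x ∈ 𝒜 g → y ∈ 𝒜 h → x * y ∈ 𝒜 (g * h)) :
    IsGradedCentralSimple F 𝒜 ↔
      IsGradedCentralSimple K (fun g => (𝒜 g).baseChange K) := by
  constructor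
  · rintro h
    obtain ⟨x, y, hxy⟩ := h.2.1
    have : Nontrivial A := nontrivial_of_ne _ _ hxy
    exact ⟨(center_inter_eq_baseChange_iff K (𝒜 1)).1 h.1, ⟨1, 1, by simp⟩,
      gradedSimple_baseChange K hinternal hone h⟩
  · rintro ⟨hcentral, ⟨x, y, hxy⟩, hsimple⟩
    have : Nontrivial A := by
      by_contra hA
      rw [not_nontrivial_iff_subsingleton] at hA
      exact hxy (Subsingleton.elim _ _)
    exact ⟨(center_inter_eq_baseChange_iff K (𝒜 1)).2 hcentral, ⟨1, 1, by simp⟩,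
      gradedSimple_of_baseChange K hinternal hsimple⟩
end

section
/- Let E be a finite-dimensional graded-division algebra with support K over a field L with Z(E)_e = L. Suppose L is a finite Galois extension of a field F, and T is a group containing K as a normal subgroup together with a fixed isomorphism T/K ≅ Gal(L/F). Consider E as a T-graded algebra and let V = ⊕_{σ∈Gal(L/F)} V_σ be the direct sum of graded right E-modules of rank 1, one from each of the [T:K] isomorphism classes, labeled so that Supp(V_σ) is the coset of K in T corresponding to σ^{-1}. Let D̃ := End_E(V) with the grading in which r is homogeneous of degree g iff r(V_h) ⊆ V_{gh} for all h. Suppose D̃ admits a Galois descent datum σ ↦ ψ_σ (a group homomorphism Gal(L/F) → Aut_F^T(D̃) with ψ_σ(xλ) = ψ_σ(x)σ(λ) for x ∈ D̃, λ ∈ L) such that each ψ_σ has the form ψ_σ(r) = ψ_σ^1 r (ψ_σ^1)^{-1} for an additive bijection ψ_σ^1 of V satisfying ψ_σ^1(V_τ) = V_{στ} for all σ,τ ∈ Gal(L/F). Then the F-form D of D̃ determined by this descent (the set of common fixed points of all ψ_σ) is a graded-division algebra over F with support T and Z(D) ∩ D_e = F·1; moreover, L is isomorphic to a subfield of Z(D_e)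 and E ≅ D_K = ⊕_{t∈K} D_t as graded F-algebras. -/
noncomputable section

section Defs

variable {T : Type*} [Group T]
variable {E : Type*} [Ring E]
variable {V : Type*} [AddCommGroup V] [Module Eᵐᵒᵖ V]

/-- The degree-`t` homogeneous component of `End_E(V)`:
operators `r` with `r(V_h) ⊆ V_{t h}` for all `h`. -/
def homogPart (Vcomp : T → AddSubgroup V) (t : T) :
    AddSubgroup (Module.End Eᵐᵒᵖ V) where
  carrier := {r | ∀ (h : T) (v : V), v ∈ Vcomp h → r v ∈ Vcomp (t * h)}
  zero_mem' := by
    intro h v hv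
    simpa using (Vcomp (t * h)).zero_mem
  add_mem' := by
    intro r s hr hs h v hv
    simpa using (Vcomp (t * h)).add_mem (hr h v hv) (hs h v hv)
  neg_mem' := by
    intro r hr h v hv
    simpa using (Vcomp (t * h)).neg_mem (hr h v hv)

/-- The subring of common fixed points of a family of ring automorphisms of `End_E(V)`
(the `F`-form determined by a Galois descent datum). -/
def fixedSubring {Γ : Type*} [Group Γ] (ψ : Γ →* RingAut (Module.End Eᵐᵒᵖ V)) :
    Subring (Module.End Eᵐᵒᵖ V) where
  carrier := {r | ∀ σ : Γ, ψ σ r = r}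
  one_mem' := by intro σ; simp
  zero_mem' := by intro σ; simp
  mul_mem' := by intro a b ha hb σ; simp [map_mul, ha σ, hb σ]
  add_mem' := by intro a b ha hb σ; simp [map_add, ha σ, hb σ]
  neg_mem' := by intro a ha σ; simp [map_neg, ha σ]

end Defs

/-- Induction on a vector through its expansion in a basis. -/
theorem basis_induction {ι R V : Type*} [Ring R] [AddCommGroup V] [Module R V]
    (B : Module.Basis ι R V) {p : V → Prop} (v : V) (zero : p 0)
    (add : ∀ a b, p a → p b → p (a + b)) (smul : ∀ (a : R) (i : ι), p (a • B i)) : p v := by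
  rw [← B.repr.symm_apply_apply v]
  induction B.repr v using Finsupp.induction_linear with
  | zero => simp [zero]
  | add f g hf hg => rw [map_add]; exact add _ _ hf hg
  | single i a => simpa using smul a i

/-- A family of vectors with unique coordinates in `E`, acting from the right, is a basis. -/
theorem exists_basis_of_bijective {ι E V : Type*} [Ring E] [AddCommGroup V] [Module Eᵐᵒᵖ V]
    (b : ι → V)
    (hb : Function.Bijective fun c : ι →₀ E => c.sum fun i a => MulOpposite.op a • b i) :
    ∃ B : Module.Basis ι Eᵐᵒᵖ V, ∀ i, B i = b i := by
  have hbij : Function.Bijective (Finsupp.linearCombination Eᵐᵒᵖ b) := by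
    have : (Finsupp.linearCombination Eᵐᵒᵖ b : (ι →₀ Eᵐᵒᵖ) → V) =
        (fun c : ι →₀ E => c.sum fun i a => MulOpposite.op a • b i) ∘
          (Finsupp.mapRange.addEquiv (MulOpposite.opAddEquiv (α := E)).symm) := by
      funext c
      simp [Finsupp.linearCombination_apply, Finsupp.sum_mapRange_index]
    rw [this]
    exact hb.comp (Equiv.bijective _)
  refine ⟨Module.Basis.ofRepr (LinearEquiv.ofBijective _ hbij).symm, fun i => ?_⟩
  simp [Module.Basis.coe_ofRepr]

section GradedModule

open DirectSum MulOpposite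

variable {T : Type*} [Group T] [DecidableEq T]
  {E SE : Type*} [Ring E] [SetLike SE E] [AddSubmonoidClass SE E]
  {V SV : Type*} [AddCommGroup V] [Module Eᵐᵒᵖ V] [SetLike SV V] [AddSubmonoidClass SV V]

/-- Projecting `v x`, with `v` homogeneous, onto a component amounts to projecting `x`. -/
theorem coe_decompose_op_smul (Ecomp : T → SE) [Decomposition Ecomp]
    (Vcomp : T → SV) [Decomposition Vcomp]
    (hVsmul : ∀ {h g : T} {v : V} {x : E}, v ∈ Vcomp h → x ∈ Ecomp g →
      op x • v ∈ Vcomp (h * g))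
    {k : T} {v : V} (hv : v ∈ Vcomp k) (x : E) (h : T) :
    (decompose Vcomp (op x • v) h : V) = op (decompose Ecomp x (k⁻¹ * h) : E) • v := by
  induction x using Decomposition.inductionOn Ecomp with
  | zero => simp
  | @homogeneous g m =>
    by_cases hg : h = k * g
    · subst hg
      rw [decompose_of_mem_same Vcomp (hVsmul hv m.2)]
      have : k⁻¹ * (k * g) = g := by group
      rw [this, decompose_coe, of_eq_same]
    · rw [decompose_of_mem_ne Vcomp (hVsmul hv m.2) (Ne.symm hg),
        decompose_of_mem_ne Ecomp m.2 (by rintro rfl; exact hg (by group))]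
      simp
  | add a b ha hb => simp [add_smul, ha, hb]

/-- The inverse of an invertible homogeneous element is homogeneous of inverse degree. -/
theorem mem_inv_of_mul_eq_one (Ecomp : T → SE) [Decomposition Ecomp]
    (hEone : (1 : E) ∈ Ecomp 1)
    (hEmul : ∀ {g h : T} {x y : E}, x ∈ Ecomp g → y ∈ Ecomp h → x * y ∈ Ecomp (g * h))
    {g : T} {x y : E} (hx : x ∈ Ecomp g) (hxy : x * y = 1) (hyx : y * x = 1) :
    y ∈ Ecomp g⁻¹ := by
  have key := coe_decompose_op_smul Ecomp Ecomp (fun h1 h2 => hEmul h1 h2) hx y 1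
  rw [op_smul_eq_mul, hxy, decompose_of_mem_same Ecomp hEone, mul_one, op_smul_eq_mul] at key
  have : y = (decompose Ecomp y g⁻¹ : E) := by
    calc y = y * (x * (decompose Ecomp y g⁻¹ : E)) := by rw [← key, mul_one]
      _ = _ := by rw [← mul_assoc, hyx, one_mul]
  rw [this]
  exact SetLike.coe_mem _

/-- The coordinates of a homogeneous vector in a homogeneous basis are homogeneous. -/
theorem unop_repr_mem {ι : Type*} (Ecomp : T → SE) [Decomposition Ecomp]
    (Vcomp : T → SV) [Decomposition Vcomp]
    (hVsmul : ∀ {h g : T} {v : V} {x : E}, v ∈ Vcomp h → x ∈ Ecomp g →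
      op x • v ∈ Vcomp (h * g))
    (B : Module.Basis ι Eᵐᵒᵖ V) (d : ι → T) (hB : ∀ i, B i ∈ Vcomp (d i))
    {h : T} {w : V} (hw : w ∈ Vcomp h) (i : ι) :
    unop (B.repr w i) ∈ Ecomp ((d i)⁻¹ * h) := by
  have main : ∀ v : V, B.repr (decompose Vcomp v h : V) i =
      op (decompose Ecomp (unop (B.repr v i)) ((d i)⁻¹ * h) : E) := by
    intro v
    induction v using basis_induction B with
    | zero => simp
    | add a b ha hb => simp [ha, hb]
    | smul a j =>
      rw [← op_unop a, coe_decompose_op_smul Ecomp Vcomp hVsmul (hB j)]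
      by_cases hij : j = i
      · subst hij; simp
      · simp [Finsupp.single_eq_of_ne (Ne.symm hij)]
  have := main w
  rw [decompose_of_mem_same Vcomp hw] at this
  rw [this, unop_op]
  exact SetLike.coe_mem _

end GradedModule

section ElementaryEnd

variable {Γ R V : Type*} [Ring R] [AddCommGroup V] [Module R V] [DecidableEq Γ]

/-- The endomorphism sending the basis vector of index `σ` to `v` and the others to `0`. -/
def elementaryEnd (B : Module.Basis Γ R V) (σ : Γ) (v : V) : Module.End R V :=
  B.constr ℕ (Pi.single σ v)

theorem elementaryEnd_apply (B : Module.Basis Γ R V) (σ : Γ) (v w : V) :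
    elementaryEnd B σ v w = B.repr w σ • v := by
  rw [elementaryEnd, Module.Basis.constr_apply, Finsupp.sum]
  by_cases h : σ ∈ (B.repr w).support
  · rw [Finset.sum_eq_single_of_mem σ h (fun j _ hj => by simp [Pi.single_eq_of_ne hj])]
    simp
  · rw [Finset.sum_eq_zero, Finsupp.notMem_support_iff.mp h, zero_smul]
    intro j hj
    have : j ≠ σ := by rintro rfl; exact h hj
    simp [Pi.single_eq_of_ne this]

theorem elementaryEnd_basis (B : Module.Basis Γ R V) (σ τ : Γ) (v : V) :
    elementaryEnd B σ v (B τ) = if τ = σ then v else 0 := by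
  simp [elementaryEnd, Module.Basis.constr_basis, Pi.single_apply]

theorem mul_elementaryEnd (B : Module.Basis Γ R V) (r : Module.End R V) (σ : Γ) (v : V) :
    r * elementaryEnd B σ v = elementaryEnd B σ (r v) := by
  ext w; simp [elementaryEnd_apply]

theorem elementaryEnd_add (B : Module.Basis Γ R V) (σ : Γ) (v w : V) :
    elementaryEnd B σ (v + w) = elementaryEnd B σ v + elementaryEnd B σ w := by
  ext; simp [elementaryEnd_apply]

/-- The projection onto the line of index `σ` along the other basis lines. -/
def lineProj (B : Module.Basis Γ R V) (σ : Γ) : Module.End R V :=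
  elementaryEnd B σ (B σ)

theorem mul_lineProj (B : Module.Basis Γ R V) (r : Module.End R V) (σ : Γ) :
    r * lineProj B σ = elementaryEnd B σ (r (B σ)) :=
  mul_elementaryEnd B r σ _

theorem elementaryEnd_mul_lineProj (B : Module.Basis Γ R V) (σ τ : Γ) (v : V) :
    elementaryEnd B σ v * lineProj B τ = if τ = σ then elementaryEnd B σ v else 0 := by
  rw [mul_lineProj, elementaryEnd_basis]
  split_ifs with h
  · rw [h]
  · ext; simp [elementaryEnd_apply]

theorem sum_lineProj [Fintype Γ] (B : Module.Basis Γ R V) : ∑ σ, lineProj B σ = 1 := by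
  refine B.ext fun τ => ?_
  simp [lineProj, elementaryEnd_basis, LinearMap.sum_apply]

/-- Conjugation by an additive bijection permuting the basis lines permutes the projections
onto these lines. -/
theorem conj_lineProj [Group Γ] [Fintype Γ] (B : Module.Basis Γ R V) (σ : Γ)
    (f : Module.End R V → Module.End R V) (u : V ≃+ V)
    (hf : ∀ (r : Module.End R V) (v : V), f r (u v) = u (r v))
    (hu : ∀ (τ : Γ) (a : R), ∃ a' : R, u (a • B τ) = a' • B (σ * τ)) (τ : Γ) :
    f (lineProj B τ) = lineProj B (σ * τ) := by
  have hline : ∀ (a : R) (ρ : Γ),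
      u (lineProj B τ (a • B ρ)) = lineProj B (σ * τ) (u (a • B ρ)) := by
    intro a ρ
    obtain ⟨a', ha'⟩ := hu ρ a
    rw [ha', LinearMap.map_smul, LinearMap.map_smul, lineProj, lineProj, elementaryEnd_basis,
      elementaryEnd_basis]
    by_cases h : ρ = τ
    · subst h; simp [ha']
    · simp [h]
  ext v
  obtain ⟨w, rfl⟩ := u.surjective v
  rw [hf]
  induction w using basis_induction B with
  | zero => simp
  | add a b ha hb => simp only [map_add, ha, hb]
  | smul a ρ => exact hline a ρ

end ElementaryEnd

section OrbitSum

variable {Γ R V : Type*} [Ring R] [AddCommGroup V] [Module R V]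
  [Group Γ] [Fintype Γ]

/-- The sum of all translates of `r` under the action `ψ`. -/
def orbitSum {A : Type*} [Ring A] (ψ : Γ →* RingAut A) : A →+ A :=
  ∑ σ, (ψ σ : A ≃+* A).toAddEquiv.toAddMonoidHom

theorem orbitSum_apply {A : Type*} [Ring A] (ψ : Γ →* RingAut A) (r : A) :
    orbitSum ψ r = ∑ σ, ψ σ r := by
  simp [orbitSum]

theorem map_orbitSum {A : Type*} [Ring A] (ψ : Γ →* RingAut A) (σ : Γ) (r : A) :
    ψ σ (orbitSum ψ r) = orbitSum ψ r := by
  simp only [orbitSum_apply, map_sum, ← RingAut.mul_apply, ← map_mul]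
  exact Fintype.sum_bijective _ (Group.mulLeft_bijective σ) _ _ fun _ => rfl

theorem orbitSum_mul {A : Type*} [Ring A] (ψ : Γ →* RingAut A) {r s : A}
    (hr : ∀ σ, ψ σ r = r) : orbitSum ψ (r * s) = r * orbitSum ψ s := by
  simp [orbitSum_apply, map_mul, hr, Finset.mul_sum]

theorem orbitSum_mul' {A : Type*} [Ring A] (ψ : Γ →* RingAut A) {r s : A}
    (hr : ∀ σ, ψ σ r = r) : orbitSum ψ (s * r) = orbitSum ψ s * r := by
  simp [orbitSum_apply, map_mul, hr, Finset.sum_mul]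

theorem orbitSum_lineProj [DecidableEq Γ] (B : Module.Basis Γ R V)
    (ψ : Γ →* RingAut (Module.End R V))
    (hψ : ∀ σ τ, ψ σ (lineProj B τ) = lineProj B (σ * τ)) (τ : Γ) :
    orbitSum ψ (lineProj B τ) = 1 := by
  rw [orbitSum_apply, ← sum_lineProj B]
  simp only [hψ]
  exact Fintype.sum_bijective _ (Group.mulRight_bijective τ) _ _ fun _ => rfl

/-- A fixed endomorphism is recovered from its restriction to the first line. -/
theorem orbitSum_elementaryEnd_self [DecidableEq Γ] (B : Module.Basis Γ R V)
    (ψ : Γ →* RingAut (Module.End R V))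
    (hψ : ∀ σ τ, ψ σ (lineProj B τ) = lineProj B (σ * τ))
    {r : Module.End R V} (hr : ∀ σ, ψ σ r = r) :
    orbitSum ψ (elementaryEnd B 1 (r (B 1))) = r := by
  rw [← mul_lineProj, orbitSum_mul ψ hr, orbitSum_lineProj B ψ hψ, mul_one]

theorem orbitSum_elementaryEnd_basis [DecidableEq Γ] (B : Module.Basis Γ R V)
    (ψ : Γ →* RingAut (Module.End R V))
    (hψ : ∀ σ τ, ψ σ (lineProj B τ) = lineProj B (σ * τ)) (v : V) :
    orbitSum ψ (elementaryEnd B 1 v) (B 1) = v := by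
  have h : ∀ σ, ψ σ (elementaryEnd B 1 v) * lineProj B 1 =
      if σ = 1 then elementaryEnd B 1 v else 0 := by
    intro σ
    have h1 : lineProj B 1 = ψ σ (lineProj B σ⁻¹) := by rw [hψ]; simp
    rw [h1, ← map_mul, elementaryEnd_mul_lineProj]
    by_cases hσ : σ = 1
    · subst hσ; simp
    · simp [hσ]
  have h2 : orbitSum ψ (elementaryEnd B 1 v) * lineProj B 1 = elementaryEnd B 1 v := by
    simp [orbitSum_apply, Finset.sum_mul, h]
  have h3 := congrArg (fun f => f (B 1)) h2
  simpa [lineProj, elementaryEnd_basis] using h3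

end OrbitSum

section Homogeneous

open DirectSum MulOpposite

variable {T : Type*} [Group T] [DecidableEq T]
  {E SE : Type*} [Ring E] [SetLike SE E] [AddSubmonoidClass SE E]
  {V : Type*} [AddCommGroup V] [Module Eᵐᵒᵖ V]

theorem elementaryEnd_mem_homogPart {Γ : Type*} [DecidableEq Γ]
    (Ecomp : T → SE) [Decomposition Ecomp]
    (Vcomp : T → AddSubgroup V) [Decomposition Vcomp]
    (hVsmul : ∀ {h g : T} {v : V} {x : E}, v ∈ Vcomp h → x ∈ Ecomp g →
      op x • v ∈ Vcomp (h * g))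
    (B : Module.Basis Γ Eᵐᵒᵖ V) (d : Γ → T) (hB : ∀ i, B i ∈ Vcomp (d i))
    {t : T} {σ : Γ} {v : V} (hv : v ∈ Vcomp (t * d σ)) :
    elementaryEnd B σ v ∈ homogPart Vcomp t := by
  intro h w hw
  have h1 := unop_repr_mem Ecomp Vcomp hVsmul B d hB hw σ
  have h2 := hVsmul hv h1
  rw [elementaryEnd_apply]
  simpa [mul_assoc] using h2

/-- Every endomorphism of a graded module with a finite homogeneous basis is a sum of
homogeneous ones. -/
theorem mem_iSup_homogPart {Γ : Type*} [DecidableEq Γ] [Fintype Γ]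
    (Ecomp : T → SE) [Decomposition Ecomp]
    (Vcomp : T → AddSubgroup V) [Decomposition Vcomp]
    (hVsmul : ∀ {h g : T} {v : V} {x : E}, v ∈ Vcomp h → x ∈ Ecomp g →
      op x • v ∈ Vcomp (h * g))
    (B : Module.Basis Γ Eᵐᵒᵖ V) (d : Γ → T) (hB : ∀ i, B i ∈ Vcomp (d i))
    (r : Module.End Eᵐᵒᵖ V) : r ∈ ⨆ t, homogPart Vcomp t := by
  have hr : r = ∑ σ, elementaryEnd B σ (r (B σ)) := by
    simp_rw [← mul_lineProj]
    rw [← Finset.mul_sum, sum_lineProj, mul_one]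
  rw [hr]
  refine sum_mem fun σ _ => ?_
  induction r (B σ) using Decomposition.inductionOn Vcomp with
  | zero =>
    have : elementaryEnd B σ 0 = 0 := by ext; simp [elementaryEnd_apply]
    rw [this]; exact zero_mem _
  | @homogeneous h v =>
    refine AddSubgroup.mem_iSup_of_mem (h * (d σ)⁻¹) ?_
    refine elementaryEnd_mem_homogPart Ecomp Vcomp hVsmul B d hB ?_
    simp
  | add a b ha hb => rw [elementaryEnd_add]; exact add_mem ha hb

theorem finsupp_homogPart_eq_zero (Vcomp : T → AddSubgroup V) [Decomposition Vcomp]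
    (c : T →₀ Module.End Eᵐᵒᵖ V) (hc : ∀ t, c t ∈ homogPart Vcomp t)
    (h0 : (c.sum fun _ x => x) = 0) : c = 0 := by
  ext t v
  induction v using Decomposition.inductionOn Vcomp with
  | zero => simp
  | @homogeneous h v =>
    have h1 : (c.sum fun _ x => x) (v : V) = 0 := by rw [h0]; rfl
    rw [Finsupp.sum, LinearMap.sum_apply] at h1
    have h2 := congrArg (fun w => (decompose Vcomp w (t * h) : V)) h1
    simp only [decompose_sum, DirectSum.sum_apply, AddSubmonoidClass.coe_finsetSum] at h2
    rw [Finset.sum_eq_single t] at h2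
    · rw [decompose_of_mem_same Vcomp (hc t h _ v.2)] at h2
      simpa using h2
    · intro s _ hs
      exact decompose_of_mem_ne Vcomp (hc s h _ v.2) (fun e => hs (mul_right_cancel e))
    · intro ht
      simp [Finsupp.notMem_support_iff.mp ht]
  | add a b ha hb => rw [map_add, map_add, ha, hb]

/-- Fixed endomorphisms decompose uniquely into fixed homogeneous ones. -/
theorem existsUnique_fixed_decomposition {Γ Γ' : Type*} [DecidableEq Γ] [Fintype Γ] [Group Γ']
    (Ecomp : T → SE) [Decomposition Ecomp]
    (Vcomp : T → AddSubgroup V) [Decomposition Vcomp]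
    (hVsmul : ∀ {h g : T} {v : V} {x : E}, v ∈ Vcomp h → x ∈ Ecomp g →
      op x • v ∈ Vcomp (h * g))
    (B : Module.Basis Γ Eᵐᵒᵖ V) (d : Γ → T) (hB : ∀ i, B i ∈ Vcomp (d i))
    (ψ : Γ' →* RingAut (Module.End Eᵐᵒᵖ V))
    (hψgraded : ∀ (σ : Γ') (t : T) (r : Module.End Eᵐᵒᵖ V),
      r ∈ homogPart Vcomp t → ψ σ r ∈ homogPart Vcomp t)
    (r : Module.End Eᵐᵒᵖ V) (hr : r ∈ fixedSubring ψ) :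
    ∃! c : T →₀ Module.End Eᵐᵒᵖ V,
      (∀ t : T, c t ∈ fixedSubring ψ ∧ c t ∈ homogPart Vcomp t) ∧
      r = c.sum fun _ x => x := by
  have uniq : ∀ c c' : T →₀ Module.End Eᵐᵒᵖ V, (∀ t, c t ∈ homogPart Vcomp t) →
      (∀ t, c' t ∈ homogPart Vcomp t) → (c.sum fun _ x => x) = (c'.sum fun _ x => x) →
      c = c' := by
    intro c c' hc hc' h
    refine sub_eq_zero.mp (finsupp_homogPart_eq_zero Vcomp (c - c')
      (fun t => sub_mem (hc t) (hc' t)) ?_)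
    rw [Finsupp.sum_sub_index (fun _ _ _ => rfl), h, sub_self]
  obtain ⟨c, hc, hcr⟩ : ∃ c : T →₀ Module.End Eᵐᵒᵖ V, (∀ t, c t ∈ homogPart Vcomp t) ∧
      (c.sum fun _ x => x) = r := by
    refine AddSubgroup.iSup_induction _ (C := fun r => ∃ c : T →₀ Module.End Eᵐᵒᵖ V,
      (∀ t, c t ∈ homogPart Vcomp t) ∧ (c.sum fun _ x => x) = r)
      (mem_iSup_homogPart Ecomp Vcomp hVsmul B d hB r) ?_ ?_ ?_
    · intro t x hx
      refine ⟨Finsupp.single t x, fun s => ?_, by simp⟩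
      by_cases hs : t = s
      · subst hs; simpa using hx
      · rw [Finsupp.single_eq_of_ne (Ne.symm hs)]; exact zero_mem _
    · exact ⟨0, fun t => zero_mem _, by simp⟩
    · rintro x y ⟨c, hc, rfl⟩ ⟨c', hc', rfl⟩
      exact ⟨c + c', fun t => add_mem (hc t) (hc' t),
        Finsupp.sum_add_index' (fun _ => rfl) (fun _ _ _ => rfl)⟩
  refine ⟨c, ⟨fun t => ⟨fun σ => ?_, hc t⟩, hcr.symm⟩, fun c' h => ?_⟩
  · have : c.mapRange (ψ σ) (map_zero _) = c := by
      refine uniq _ _ (fun t => by simpa using hψgraded σ t _ (hc t)) hc ?_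
      rw [Finsupp.sum_mapRange_index (fun _ => rfl), hcr, ← map_finsuppSum, hcr]
      exact hr σ
    conv_rhs => rw [← this]
    simp
  · exact uniq _ _ (fun t => (h.1 t).2) hc (by rw [← h.2, hcr])

end Homogeneous

/-- Let `E` be a finite-dimensional graded-division algebra with support
the normal subgroup `K` of `T` over `L`, with `Z(E)_e = L`, where `L/F` is a finite
Galois extension and `θ : T/K ≅ Gal(L/F)`.  Let `V` be the direct sum of rank-one graded
right `E`-modules `V_σ` (`σ ∈ Gal(L/F)`), one from each isomorphism class, labeled so
that `Supp V_σ` is the coset corresponding to `σ⁻¹` (via a homogeneous basis `b σ` of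
degree `d σ` with `θ(d σ K) = σ⁻¹`).  Suppose `D̃ = End_E(V)` has a Galois descent datum
`σ ↦ ψ_σ` (semilinear, degree-preserving) with `ψ_σ = ψ_σ¹ ∘ – ∘ (ψ_σ¹)⁻¹` for additive
bijections `ψ_σ¹` with `ψ_σ¹(V_τ) = V_{στ}`.  Then the `F`-form `D` (the fixed points)
is a graded-division algebra over `F` with support `T` and `Z(D) ∩ D_e = F·1`; moreover
`L` embeds into `Z(D_e)` and `E ≅ D_K` as graded `F`-algebras. -/
theorem stmt4 {F L : Type*} [Field F] [Field L] [Algebra F L]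
    [IsGalois F L] [FiniteDimensional F L]
    {T : Type*} [Group T] [DecidableEq T] (K : Subgroup T) [K.Normal]
    (θ : (T ⧸ K) ≃* (L ≃ₐ[F] L))
    {E : Type*} [Ring E] [Algebra L E] [FiniteDimensional L E]
    (Ecomp : T → Submodule L E)
    (hEinternal : DirectSum.IsInternal Ecomp)
    (hEone : (1 : E) ∈ Ecomp 1)
    (hEmul : ∀ {g h : T} {x y : E}, x ∈ Ecomp g → y ∈ Ecomp h → x * y ∈ Ecomp (g * h))
    (hEdiv : ∀ (t : T), ∀ x ∈ Ecomp t, x ≠ 0 → IsUnit x)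
    (hEsupp : ∀ t : T, Ecomp t ≠ ⊥ ↔ t ∈ K)
    (hEcentral : ∀ x : E, (x ∈ Ecomp 1 ∧ ∀ y : E, x * y = y * x) ↔
      x ∈ Set.range (algebraMap L E))
    {V : Type*} [AddCommGroup V] [Module Eᵐᵒᵖ V]
    [Module L V] [SMulCommClass Eᵐᵒᵖ L V]
    (hLV : ∀ (l : L) (v : V), l • v = MulOpposite.op (algebraMap L E l) • v)
    (Vcomp : T → AddSubgroup V)
    (hVinternal : DirectSum.IsInternal Vcomp)
    (hVsmul : ∀ {h g : T} {v : V} {x : E}, v ∈ Vcomp h → x ∈ Ecomp g →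
      MulOpposite.op x • v ∈ Vcomp (h * g))
    -- the homogeneous basis `b`, one rank-one module per isomorphism class:
    (b : (L ≃ₐ[F] L) → V) (d : (L ≃ₐ[F] L) → T)
    (hd : ∀ σ : L ≃ₐ[F] L, θ (QuotientGroup.mk (d σ)) = σ⁻¹)
    (hb : ∀ σ : L ≃ₐ[F] L, b σ ∈ Vcomp (d σ))
    (hbasis : Function.Bijective fun (c : (L ≃ₐ[F] L) →₀ E) =>
      c.sum fun σ a => MulOpposite.op a • b σ)
    -- the Galois descent datum on `D̃ = End_E(V)`:
    (ψ : (L ≃ₐ[F] L) →* RingAut (Module.End Eᵐᵒᵖ V))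
    (hψsemilinear : ∀ (σ : L ≃ₐ[F] L) (l : L) (r : Module.End Eᵐᵒᵖ V),
      ψ σ (l • r) = σ l • ψ σ r)
    (hψgraded : ∀ (σ : L ≃ₐ[F] L) (t : T) (r : Module.End Eᵐᵒᵖ V),
      r ∈ homogPart Vcomp t → ψ σ r ∈ homogPart Vcomp t)
    (hform : ∀ σ : L ≃ₐ[F] L, ∃ u : V ≃+ V,
      (∀ (r : Module.End Eᵐᵒᵖ V) (v : V), (ψ σ r) (u v) = u (r v)) ∧
      (∀ τ : L ≃ₐ[F] L,
        u '' {v : V | ∃ x : E, v = MulOpposite.op x • b τ} =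
          {v : V | ∃ x : E, v = MulOpposite.op x • b (σ * τ)})) :
    -- the fixed-point `F`-form `D` is a graded-division algebra with support `T`,
    -- graded-central over `F`:
    (∀ r ∈ fixedSubring ψ, ∃! c : T →₀ Module.End Eᵐᵒᵖ V,
      (∀ t : T, c t ∈ fixedSubring ψ ∧ c t ∈ homogPart Vcomp t) ∧
      r = c.sum fun _ x => x) ∧
    (∀ t : T, ∃ r : Module.End Eᵐᵒᵖ V,
      r ∈ fixedSubring ψ ∧ r ∈ homogPart Vcomp t ∧ r ≠ 0) ∧
    (∀ (t : T) (r : Module.End Eᵐᵒᵖ V), r ∈ fixedSubring ψ → r ∈ homogPart Vcomp t →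
      r ≠ 0 → ∃ s : Module.End Eᵐᵒᵖ V, s ∈ fixedSubring ψ ∧ r * s = 1 ∧ s * r = 1) ∧
    (∀ r : Module.End Eᵐᵒᵖ V, r ∈ fixedSubring ψ → r ∈ homogPart Vcomp 1 →
      (∀ s ∈ fixedSubring ψ, r * s = s * r) →
      ∃ c : F, r = algebraMap F L c • (1 : Module.End Eᵐᵒᵖ V)) ∧
    -- `L` is isomorphic to a subfield of `Z(D_e)`:
    (∃ jL : L →+* Module.End Eᵐᵒᵖ V, Function.Injective jL ∧
      ∀ l : L, jL l ∈ fixedSubring ψ ∧ jL l ∈ homogPart Vcomp 1 ∧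
        ∀ r : Module.End Eᵐᵒᵖ V, r ∈ fixedSubring ψ → r ∈ homogPart Vcomp 1 →
          jL l * r = r * jL l) ∧
    -- `E ≅ D_K = ⨁_{t ∈ K} D_t` as graded `F`-algebras:
    (∃ Φ : E →+* Module.End Eᵐᵒᵖ V, Function.Injective Φ ∧
      (∀ x : E, Φ x ∈ fixedSubring ψ) ∧
      (∀ t ∈ K, ∀ x ∈ Ecomp t, Φ x ∈ homogPart Vcomp t) ∧
      (∀ c : F, Φ (algebraMap L E (algebraMap F L c)) =
        algebraMap F L c • (1 : Module.End Eᵐᵒᵖ V)) ∧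
      Set.range ⇑Φ =
        ↑(⨆ t ∈ K, homogPart Vcomp t ⊓ (fixedSubring ψ).toAddSubgroup)) := by
  classical
  let _ : DirectSum.Decomposition Ecomp := hEinternal.chooseDecomposition
  let _ : DirectSum.Decomposition Vcomp := hVinternal.chooseDecomposition
  obtain ⟨B, hBb⟩ := exists_basis_of_bijective b hbasis
  obtain rfl : b = B := funext fun i => (hBb i).symm
  have hψε : ∀ σ τ, ψ σ (lineProj B τ) = lineProj B (σ * τ) := by
    intro σ τ
    obtain ⟨u, hu, huline⟩ := hform σ
    refine conj_lineProj B σ (ψ σ) u hu (fun ρ a => ?_) τ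
    have h1 : u (a • B ρ) ∈ u '' {v : V | ∃ x : E, v = MulOpposite.op x • B ρ} :=
      ⟨_, ⟨a.unop, rfl⟩, rfl⟩
    rw [huline] at h1
    obtain ⟨x, hx⟩ := h1
    exact ⟨_, hx⟩
  have hmem {σ : L ≃ₐ[F] L} {v : V} {t : T} (hv : v ∈ Vcomp (t * d σ)) :
      elementaryEnd B σ v ∈ homogPart Vcomp t :=
    elementaryEnd_mem_homogPart Ecomp Vcomp hVsmul B d hb hv
  have hS {t : T} {r : Module.End Eᵐᵒᵖ V} (hr : r ∈ homogPart Vcomp t) :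
      orbitSum ψ r ∈ homogPart Vcomp t := by
    rw [orbitSum_apply]
    exact sum_mem fun σ _ => hψgraded σ t r hr
  have hSfix (r : Module.End Eᵐᵒᵖ V) : orbitSum ψ r ∈ fixedSubring ψ :=
    fun σ => map_orbitSum ψ σ r
  -- The line containing a homogeneous vector is determined by its degree.
  have hidx : ∀ (σ : L ≃ₐ[F] L) (h : T),
      (d σ)⁻¹ * h ∈ K ↔ σ = (θ (QuotientGroup.mk h))⁻¹ := by
    intro σ h
    rw [← QuotientGroup.eq, ← θ.injective.eq_iff, hd, inv_eq_iff_eq_inv]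
  have hcoord : ∀ (σ : L ≃ₐ[F] L) (h : T) (w : V), (d σ)⁻¹ * h ∈ K → w ∈ Vcomp h →
      ∃ x ∈ Ecomp ((d σ)⁻¹ * h), w = MulOpposite.op x • B σ := by
    intro σ h w hσ hw
    refine ⟨_, unop_repr_mem Ecomp Vcomp hVsmul B d hb hw σ, ?_⟩
    conv_lhs => rw [← B.sum_repr w]
    refine Finset.sum_eq_single σ (fun ρ _ hρ => ?_) (by simp)
    have h1 := unop_repr_mem Ecomp Vcomp hVsmul B d hb hw ρ
    have h2 : Ecomp ((d ρ)⁻¹ * h) = ⊥ := by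
      by_contra h3
      exact hρ (((hidx ρ h).mp ((hEsupp _).mp h3)).trans ((hidx σ h).mp hσ).symm)
    rw [h2, Submodule.mem_bot, MulOpposite.unop_eq_zero_iff] at h1
    rw [h1, zero_smul]
  have hne : ∀ t ∈ K, ∃ x ∈ Ecomp t, x ≠ 0 := fun t ht =>
    (Submodule.ne_bot_iff _).mp ((hEsupp t).mpr ht)
  have hinv : ∀ t ∈ K, ∃ x ∈ Ecomp t, ∃ y ∈ Ecomp t⁻¹, x * y = 1 ∧ y * x = 1 := by
    intro t ht
    obtain ⟨x, hx, hx0⟩ := hne t ht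
    obtain ⟨y, hxy, hyx⟩ := isUnit_iff_exists.mp (hEdiv t x hx hx0)
    exact ⟨x, hx, y, mem_inv_of_mul_eq_one Ecomp hEone hEmul hx hxy hyx, hxy, hyx⟩
  have hd1 : d 1 ∈ K := by
    have := (hidx 1 1).mpr (by simp)
    simpa using this
  have : Nontrivial E := by
    obtain ⟨x, -, hx⟩ := hne 1 K.one_mem
    exact ⟨x, 0, hx⟩
  have hsmul_inj : ∀ (σ : L ≃ₐ[F] L) (x y : E),
      MulOpposite.op x • B σ = MulOpposite.op y • B σ → x = y := by
    intro σ x y h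
    simpa using congrArg (fun v => B.repr v σ) h
  obtain ⟨z, hz, y, hy, hzy, hyz⟩ := hinv (d 1) hd1
  -- The embedding of `E` as endomorphisms of the first line.
  let φ : E → Module.End Eᵐᵒᵖ V := fun x =>
    elementaryEnd B 1 (MulOpposite.op (y * x * z) • B 1)
  have hφbasis : ∀ x, orbitSum ψ (φ x) (B 1) = MulOpposite.op (y * x * z) • B 1 := fun x =>
    orbitSum_elementaryEnd_basis B ψ hψε _
  have hφmem : ∀ t, ∀ x ∈ Ecomp t, φ x ∈ homogPart Vcomp t := by
    intro t x hx
    refine hmem ?_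
    have := hVsmul (hb 1) (hEmul (hEmul hy hx) hz)
    convert this using 2
    group
  let Φ : E →+* Module.End Eᵐᵒᵖ V :=
    { toFun := fun x => orbitSum ψ (φ x)
      map_one' := by
        have : φ 1 = lineProj B 1 := by
          simp only [φ, lineProj, mul_one, hyz, MulOpposite.op_one, one_smul]
        rw [this, orbitSum_lineProj B ψ hψε]
      map_zero' := by
        have : φ 0 = 0 := by ext; simp [φ, elementaryEnd_apply]
        rw [this, map_zero]
      map_add' := fun x x' => by
        rw [← map_add]
        congr 1
        simp only [φ]
        rw [← elementaryEnd_add, mul_add, add_mul, MulOpposite.op_add, add_smul]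
      map_mul' := fun x x' => by
        rw [← orbitSum_mul ψ (hSfix (φ x))]
        congr 1
        simp only [φ]
        rw [mul_elementaryEnd, LinearMap.map_smul]
        have := hφbasis x
        simp only [φ] at this
        rw [this, smul_smul, ← MulOpposite.op_mul]
        congr 3
        calc y * (x * x') * z = y * x * 1 * x' * z := by simp only [mul_one, mul_assoc]
          _ = _ := by rw [← hzy]; simp only [mul_assoc] }
  have hΦ : ∀ x, Φ x = orbitSum ψ (φ x) := fun _ => rfl
  have hΦinj : Function.Injective Φ := by
    intro x x' h
    have h1 := congrArg (fun r => r (B 1)) h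
    simp only [hΦ, hφbasis] at h1
    have h2 := hsmul_inj _ _ _ h1
    calc x = z * (y * x * z) * y := by
          rw [← mul_assoc, ← mul_assoc, hzy, one_mul, mul_assoc, hzy, mul_one]
      _ = z * (y * x' * z) * y := by rw [h2]
      _ = x' := by rw [← mul_assoc, ← mul_assoc, hzy, one_mul, mul_assoc, hzy, mul_one]
  have hΦsurj : ∀ t ∈ K, ∀ r ∈ homogPart Vcomp t, r ∈ fixedSubring ψ →
      ∃ x ∈ Ecomp t, Φ x = r := by
    intro t ht r hr hrfix
    obtain ⟨x, hx, hrx⟩ := hcoord 1 (t * d 1) (r (B 1))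
      (K.mul_mem (K.inv_mem hd1) (K.mul_mem ht hd1)) (hr _ _ (hb 1))
    refine ⟨z * x * y, ?_, ?_⟩
    · convert hEmul (hEmul hz hx) hy using 2
      group
    · rw [hΦ, ← orbitSum_elementaryEnd_self B ψ hψε hrfix, hrx]
      simp only [φ]
      congr 4
      rw [← mul_assoc, ← mul_assoc, hyz, one_mul, mul_assoc, hyz, mul_one]
  have hΦL : ∀ l : L, Φ (algebraMap L E l) = ∑ σ : L ≃ₐ[F] L, σ l • lineProj B σ := by
    intro l
    have : φ (algebraMap L E l) = l • lineProj B 1 := by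
      simp only [φ, lineProj]
      rw [← Algebra.commutes, mul_assoc, hyz, mul_one, ← hLV]
      ext v
      simp [elementaryEnd_apply, smul_comm]
    rw [hΦ, this, orbitSum_apply]
    simp [hψsemilinear, hψε]
  have hΦF : ∀ c : F, Φ (algebraMap L E (algebraMap F L c)) =
      algebraMap F L c • (1 : Module.End Eᵐᵒᵖ V) := by
    intro c
    rw [hΦL, ← sum_lineProj B, Finset.smul_sum]
    simp
  refine ⟨existsUnique_fixed_decomposition Ecomp Vcomp hVsmul B d hb ψ hψgraded,
    fun t => ?_, fun t r hrfix hr hr0 => ?_, fun r hrfix hr hrc => ?_,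
    ⟨Φ.comp (algebraMap L E), hΦinj.comp (algebraMap L E).injective, fun l => ⟨hSfix _,
      hS (hφmem 1 _ ((hEcentral _).mpr ⟨l, rfl⟩).1), fun r hrfix hr => ?_⟩⟩,
    Φ, hΦinj, fun x => hSfix _, fun t _ x hx => hS (hφmem t x hx), hΦF, ?_⟩
  · set τ := (θ (QuotientGroup.mk (t * d 1)))⁻¹ with hτ
    obtain ⟨x, hx, hx0⟩ := hne _ ((hidx τ (t * d 1)).mpr hτ)
    have hv : MulOpposite.op x • B τ ∈ Vcomp (t * d 1) := by
      convert hVsmul (hb τ) hx using 2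
      group
    refine ⟨_, hSfix (elementaryEnd B 1 (MulOpposite.op x • B τ)), hS (hmem hv), fun h => hx0 ?_⟩
    have h1 := orbitSum_elementaryEnd_basis B ψ hψε (MulOpposite.op x • B τ)
    rw [h] at h1
    exact (hsmul_inj τ 0 x (by simpa using h1)).symm
  · obtain ⟨τ, hτ⟩ : ∃ τ, τ = (θ (QuotientGroup.mk (t * d 1)))⁻¹ := ⟨_, rfl⟩
    obtain ⟨x, hx, hrx⟩ := hcoord τ (t * d 1) (r (B 1)) ((hidx _ _).mpr hτ) (hr _ _ (hb 1))
    have hx0 : x ≠ 0 := by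
      rintro rfl
      refine hr0 ?_
      rw [← orbitSum_elementaryEnd_self B ψ hψε hrfix, hrx]
      have : elementaryEnd B 1 (MulOpposite.op (0 : E) • B τ) = 0 := by
        ext; simp [elementaryEnd_apply]
      rw [this, map_zero]
    obtain ⟨x', hxx', hx'x⟩ := isUnit_iff_exists.mp (hEdiv _ x hx hx0)
    refine ⟨orbitSum ψ (elementaryEnd B τ (MulOpposite.op x' • B 1)), hSfix _, ?_, ?_⟩
    · rw [← orbitSum_mul ψ hrfix, mul_elementaryEnd, LinearMap.map_smul, hrx, smul_smul,
        ← MulOpposite.op_mul, hxx', MulOpposite.op_one, one_smul]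
      exact orbitSum_lineProj B ψ hψε τ
    · have : elementaryEnd B τ (MulOpposite.op x' • B 1) * r = lineProj B 1 := by
        refine B.ext fun ρ => ?_
        rw [Module.End.mul_apply, lineProj, elementaryEnd_basis]
        split_ifs with hρ
        · rw [hρ, hrx, LinearMap.map_smul, elementaryEnd_basis, if_pos rfl, smul_smul,
            ← MulOpposite.op_mul, hx'x, MulOpposite.op_one, one_smul]
        · obtain ⟨w, -, hrw⟩ := hcoord _ (t * d ρ) (r (B ρ)) ((hidx _ _).mpr rfl) (hr _ _ (hb ρ))
          rw [hrw, LinearMap.map_smul, elementaryEnd_basis, if_neg, smul_zero]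
          intro h
          rw [hτ, inv_inj, QuotientGroup.mk_mul, QuotientGroup.mk_mul, map_mul, map_mul, hd, hd,
            mul_right_inj, inv_inj] at h
          exact hρ h
      rw [← orbitSum_mul' ψ hrfix, this, orbitSum_lineProj B ψ hψε]
  · obtain ⟨x, hx, rfl⟩ := hΦsurj 1 K.one_mem r hr hrfix
    obtain ⟨l, rfl⟩ := (hEcentral x).mp ⟨hx, fun x' => hΦinj (by
      rw [map_mul, map_mul]; exact hrc _ (hSfix _))⟩
    have hl : ∀ τ : L ≃ₐ[F] L, τ l = l := by
      intro τ
      have h1 := congrArg (fun f => f (B 1)) (hrc _ (hSfix (elementaryEnd B 1 (B τ))))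
      simp only [Module.End.mul_apply, orbitSum_elementaryEnd_basis B ψ hψε, hΦL] at h1
      simp only [LinearMap.sum_apply, LinearMap.smul_apply, lineProj, elementaryEnd_basis,
        smul_ite, smul_zero, Finset.sum_ite_eq, Finset.mem_univ, if_true, hLV,
        LinearMap.map_smul, orbitSum_elementaryEnd_basis B ψ hψε, AlgEquiv.one_apply] at h1
      exact (algebraMap L E).injective (hsmul_inj τ _ _ h1)
    obtain ⟨c, rfl⟩ := (IsGalois.mem_range_algebraMap_iff_fixed l).mpr hl
    exact ⟨c, hΦF c⟩
  · obtain ⟨x, -, rfl⟩ := hΦsurj 1 K.one_mem r hr hrfix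
    rw [RingHom.comp_apply, ← map_mul, ← map_mul, Algebra.commutes]
  · apply Set.Subset.antisymm
    · rintro _ ⟨x, rfl⟩
      rw [SetLike.mem_coe]
      induction x using DirectSum.Decomposition.inductionOn Ecomp with
      | zero => rw [map_zero]; exact zero_mem _
      | @homogeneous t x =>
        by_cases ht : t ∈ K
        · exact AddSubgroup.mem_iSup_of_mem t (AddSubgroup.mem_iSup_of_mem ht
            ⟨hS (hφmem t x x.2), hSfix _⟩)
        · have hbot : Ecomp t = ⊥ := by
            by_contra h; exact ht ((hEsupp t).mp h)
          have hx : (x : E) = 0 := (Submodule.eq_bot_iff _).mp hbot x x.2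
          rw [hx, map_zero]; exact zero_mem _
      | add x x' hx hx' => rw [map_add]; exact add_mem hx hx'
    · have : (⨆ t ∈ K, homogPart Vcomp t ⊓ (fixedSubring ψ).toAddSubgroup) ≤
          Φ.range.toAddSubgroup := by
        refine iSup₂_le fun t ht r hr => ?_
        obtain ⟨x, -, hx⟩ := hΦsurj t ht r hr.1 hr.2
        exact ⟨x, hx⟩
      exact this
end
end

section
/- Let L be a field and K = ⟨a_1⟩ × ⋯ × ⟨a_m⟩ a finitely generated abelian group written as a direct product of cyclic groups. Let β_{ij} ∈ L^× (for i < j) be scalars satisfying β_{ij}^{o(a_i)} = 1 whenever o(a_i) < ∞ and β_{ij}^{o(a_j)} = 1 whenever o(a_j) < ∞, and let μ_i ∈ L^× be given for each i with o(a_i) < ∞. Grade the free associative algebra L⟨X_1^±,…,X_m^±⟩ by K via deg X_i^+ = a_i, deg X_i^- = a_i^{-1}, and let J be the two-sided ideal generated by: (i) X_i^- X_i^+ − 1 and X_i^+ X_i^- − 1 for all i; (ii) X_i X_j − β_{ij} X_j X_i for all i < j; (iii) X_i^{o(a_i)} − μ_i for all i with o(a_i) < ∞. Then the quotient D(K, β_{ij},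 μ_i) := L⟨X_1^±,…,X_m^±⟩/J is a graded-division algebra over L with support K and all homogeneous components of dimension 1 over L. -/
noncomputable section

/-- The abelian group `K = ⟨a_1⟩ × ⋯ × ⟨a_m⟩`, a direct product of cyclic groups of
orders `n 1, …, n m` (`n i = 0` meaning infinite cyclic). -/
abbrev KGrp {m : ℕ} (n : Fin m → ℕ) : Type := ∀ i : Fin m, Multiplicative (ZMod (n i))

/-- The generator `a_i` of the `i`-th cyclic factor. -/
def kGen {m : ℕ} (n : Fin m → ℕ) (i : Fin m) : KGrp n :=
  Pi.mulSingle i (Multiplicative.ofAdd (1 : ZMod (n i)))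

/-- Degrees of the free generators: `deg X_i^+ = a_i`, `deg X_i^- = a_i⁻¹`. -/
def degOf {m : ℕ} (n : Fin m → ℕ) : Fin m × Bool → KGrp n :=
  fun q => if q.2 then kGen n q.1 else (kGen n q.1)⁻¹

/-- The generator `X_i^+` of the free algebra. -/
def Xp (L : Type*) [Field L] {m : ℕ} (i : Fin m) : FreeAlgebra L (Fin m × Bool) :=
  FreeAlgebra.ι L (i, true)

/-- The generator `X_i^-` of the free algebra. -/
def Xm (L : Type*) [Field L] {m : ℕ} (i : Fin m) : FreeAlgebra L (Fin m × Bool) :=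
  FreeAlgebra.ι L (i, false)

/-- The homogeneous component of degree `g` of the free algebra
`L⟨X_1^±, …, X_m^±⟩` under the `K`-grading induced by `degOf`. -/
def freeComp (L : Type*) [Field L] {m : ℕ} (n : Fin m → ℕ) (g : KGrp n) :
    Submodule L (FreeAlgebra L (Fin m × Bool)) :=
  Submodule.span L {x | ∃ l : List (Fin m × Bool),
    (l.map (degOf n)).prod = g ∧ x = (l.map (FreeAlgebra.ι L)).prod}

/-- The defining relations of `D(K, β_{ij}, μ_i)`:
(i) `X_i^- X_i^+ = 1 = X_i^+ X_i^-`; (ii) `X_i X_j = β_{ij} X_j X_i` for `i < j`;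
(iii) `X_i^{o(a_i)} = μ_i` whenever `o(a_i) < ∞`. -/
inductive QuasiTorusRel (L : Type*) [Field L] {m : ℕ} (n : Fin m → ℕ)
    (β : Fin m → Fin m → Lˣ) (μ : Fin m → Lˣ) :
    FreeAlgebra L (Fin m × Bool) → FreeAlgebra L (Fin m × Bool) → Prop
  | inv_mul (i : Fin m) : QuasiTorusRel L n β μ (Xm L i * Xp L i) 1
  | mul_inv (i : Fin m) : QuasiTorusRel L n β μ (Xp L i * Xm L i) 1
  | comm (i j : Fin m) (hij : i < j) :
      QuasiTorusRel L n β μ (Xp L i * Xp L j) (((β i j : L)) • (Xp L j * Xp L i))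
  | pow (i : Fin m) (hfin : n i ≠ 0) :
      QuasiTorusRel L n β μ (Xp L i ^ (n i))
        (algebraMap L (FreeAlgebra L (Fin m × Bool)) ((μ i : L)))

/-- The quotient algebra `D(K, β_{ij}, μ_i) = L⟨X_1^±, …, X_m^±⟩ / J`. -/
abbrev QuasiTorus (L : Type*) [Field L] {m : ℕ} (n : Fin m → ℕ)
    (β : Fin m → Fin m → Lˣ) (μ : Fin m → Lˣ) : Type _ :=
  RingQuot (QuasiTorusRel L n β μ)

/-- The homogeneous component of degree `g` of the quotient: the image of the
corresponding component of the free algebra (the defining ideal is graded). -/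
def quotComp (L : Type*) [Field L] {m : ℕ} (n : Fin m → ℕ)
    (β : Fin m → Fin m → Lˣ) (μ : Fin m → Lˣ) (g : KGrp n) :
    Submodule L (QuasiTorus L n β μ) :=
  (freeComp L n g).map (RingQuot.mkAlgHom L (QuasiTorusRel L n β μ)).toLinearMap

/-- The homomorphism from `ℤ/n` sending the generator to an element `x` with `x ^ n = 1`. -/
def zmodPow {G : Type*} [Group G] (n : ℕ) (x : G) (h : x ^ n = 1) :
    Multiplicative (ZMod n) →* G :=
  AddMonoidHom.toMultiplicativeLeft (ZMod.lift n ⟨zmultiplesHom (Additive G) (Additive.ofMul x), by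
    rw [zmultiplesHom_apply, natCast_zsmul, ← ofMul_pow, h, ofMul_one]⟩)

theorem zmodPow_intCast {G : Type*} [Group G] (n : ℕ) (x : G) (h : x ^ n = 1) (k : ℤ) :
    zmodPow n x h (Multiplicative.ofAdd (k : ZMod n)) = x ^ k := by
  simp [zmodPow]

theorem zmodPow_one {G : Type*} [Group G] (n : ℕ) (x : G) (h : x ^ n = 1) :
    zmodPow n x h (Multiplicative.ofAdd 1) = x := by
  simpa using zmodPow_intCast n x h 1

theorem kGen_pow_card {m : ℕ} (n : Fin m → ℕ) (i : Fin m) : kGen n i ^ n i = 1 := by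
  rw [kGen, ← Pi.mulSingle_pow, ← ofAdd_nsmul, nsmul_one, ZMod.natCast_self, ofAdd_zero,
    Pi.mulSingle_one]

theorem exists_word_degree {m : ℕ} (n : Fin m → ℕ) (g : KGrp n) :
    ∃ l : List (Fin m × Bool), (l.map (degOf n)).prod = g := by
  suffices h : g ∈ MonoidHom.mrange (FreeMonoid.lift (degOf n)) by
    obtain ⟨l, hl⟩ := h
    exact ⟨l.toList, by rw [← hl, FreeMonoid.lift_apply]⟩
  have hmem (q : Fin m × Bool) : degOf n q ∈ MonoidHom.mrange (FreeMonoid.lift (degOf n)) :=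
    ⟨FreeMonoid.of q, FreeMonoid.lift_eval_of _ _⟩
  rw [← Finset.univ_prod_mulSingle g]
  refine Submonoid.prod_mem _ fun i _ => ?_
  obtain ⟨k, hk⟩ := ZMod.intCast_surjective (Multiplicative.toAdd (g i))
  have hgi : (Pi.mulSingle i (g i) : KGrp n) = kGen n i ^ k := by
    rw [kGen, ← Pi.mulSingle_zpow, ← ofAdd_zsmul, zsmul_one, hk, ofAdd_toAdd]
  rw [hgi]
  obtain ⟨j, rfl | rfl⟩ := k.eq_nat_or_neg
  · rw [zpow_natCast]
    exact Submonoid.pow_mem _ (hmem (i, true)) j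
  · rw [zpow_neg, zpow_natCast, ← inv_pow]
    exact Submonoid.pow_mem _ (hmem (i, false)) j

section Model

variable {L : Type*} [Field L]

/-- The operator on the free module over a group sending `e_g` to `c g • e_{a g}`. -/
def weightedShift {K : Type*} [Group K] (a : K) (c : K → Lˣ) : Module.End L (K →₀ L) :=
  Finsupp.linearCombination L fun g => Finsupp.single (a * g) (c g : L)

theorem weightedShift_single {K : Type*} [Group K] (a : K) (c : K → Lˣ) (g : K) (r : L) :
    weightedShift a c (Finsupp.single g r) = Finsupp.single (a * g) (r * c g) := by
  simp [weightedShift]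

theorem weightedShift_mul {K : Type*} [Group K] (a b : K) (c d : K → Lˣ) :
    weightedShift a c * weightedShift b d = weightedShift (a * b) fun g => d g * c (b * g) := by
  refine Finsupp.lhom_ext fun g r => ?_
  rw [Module.End.mul_apply]
  simp only [weightedShift_single, Units.val_mul, mul_assoc]

theorem weightedShift_one {K : Type*} [Group K] :
    weightedShift (1 : K) (fun _ => (1 : Lˣ)) = 1 := by
  refine Finsupp.lhom_ext fun g r => ?_
  simp [weightedShift_single]

theorem weightedShift_pow {K : Type*} [Group K] (a : K) (c : K → Lˣ) (k : ℕ) :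
    weightedShift a c ^ k =
      weightedShift (a ^ k) fun g => ∏ t ∈ Finset.range k, c (a ^ t * g) := by
  induction k with
  | zero => simp [weightedShift_one]
  | succ k ih =>
    rw [pow_succ', ih, weightedShift_mul, pow_succ']
    simp only [Finset.prod_range_succ]

variable {m : ℕ} (n : Fin m → ℕ) (β : Fin m → Fin m → Lˣ) (μ : Fin m → Lˣ)

/-- The character of `K` with value `β_{ji}⁻¹` at `a_j` for `j < i` and `1` at the other
generators. -/
def twistChar (hβ : ∀ i j : Fin m, i < j → β i j ^ n i = 1) (i : Fin m) : KGrp n →* Lˣ where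
  toFun g := ∏ j, if h : j < i then
    zmodPow (n j) (β j i)⁻¹ (by rw [inv_pow, hβ j i h, inv_one]) (g j) else 1
  map_one' := Finset.prod_eq_one fun j _ => by split_ifs <;> simp
  map_mul' g h := by
    rw [← Finset.prod_mul_distrib]
    refine Finset.prod_congr rfl fun j _ => ?_
    split_ifs <;> simp

variable {n β}

theorem twistChar_kGen (hβ : ∀ i j : Fin m, i < j → β i j ^ n i = 1) (i j : Fin m) :
    twistChar n β hβ i (kGen n j) = if j < i then (β j i)⁻¹ else 1 := by
  change (∏ l, if h : l < i then zmodPow (n l) (β l i)⁻¹ _ (kGen n j l) else 1) = _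
  rw [Finset.prod_eq_single j]
  · rw [kGen, Pi.mulSingle_eq_same]
    split_ifs
    · exact zmodPow_one _ _ _
    · rfl
  · intro l _ hl
    rw [kGen, Pi.mulSingle_eq_of_ne hl]
    split_ifs
    · exact map_one _
    · rfl
  · simp

theorem twistChar_pow (hβ : ∀ i j : Fin m, i < j → β i j ^ n i = 1)
    (hβ' : ∀ i j : Fin m, i < j → β i j ^ n j = 1) (i : Fin m) (g : KGrp n) :
    twistChar n β hβ i g ^ n i = 1 := by
  change (∏ l, if h : l < i then zmodPow (n l) (β l i)⁻¹ _ (g l) else 1) ^ n i = _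
  rw [← Finset.prod_pow]
  refine Finset.prod_eq_one fun j _ => ?_
  split_ifs with h
  · obtain ⟨k, hk⟩ := ZMod.intCast_surjective (Multiplicative.toAdd (g j))
    rw [← ofAdd_toAdd (g j), ← hk, zmodPow_intCast, ← zpow_natCast, zpow_comm, zpow_natCast,
      inv_pow, hβ' j i h, inv_one, one_zpow]
  · exact one_pow _

/-- The factor `μ_i` picked up when the `i`-th coordinate wraps around. -/
def wrapFactor (μ : Fin m → Lˣ) (i : Fin m) (g : KGrp n) : Lˣ :=
  open Classical in if n i ≠ 0 ∧ g i = Multiplicative.ofAdd (-1) then μ i else 1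

theorem wrapFactor_kGen_mul {i j : Fin m} (hij : i ≠ j) (g : KGrp n) :
    wrapFactor μ i (kGen n j * g) = wrapFactor μ i g := by
  simp [wrapFactor, kGen, Pi.mulSingle_eq_of_ne hij]

theorem prod_wrapFactor (i : Fin m) (hi : n i ≠ 0) (g : KGrp n) :
    ∏ t ∈ Finset.range (n i), wrapFactor μ i (kGen n i ^ t * g) = μ i := by
  have : NeZero (n i) := ⟨hi⟩
  set z : ZMod (n i) := -1 - Multiplicative.toAdd (g i) with hz
  rw [Finset.prod_eq_single z.val]
  · refine if_pos ⟨hi, ?_⟩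
    rw [Pi.mul_apply, Pi.pow_apply, kGen, Pi.mulSingle_eq_same, ← ofAdd_nsmul, nsmul_one,
      ZMod.natCast_zmod_val, ← ofAdd_toAdd (g i), ← ofAdd_add, hz, sub_add_cancel]
  · intro t ht htz
    refine if_neg fun h => htz ?_
    have h2 := h.2
    rw [Pi.mul_apply, Pi.pow_apply, kGen, Pi.mulSingle_eq_same, ← ofAdd_nsmul, nsmul_one,
      ← ofAdd_toAdd (g i), ← ofAdd_add] at h2
    rw [hz, ← Multiplicative.ofAdd.injective h2, add_sub_cancel_right,
      ZMod.val_natCast_of_lt (Finset.mem_range.mp ht)]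
  · exact fun h => absurd (Finset.mem_range.mpr z.val_lt) h

/-- The weight of the action of `X_i` on the basis vector `e_g`. -/
def modelWeight (hβ : ∀ i j : Fin m, i < j → β i j ^ n i = 1) (μ : Fin m → Lˣ) (i : Fin m)
    (g : KGrp n) : Lˣ :=
  twistChar n β hβ i g * wrapFactor μ i g

theorem modelWeight_comm (hβ : ∀ i j : Fin m, i < j → β i j ^ n i = 1) {i j : Fin m}
    (hij : i < j) (g : KGrp n) :
    modelWeight hβ μ j g * modelWeight hβ μ i (kGen n j * g) =
      β i j * (modelWeight hβ μ i g * modelWeight hβ μ j (kGen n i * g)) := by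
  simp only [modelWeight, map_mul, twistChar_kGen, wrapFactor_kGen_mul μ hij.ne,
    wrapFactor_kGen_mul μ hij.ne', if_pos hij, if_neg hij.not_gt, one_mul]
  rw [mul_comm (twistChar n β hβ i g * _), mul_assoc (β i j)⁻¹, mul_assoc (β i j)⁻¹,
    mul_inv_cancel_left]

theorem prod_modelWeight (hβ : ∀ i j : Fin m, i < j → β i j ^ n i = 1)
    (hβ' : ∀ i j : Fin m, i < j → β i j ^ n j = 1) (i : Fin m) (hi : n i ≠ 0) (g : KGrp n) :
    ∏ t ∈ Finset.range (n i), modelWeight hβ μ i (kGen n i ^ t * g) = μ i := by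
  simp only [modelWeight, Finset.prod_mul_distrib, prod_wrapFactor μ i hi, map_mul, map_pow,
    twistChar_kGen, twistChar_pow hβ hβ', lt_irrefl, if_false, one_pow, one_mul,
    Finset.prod_const, Finset.card_range]

/-- The weight of the action of a letter `X_i^±` on the basis vector `e_g`. -/
def letterWeight (hβ : ∀ i j : Fin m, i < j → β i j ^ n i = 1) (μ : Fin m → Lˣ)
    (q : Fin m × Bool) (g : KGrp n) : Lˣ :=
  if q.2 then modelWeight hβ μ q.1 g else (modelWeight hβ μ q.1 ((kGen n q.1)⁻¹ * g))⁻¹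

/-- The representation of the free algebra by weighted shifts along `K`. -/
def freeModel (hβ : ∀ i j : Fin m, i < j → β i j ^ n i = 1) (μ : Fin m → Lˣ) :
    FreeAlgebra L (Fin m × Bool) →ₐ[L] Module.End L (KGrp n →₀ L) :=
  FreeAlgebra.lift L fun q => weightedShift (degOf n q) (letterWeight hβ μ q)

theorem freeModel_Xp (hβ : ∀ i j : Fin m, i < j → β i j ^ n i = 1) (i : Fin m) :
    freeModel hβ μ (Xp L i) = weightedShift (kGen n i) (modelWeight hβ μ i) := by
  rw [freeModel, Xp, FreeAlgebra.lift_ι_apply]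
  rfl

theorem freeModel_Xm (hβ : ∀ i j : Fin m, i < j → β i j ^ n i = 1) (i : Fin m) :
    freeModel hβ μ (Xm L i) = weightedShift (kGen n i)⁻¹
      fun g => (modelWeight hβ μ i ((kGen n i)⁻¹ * g))⁻¹ := by
  rw [freeModel, Xm, FreeAlgebra.lift_ι_apply]
  rfl

theorem freeModel_rel (hβ : ∀ i j : Fin m, i < j → β i j ^ n i = 1)
    (hβ' : ∀ i j : Fin m, i < j → β i j ^ n j = 1) {x y : FreeAlgebra L (Fin m × Bool)}
    (h : QuasiTorusRel L n β μ x y) : freeModel hβ μ x = freeModel hβ μ y := by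
  induction h with
  | inv_mul i =>
    rw [map_mul, freeModel_Xp, freeModel_Xm, weightedShift_mul, map_one, ← weightedShift_one]
    simp
  | mul_inv i =>
    rw [map_mul, freeModel_Xp, freeModel_Xm, weightedShift_mul, map_one, ← weightedShift_one]
    simp
  | comm i j hij =>
    rw [map_smul, map_mul, map_mul, freeModel_Xp, freeModel_Xp, weightedShift_mul,
      weightedShift_mul]
    refine Finsupp.lhom_ext fun g r => ?_
    rw [LinearMap.smul_apply, weightedShift_single, weightedShift_single,
      modelWeight_comm μ hβ hij, mul_comm (kGen n i), Finsupp.smul_single, smul_eq_mul,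
      Units.val_mul, mul_left_comm]
  | pow i hi =>
    rw [map_pow, freeModel_Xp, weightedShift_pow, AlgHom.commutes, kGen_pow_card]
    refine Finsupp.lhom_ext fun g r => ?_
    rw [weightedShift_single, prod_modelWeight μ hβ hβ' i hi, one_mul,
      Module.algebraMap_end_apply, Finsupp.smul_single, smul_eq_mul, mul_comm]

theorem freeModel_word (hβ : ∀ i j : Fin m, i < j → β i j ^ n i = 1)
    (l : List (Fin m × Bool)) : ∃ c : KGrp n → Lˣ,
      freeModel hβ μ (l.map (FreeAlgebra.ι L)).prod =
        weightedShift (l.map (degOf n)).prod c := by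
  induction l with
  | nil => exact ⟨fun _ => 1, by simp [weightedShift_one]⟩
  | cons q l ih =>
    obtain ⟨c, hc⟩ := ih
    refine ⟨fun g => c g * letterWeight hβ μ q ((l.map (degOf n)).prod * g), ?_⟩
    rw [List.map_cons, List.prod_cons, map_mul, hc, freeModel, FreeAlgebra.lift_ι_apply,
      weightedShift_mul, List.map_cons, List.prod_cons]

end Model

section Words

variable {L : Type*} [Field L] {m : ℕ} (n : Fin m → ℕ) (β : Fin m → Fin m → Lˣ) (μ : Fin m → Lˣ)

/-- The image of `X_i^+` in the quotient, as a unit. -/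
def genUnit (i : Fin m) : (QuasiTorus L n β μ)ˣ where
  val := RingQuot.mkAlgHom L (QuasiTorusRel L n β μ) (Xp L i)
  inv := RingQuot.mkAlgHom L (QuasiTorusRel L n β μ) (Xm L i)
  val_inv := by
    rw [← map_mul, RingQuot.mkAlgHom_rel L (QuasiTorusRel.mul_inv i), map_one]
  inv_val := by
    rw [← map_mul, RingQuot.mkAlgHom_rel L (QuasiTorusRel.inv_mul i), map_one]

/-- The image of a letter `X_i^±` in the quotient, as a unit. -/
def letterUnit (q : Fin m × Bool) : (QuasiTorus L n β μ)ˣ :=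
  if q.2 then genUnit n β μ q.1 else (genUnit n β μ q.1)⁻¹

theorem val_prod_letterUnit (l : List (Fin m × Bool)) :
    (((l.map (letterUnit n β μ)).prod : (QuasiTorus L n β μ)ˣ) : QuasiTorus L n β μ) =
      RingQuot.mkAlgHom L (QuasiTorusRel L n β μ) (l.map (FreeAlgebra.ι L)).prod := by
  induction l with
  | nil => simp
  | cons q l ih =>
    rw [List.map_cons, List.prod_cons, Units.val_mul, ih, List.map_cons, List.prod_cons, map_mul]
    obtain ⟨i, _ | _⟩ := q <;> rfl

/-- The group of scalar units of an algebra. -/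
def scalarUnits (L A : Type*) [Field L] [Ring A] [Algebra L A] : Subgroup Aˣ :=
  (Units.map (algebraMap L A : L →* A)).range

instance scalarUnits_normal (L A : Type*) [Field L] [Ring A] [Algebra L A] :
    (scalarUnits L A).Normal where
  conj_mem := by
    rintro _ ⟨c, rfl⟩ u
    refine ⟨c, ?_⟩
    rw [eq_mul_inv_iff_mul_eq]
    exact Units.ext (Algebra.commutes (c : L) (u : A))

theorem genUnit_pow_class (i : Fin m) :
    (QuotientGroup.mk' (scalarUnits L (QuasiTorus L n β μ)) (genUnit n β μ i)) ^ n i = 1 := by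
  rcases eq_or_ne (n i) 0 with h | h
  · rw [h, pow_zero]
  · rw [← map_pow, ← MonoidHom.mem_ker, QuotientGroup.ker_mk']
    refine ⟨μ i, Units.ext ?_⟩
    have := RingQuot.mkAlgHom_rel L (QuasiTorusRel.pow (β := β) (μ := μ) i h)
    rw [map_pow, AlgHom.commutes] at this
    exact this.symm

theorem genUnit_commute_class_of_lt {i j : Fin m} (hij : i < j) :
    Commute (QuotientGroup.mk' (scalarUnits L (QuasiTorus L n β μ)) (genUnit n β μ i))
      (QuotientGroup.mk' (scalarUnits L (QuasiTorus L n β μ)) (genUnit n β μ j)) := by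
  have hrel : genUnit n β μ i * genUnit n β μ j =
      Units.map (algebraMap L (QuasiTorus L n β μ) : L →* _) (β i j) *
        (genUnit n β μ j * genUnit n β μ i) := by
    refine Units.ext ?_
    have := RingQuot.mkAlgHom_rel L (QuasiTorusRel.comm (n := n) (β := β) (μ := μ) i j hij)
    rw [map_mul, map_smul, map_mul, Algebra.smul_def] at this
    exact this
  have hscalar : QuotientGroup.mk' (scalarUnits L (QuasiTorus L n β μ))
      (Units.map (algebraMap L (QuasiTorus L n β μ) : L →* _) (β i j)) = 1 := by
    rw [← MonoidHom.mem_ker, QuotientGroup.ker_mk']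
    exact ⟨_, rfl⟩
  rw [commute_iff_eq, ← map_mul, hrel, map_mul, hscalar, one_mul, map_mul]

theorem degreeClass_pairwise : Pairwise fun i j => ∀ x y,
    Commute (zmodPow (n i) _ (genUnit_pow_class n β μ i) x)
      (zmodPow (n j) _ (genUnit_pow_class n β μ j) y) := by
  intro i j hij x y
  obtain ⟨k, hk⟩ := ZMod.intCast_surjective (Multiplicative.toAdd x)
  obtain ⟨l, hl⟩ := ZMod.intCast_surjective (Multiplicative.toAdd y)
  rw [← ofAdd_toAdd x, ← hk, zmodPow_intCast, ← ofAdd_toAdd y, ← hl, zmodPow_intCast]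
  refine Commute.zpow_zpow ?_ k l
  rcases lt_or_gt_of_ne hij with h | h
  · exact genUnit_commute_class_of_lt n β μ h
  · exact (genUnit_commute_class_of_lt n β μ h).symm

/-- The homomorphism from `K` to the units modulo scalars sending `a_i` to the class of `X_i`. -/
def degreeClass :
    KGrp n →* (QuasiTorus L n β μ)ˣ ⧸ scalarUnits L (QuasiTorus L n β μ) :=
  MonoidHom.noncommPiCoprod (fun i => zmodPow (n i) _ (genUnit_pow_class n β μ i))
    (degreeClass_pairwise n β μ)

theorem degreeClass_kGen (i : Fin m) :
    degreeClass n β μ (kGen n i) = QuotientGroup.mk' _ (genUnit n β μ i) := by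
  exact (MonoidHom.noncommPiCoprod_mulSingle _ _ _).trans (zmodPow_one _ _ _)

theorem mk_prod_letterUnit (l : List (Fin m × Bool)) :
    QuotientGroup.mk' (scalarUnits L (QuasiTorus L n β μ)) (l.map (letterUnit n β μ)).prod =
      degreeClass n β μ (l.map (degOf n)).prod := by
  rw [map_list_prod, map_list_prod, List.map_map, List.map_map]
  congr 2
  funext q
  obtain ⟨i, _ | _⟩ := q
  · simp [letterUnit, degOf, degreeClass_kGen]
  · simp [letterUnit, degOf, degreeClass_kGen]

theorem exists_smul_word {l l' : List (Fin m × Bool)}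
    (h : (l.map (degOf n)).prod = (l'.map (degOf n)).prod) :
    ∃ c : L, RingQuot.mkAlgHom L (QuasiTorusRel L n β μ) (l.map (FreeAlgebra.ι L)).prod =
      c • RingQuot.mkAlgHom L (QuasiTorusRel L n β μ) (l'.map (FreeAlgebra.ι L)).prod := by
  have hclass := (mk_prod_letterUnit n β μ l').trans
    ((congrArg _ h.symm).trans (mk_prod_letterUnit n β μ l).symm)
  obtain ⟨c, hc⟩ := QuotientGroup.eq.mp hclass
  refine ⟨c, ?_⟩
  rw [← val_prod_letterUnit, ← val_prod_letterUnit, Algebra.smul_def, Algebra.commutes,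
    ← mul_inv_cancel_left (l'.map (letterUnit n β μ)).prod (l.map (letterUnit n β μ)).prod, ← hc]
  rfl

theorem quotComp_eq_span_word (l : List (Fin m × Bool)) :
    quotComp L n β μ (l.map (degOf n)).prod =
      Submodule.span L
        {RingQuot.mkAlgHom L (QuasiTorusRel L n β μ) (l.map (FreeAlgebra.ι L)).prod} := by
  rw [quotComp, freeComp, Submodule.map_span]
  apply le_antisymm
  · rw [Submodule.span_le]
    rintro _ ⟨_, ⟨l', hl', rfl⟩, rfl⟩
    obtain ⟨c, hc⟩ := exists_smul_word n β μ hl'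
    exact Submodule.mem_span_singleton.mpr ⟨c, hc.symm⟩
  · exact Submodule.span_mono (Set.singleton_subset_iff.mpr ⟨_, ⟨l, rfl, rfl⟩, rfl⟩)

theorem word_mem_quotComp (l : List (Fin m × Bool)) :
    RingQuot.mkAlgHom L (QuasiTorusRel L n β μ) (l.map (FreeAlgebra.ι L)).prod ∈
      quotComp L n β μ (l.map (degOf n)).prod := by
  rw [quotComp_eq_span_word]
  exact Submodule.mem_span_singleton_self _

theorem iSup_quotComp : ⨆ g, quotComp L n β μ g = ⊤ := by
  rw [eq_top_iff]
  rintro x -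
  obtain ⟨y, rfl⟩ := RingQuot.mkAlgHom_surjective L (QuasiTorusRel L n β μ) x
  have hy : y ∈ Subalgebra.toSubmodule (Algebra.adjoin L (Set.range
      (FreeAlgebra.ι L (X := Fin m × Bool)))) := by
    rw [FreeAlgebra.adjoin_range_ι]
    trivial
  rw [Algebra.adjoin_eq_span] at hy
  induction hy using Submodule.span_induction with
  | mem y hy =>
    rw [← FreeMonoid.mrange_lift] at hy
    obtain ⟨l, rfl⟩ := hy
    rw [FreeMonoid.lift_apply]
    exact Submodule.mem_iSup_of_mem _ (word_mem_quotComp n β μ l.toList)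
  | zero => rw [map_zero]; exact zero_mem _
  | add y z _ _ hy hz => rw [map_add]; exact add_mem hy hz
  | smul c y _ hy => rw [map_smul]; exact Submodule.smul_mem _ c hy

variable {n β}

theorem linearIndependent_words (hβ : ∀ i j : Fin m, i < j → β i j ^ n i = 1)
    (hβ' : ∀ i j : Fin m, i < j → β i j ^ n j = 1) (w : KGrp n → List (Fin m × Bool))
    (hw : ∀ g, ((w g).map (degOf n)).prod = g) :
    LinearIndependent L fun g =>
      RingQuot.mkAlgHom L (QuasiTorusRel L n β μ) ((w g).map (FreeAlgebra.ι L)).prod := by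
  let φ : QuasiTorus L n β μ →ₐ[L] Module.End L (KGrp n →₀ L) :=
    RingQuot.liftAlgHom L ⟨freeModel hβ μ, fun _ _ h => freeModel_rel μ hβ hβ' h⟩
  choose c hc using fun g => freeModel_word μ hβ (w g)
  refine LinearIndependent.of_comp
    ((LinearMap.applyₗ (Finsupp.single 1 1)).comp φ.toLinearMap) ?_
  have hli := (Finsupp.basisSingleOne (R := L) (ι := KGrp n)).linearIndependent.units_smul
    fun g => c g 1
  convert hli using 1
  funext g
  change φ (RingQuot.mkAlgHom L _ _) (Finsupp.single 1 1) = _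
  rw [RingQuot.liftAlgHom_mkAlgHom_apply, hc, hw, weightedShift_single]
  simp [Units.smul_def]

end Words

/-- If `β_{ij} ∈ L^×` satisfy `β_{ij}^{o(a_i)} = 1` when `o(a_i) < ∞`
and `β_{ij}^{o(a_j)} = 1` when `o(a_j) < ∞`, and `μ_i ∈ L^×`, then
`D(K, β_{ij}, μ_i) = L⟨X_1^±, …, X_m^±⟩/J` is a graded-division algebra with support
`K = ⟨a_1⟩ × ⋯ × ⟨a_m⟩` and all homogeneous components `1`-dimensional over `L`. -/
theorem stmt5 {L : Type} [Field L] {m : ℕ} (n : Fin m → ℕ)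
    (β : Fin m → Fin m → Lˣ) (μ : Fin m → Lˣ)
    (hβi : ∀ i j : Fin m, i < j → n i ≠ 0 → (β i j : L) ^ n i = 1)
    (hβj : ∀ i j : Fin m, i < j → n j ≠ 0 → (β i j : L) ^ n j = 1) :
    DirectSum.IsInternal (quotComp L n β μ) ∧
    ((1 : QuasiTorus L n β μ) ∈ quotComp L n β μ 1) ∧
    (∀ {g h : KGrp n} {x y : QuasiTorus L n β μ},
      x ∈ quotComp L n β μ g → y ∈ quotComp L n β μ h → x * y ∈ quotComp L n β μ (g * h)) ∧
    (∀ (g : KGrp n) (x : QuasiTorus L n β μ), x ∈ quotComp L n β μ g → x ≠ 0 → IsUnit x) ∧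
    (∀ g : KGrp n, Module.finrank L (quotComp L n β μ g) = 1) := by
  have hβ : ∀ i j : Fin m, i < j → β i j ^ n i = 1 := fun i j hij => by
    rcases eq_or_ne (n i) 0 with h | h
    · rw [h, pow_zero]
    · exact Units.ext (by simpa using hβi i j hij h)
  have hβ' : ∀ i j : Fin m, i < j → β i j ^ n j = 1 := fun i j hij => by
    rcases eq_or_ne (n j) 0 with h | h
    · rw [h, pow_zero]
    · exact Units.ext (by simpa using hβj i j hij h)
  choose w hw using exists_word_degree n
  have hli := linearIndependent_words μ hβ hβ' w hw
  have hspan (g : KGrp n) := (hw g) ▸ quotComp_eq_span_word n β μ (w g)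
  refine ⟨?_, by simpa using word_mem_quotComp n β μ [], ?_, ?_, ?_⟩
  · rw [DirectSum.isInternal_submodule_iff_iSupIndep_and_iSup_eq_top]
    refine ⟨?_, iSup_quotComp n β μ⟩
    rw [funext hspan]
    exact hli.iSupIndep_span_singleton
  · intro g h x y hx hy
    rw [hspan, Submodule.mem_span_singleton] at hx hy
    obtain ⟨a, rfl⟩ := hx
    obtain ⟨b, rfl⟩ := hy
    have hmem := word_mem_quotComp n β μ (w g ++ w h)
    rw [List.map_append, List.prod_append, hw, hw, List.map_append, List.prod_append,
      map_mul] at hmem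
    rw [smul_mul_smul_comm]
    exact Submodule.smul_mem _ _ hmem
  · intro g x hx hx0
    rw [hspan, Submodule.mem_span_singleton] at hx
    obtain ⟨a, rfl⟩ := hx
    have ha : a ≠ 0 := fun h => hx0 (by rw [h, zero_smul])
    rw [← val_prod_letterUnit, Algebra.smul_def]
    exact ((IsUnit.mk0 a ha).map (algebraMap L _)).mul (Units.isUnit _)
  · intro g
    rw [hspan]
    exact finrank_span_singleton (hli.ne_zero g)
end
end

section
/- Let L be a field and K a finitely generated abelian group. For t in the torsion subgroup Tor(K), let F_t := L^×/(L^×)^{o(t)} where (L^×)^{n} denotes the subgroup of n-th powers, and let F_K := ∏_{t∈Tor(K)} F_t. Let β: K × K → L^× be an alternating bicharacter and μ ∈ F_K a function satisfying: (0) if n divides o(g) then μ(g^n) is the image of μ(g) in L^×/(L^×)^{o(g)/n}; (1) if gcd(o(g),o(h)) = 1 then μ(gh) = μ(g)^{o(h)} μ(h)^{o(g)}; (2) if p is prime and o(g) = p^k > o(h) = p^ℓ then μ(gh) = μ(g)·μ(h)^{p^{k−ℓ}}; (3) if p is prime and o(g) = o(h) = o(gh) = p^k then μ(gh) = μ(g)μ(h)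 when p is odd, and μ(gh) = β(g,h)^{2^{k−1}} μ(g)μ(h) when p = 2. Then there is a unique, up to isomorphism of graded algebras, graded-division algebra D(K,β,μ) = ⊕_{t∈K} D_t over L such that: (i) dim_L D_t = 1 for all t ∈ K; (ii) xy = β(s,t) yx for all x ∈ D_s, y ∈ D_t, s,t ∈ K; and (iii) x^{o(t)} ∈ μ(t) (as a coset of (L^×)^{o(t)}) for every nonzero x ∈ D_t with t ∈ Tor(K). Moreover, every graded-division algebra C = ⊕_{t∈K} C_t over L with dim_L C_t = 1 for all t ∈ K is graded-isomorphic to exactly one of the algebras D(K,β,μ). -/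
universe u v

/-- A bundled graded-division algebra over the field `L` graded by the abelian group `K`. -/
structure GradedDivAlg (L : Type u) [Field L] (K : Type v) [CommGroup K] [DecidableEq K] :
    Type (max u v + 1) where
  carrier : Type (max u v)
  [ringC : Ring carrier]
  [algC : Algebra L carrier]
  comp : K → Submodule L carrier
  internal : DirectSum.IsInternal comp
  one_mem : (1 : carrier) ∈ comp 1
  mul_mem : ∀ {g h : K} {x y : carrier}, x ∈ comp g → y ∈ comp h → x * y ∈ comp (g * h)
  div : ∀ (g : K), ∀ x ∈ comp g, x ≠ 0 → IsUnit x

attribute [instance] GradedDivAlg.ringC GradedDivAlg.algC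

variable {L : Type u} [Field L] {K : Type v} [CommGroup K] [DecidableEq K]

/-- `𝒟` has `1`-dimensional components, commutation relations governed by the
alternating bicharacter `β`, and `x^{o(t)} ∈ μ(t)·(L^×)^{o(t)}` for homogeneous `x`
of degree `t ∈ Tor(K)` (here `μ : K → L^×` is a representative of an element of
`F_K = ∏_{t ∈ Tor(K)} L^×/(L^×)^{o(t)}`). -/
def SatisfiesData (𝒟 : GradedDivAlg L K) (β : K → K → Lˣ) (μ : K → Lˣ) : Prop :=
  (∀ t : K, Module.finrank L (𝒟.comp t) = 1) ∧
  (∀ (s t : K) (x y : 𝒟.carrier), x ∈ 𝒟.comp s → y ∈ 𝒟.comp t →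
      x * y = ((β s t : Lˣ) : L) • (y * x)) ∧
  (∀ t : K, IsOfFinOrder t → ∀ x ∈ 𝒟.comp t, x ≠ 0 →
      ∃ c : Lˣ, x ^ orderOf t =
        algebraMap L 𝒟.carrier (((μ t : Lˣ) : L) * ((c : Lˣ) : L) ^ orderOf t))

/-- `β` is an alternating bicharacter `K × K → L^×`. -/
def IsAltBichar (β : K → K → Lˣ) : Prop :=
  (∀ s t u : K, β (s * t) u = β s u * β t u) ∧
  (∀ s t u : K, β s (t * u) = β s t * β s u) ∧
  (∀ t : K, β t t = 1)

/-- The conditions (0)–(3) on `μ` (stated modulo the appropriate groups of powers). -/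
def MuConds (β : K → K → Lˣ) (μ : K → Lˣ) : Prop :=
  (∀ (g : K) (n : ℕ), IsOfFinOrder g → n ∣ orderOf g →
      ∃ c : Lˣ, μ (g ^ n) = μ g * c ^ (orderOf g / n)) ∧
  (∀ g h : K, IsOfFinOrder g → IsOfFinOrder h → Nat.Coprime (orderOf g) (orderOf h) →
      ∃ c : Lˣ, μ (g * h) = μ g ^ orderOf h * μ h ^ orderOf g * c ^ (orderOf g * orderOf h)) ∧
  (∀ (p k l : ℕ) (g h : K), p.Prime → orderOf g = p ^ k → orderOf h = p ^ l → l < k →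
      ∃ c : Lˣ, μ (g * h) = μ g * μ h ^ p ^ (k - l) * c ^ p ^ k) ∧
  (∀ (p k : ℕ) (g h : K), p.Prime → 1 ≤ k →
      orderOf g = p ^ k → orderOf h = p ^ k → orderOf (g * h) = p ^ k →
      (p ≠ 2 → ∃ c : Lˣ, μ (g * h) = μ g * μ h * c ^ p ^ k) ∧
      (p = 2 → ∃ c : Lˣ, μ (g * h) = β g h ^ 2 ^ (k - 1) * (μ g * μ h) * c ^ 2 ^ k))

/-- A graded isomorphism between bundled graded algebras. -/
def GradedIso (𝒟 𝒟' : GradedDivAlg L K) : Prop :=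
  ∃ e : 𝒟.carrier ≃ₐ[L] 𝒟'.carrier, ∀ (t : K) (x : 𝒟.carrier), x ∈ 𝒟.comp t → e x ∈ 𝒟'.comp t

theorem exists_independent_generators (K : Type*) [CommGroup K] [Group.FG K] :
    ∃ (ι : Type) (_ : Fintype ι) (g : ι → K),
      (∀ i, orderOf (g i) = 0 ∨ ∃ p e : ℕ, p.Prime ∧ orderOf (g i) = p ^ e) ∧
      (∀ t, ∃ a : ι → ℤ, ∏ i, g i ^ a i = t) ∧
      ∀ a : ι → ℤ, ∏ i, g i ^ a i = 1 → ∀ i, g i ^ a i = 1 := by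
  classical
  obtain ⟨ι, κ, _, _, p, hp, e, ⟨f⟩⟩ := CommGroup.equiv_free_prod_prod_multiplicative_zmod K
  let g : κ ⊕ ι → K := Sum.elim
    (fun i => f.symm (Pi.mulSingle i (Multiplicative.ofAdd 1), 1))
    (fun j => f.symm (1, Pi.mulSingle j (Multiplicative.ofAdd 1)))
  have h1 : ∀ i, f (g (.inl i)) = (Pi.mulSingle i (Multiplicative.ofAdd 1), 1) := by simp [g]
  have h2 : ∀ i, f (g (.inr i)) = (1, Pi.mulSingle i (Multiplicative.ofAdd 1)) := by simp [g]
  have hprod : ∀ a : κ ⊕ ι → ℤ, f (∏ i, g i ^ a i) =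
      (fun i => Multiplicative.ofAdd (a (.inl i)),
        fun j => Multiplicative.ofAdd ((a (.inr j) : ℤ) : ZMod (p j ^ e j))) := by
    intro a
    rw [map_prod, Fintype.prod_sum_type]
    simp only [map_zpow, h1, h2]
    ext j
    · rw [Prod.fst_mul, Prod.fst_prod, Prod.fst_prod, Pi.mul_apply, Finset.prod_apply,
        Finset.prod_apply, Finset.prod_eq_single j _ (by simp)]
      · simp
      · intro b _ hb
        simp [Pi.mulSingle_eq_of_ne hb.symm]
    · rw [Prod.snd_mul, Prod.snd_prod, Prod.snd_prod, Pi.mul_apply, Finset.prod_apply,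
        Finset.prod_apply, Finset.prod_eq_single j _ (by simp)]
      · simp
      · intro b _ hb
        simp [Pi.mulSingle_eq_of_ne hb.symm]
  have hl : ∀ i, orderOf (g (.inl i)) = 0 := by
    intro i
    rw [← MulEquiv.orderOf_eq f, h1, orderOf_eq_zero_iff']
    intro n hn h
    have := congrArg Multiplicative.toAdd (congrFun (congrArg Prod.fst h) i)
    simp at this
    omega
  have hr : ∀ j, orderOf (g (.inr j)) = p j ^ e j := by
    intro j
    rw [← MulEquiv.orderOf_eq f, h2, Prod.orderOf_mk, orderOf_one,
      orderOf_piMulSingle, Nat.lcm_one_left, orderOf_ofAdd_eq_addOrderOf, ZMod.addOrderOf_one]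
  refine ⟨κ ⊕ ι, inferInstance, g, ?_, ?_, ?_⟩
  · rintro (i | j)
    · exact .inl (hl i)
    · exact .inr ⟨p j, e j, hp j, hr j⟩
  · intro t
    refine ⟨Sum.elim (fun i => ((f t).1 i).toAdd) (fun j => (((f t).2 j).toAdd.cast : ℤ)), ?_⟩
    apply f.injective
    rw [hprod]
    ext j <;> simp
  · intro a ha i
    have h := hprod a
    rw [ha, map_one] at h
    rw [← orderOf_dvd_iff_zpow_eq_one]
    rcases i with i | j
    · have := congrArg Multiplicative.toAdd (congrFun (congrArg Prod.fst h) i)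
      simp at this
      simp [← this]
    · have := congrArg Multiplicative.toAdd (congrFun (congrArg Prod.snd h) j)
      simp only [Prod.snd_one, Pi.one_apply, toAdd_one, toAdd_ofAdd] at this
      rw [hr]
      exact (ZMod.intCast_zmod_eq_zero_iff_dvd _ _).1 this.symm

theorem pow_mem_of_primePow_closed {K : Type*} [CommGroup K] {S : Set K} (hone : 1 ∈ S) {p : ℕ}
    (hp : p.Prime)
    (hpow : ∀ (g : K) (n : ℕ), IsOfFinOrder g → n ∣ orderOf g → g ∈ S → g ^ n ∈ S)
    (hlt : ∀ (k l : ℕ) (g h : K), orderOf g = p ^ k → orderOf h = p ^ l → l < k →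
      g ∈ S → h ∈ S → g * h ∈ S)
    (heq : ∀ (k : ℕ) (g h : K), 1 ≤ k → orderOf g = p ^ k → orderOf h = p ^ k →
      orderOf (g * h) = p ^ k → g ∈ S → h ∈ S → g * h ∈ S)
    (a : ℕ) : ∀ (g : K) (k : ℕ), orderOf g = p ^ k → g ∈ S → g ^ a ∈ S := by
  induction a using Nat.strong_induction_on with
  | _ a ih =>
    intro g k hg hgS
    have hfin : IsOfFinOrder g := orderOf_pos_iff.1 (by rw [hg]; exact pow_pos hp.pos _)
    rcases Nat.eq_zero_or_pos a with rfl | ha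
    · simpa using hone
    rcases Nat.eq_zero_or_pos k with rfl | hk
    · rw [pow_zero, orderOf_eq_one_iff] at hg
      simpa [hg] using hone
    have hcop : ∀ b : ℕ, ¬ p ∣ b → orderOf (g ^ b) = p ^ k := by
      intro b hb
      rw [Nat.Coprime.orderOf_pow, hg]
      rw [hg]
      exact ((Nat.Prime.coprime_iff_not_dvd hp).2 hb).pow_left _
    by_cases hpa : p ∣ a
    · obtain ⟨b, rfl⟩ := hpa
      have hpg : p ∣ orderOf g := hg ▸ dvd_pow_self p hk.ne'
      rw [pow_mul]
      refine ih b ?_ _ (k - 1) ?_ (hpow g p hfin hpg hgS)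
      · have := hp.two_le
        have : 0 < b := Nat.pos_of_mul_pos_left ha
        nlinarith
      · rw [orderOf_pow_of_dvd hp.ne_zero hpg, hg, Nat.pow_div hk hp.pos |>.symm, pow_one]
    · have hmem : g ^ (a - 1) ∈ S := ih (a - 1) (by omega) g k hg hgS
      have hsplit : g ^ a = g * g ^ (a - 1) := by rw [← pow_succ', Nat.sub_add_cancel ha]
      by_cases hpa1 : p ∣ a - 1
      · obtain ⟨b, hb⟩ := hpa1
        have hdvd : orderOf (g ^ (a - 1)) ∣ p ^ (k - 1) := by
          rw [orderOf_dvd_iff_pow_eq_one, hb, ← pow_mul, mul_right_comm, ← pow_succ',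
            Nat.sub_add_cancel hk, ← hg, pow_mul, pow_orderOf_eq_one, one_pow]
        obtain ⟨l, hl, hl'⟩ := (Nat.dvd_prime_pow hp).1 hdvd
        rw [hsplit]
        exact hlt k l _ _ hg hl' (by omega) hgS hmem
      · rw [hsplit]
        exact heq k _ _ hk hg (hcop _ hpa1) (hsplit ▸ hcop _ hpa) hgS hmem

theorem mem_of_primePow_of_coprime_closed {K : Type*} [CommGroup K] {S : Set K}
    (hcop : ∀ g h : K, IsOfFinOrder g → IsOfFinOrder h → Nat.Coprime (orderOf g) (orderOf h) →
      g ∈ S → h ∈ S → g * h ∈ S)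
    (hprime : ∀ (p k : ℕ) (g : K), p.Prime → orderOf g = p ^ k → g ∈ S)
    (t : K) (ht : IsOfFinOrder t) : t ∈ S := by
  suffices H : ∀ n : ℕ, ∀ t : K, orderOf t = n → n ≠ 0 → t ∈ S from
    H _ t rfl ht.orderOf_pos.ne'
  intro n
  induction n using Nat.recOnPrimeCoprime with
  | zero => exact fun _ _ h => absurd rfl h
  | prime_pow p k hp => exact fun t h _ => hprime p k t hp h
  | coprime a b ha hb hab iha ihb =>
    intro t ht' hne
    have hta : orderOf (t ^ b) = a := by
      rw [orderOf_pow_of_dvd (by omega) (ht' ▸ dvd_mul_left b a), ht',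
        Nat.mul_div_cancel _ (by omega)]
    have htb : orderOf (t ^ a) = b := by
      rw [orderOf_pow_of_dvd (by omega) (ht' ▸ dvd_mul_right a b), ht',
        Nat.mul_div_cancel_left _ (by omega)]
    have hbez : (t ^ b) ^ (Nat.gcdB a b) * (t ^ a) ^ (Nat.gcdA a b) = t := by
      have h := Nat.gcd_eq_gcd_ab a b
      rw [hab.gcd_eq_one] at h
      rw [← zpow_natCast, ← zpow_natCast, ← zpow_mul, ← zpow_mul, ← zpow_add, add_comm, ← h]
      simp
    have hA : orderOf ((t ^ b) ^ (Nat.gcdB a b)) ∣ a := by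
      rw [orderOf_dvd_iff_pow_eq_one, ← zpow_natCast, zpow_comm, zpow_natCast, ← hta,
        pow_orderOf_eq_one, one_zpow]
    have hB : orderOf ((t ^ a) ^ (Nat.gcdA a b)) ∣ b := by
      rw [orderOf_dvd_iff_pow_eq_one, ← zpow_natCast, zpow_comm, zpow_natCast, ← htb,
        pow_orderOf_eq_one, one_zpow]
    have hAB := (Commute.all _ _).orderOf_mul_eq_mul_orderOf_of_coprime
      (hab.of_dvd hA hB)
    rw [hbez, ht'] at hAB
    have hA' := Nat.le_of_dvd (by omega) hA
    have hB' := Nat.le_of_dvd (by omega) hB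
    replace hA : orderOf ((t ^ b) ^ (Nat.gcdB a b)) = a := by
      refine le_antisymm hA' (le_of_mul_le_mul_right ?_ (by omega : 0 < b))
      rw [hAB]
      exact Nat.mul_le_mul_left _ hB'
    replace hB : orderOf ((t ^ a) ^ (Nat.gcdA a b)) = b := by
      rw [hA] at hAB
      exact (Nat.eq_of_mul_eq_mul_left (by omega) hAB).symm
    rw [← hbez]
    exact hcop _ _ (orderOf_pos_iff.1 (by omega)) (orderOf_pos_iff.1 (by omega))
      (by rwa [hA, hB]) (iha _ hA (by omega)) (ihb _ hB (by omega))

theorem mem_of_generators_of_closed {K : Type*} [CommGroup K] {ι : Type*} [Fintype ι] {g : ι → K}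
    (hg : ∀ i, orderOf (g i) = 0 ∨ ∃ p e : ℕ, p.Prime ∧ orderOf (g i) = p ^ e)
    (hspan : ∀ t, ∃ a : ι → ℤ, ∏ i, g i ^ a i = t)
    (hind : ∀ a : ι → ℤ, ∏ i, g i ^ a i = 1 → ∀ i, g i ^ a i = 1)
    {S : Set K} (hone : 1 ∈ S) (hgS : ∀ i, IsOfFinOrder (g i) → g i ∈ S)
    (hpow : ∀ (g : K) (n : ℕ), IsOfFinOrder g → n ∣ orderOf g → g ∈ S → g ^ n ∈ S)
    (hcop : ∀ g h : K, IsOfFinOrder g → IsOfFinOrder h → Nat.Coprime (orderOf g) (orderOf h) →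
      g ∈ S → h ∈ S → g * h ∈ S)
    (hlt : ∀ (p k l : ℕ) (g h : K), p.Prime → orderOf g = p ^ k → orderOf h = p ^ l → l < k →
      g ∈ S → h ∈ S → g * h ∈ S)
    (heq : ∀ (p k : ℕ) (g h : K), p.Prime → 1 ≤ k → orderOf g = p ^ k → orderOf h = p ^ k →
      orderOf (g * h) = p ^ k → g ∈ S → h ∈ S → g * h ∈ S)
    (t : K) (ht : IsOfFinOrder t) : t ∈ S := by
  classical
  refine mem_of_primePow_of_coprime_closed hcop (fun p k t hp ht => ?_) t ht
  obtain ⟨a, rfl⟩ := hspan t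
  have hk : ∀ i, (g i ^ a i) ^ p ^ k = 1 := by
    intro i
    have := hind (fun i => a i * (p ^ k : ℕ)) (by
      simp_rw [zpow_mul, zpow_natCast]
      rw [Finset.prod_pow, ← ht, pow_orderOf_eq_one]) i
    rwa [zpow_mul, zpow_natCast] at this
  have hS : ∀ i, g i ^ a i ∈ S := by
    intro i
    rcases hg i with h0 | ⟨q, e, hq, he⟩
    · have := hk i
      rw [← zpow_natCast, ← zpow_mul, ← orderOf_dvd_iff_zpow_eq_one, h0] at this
      have h1 := pow_pos hp.pos k
      simp [hp.ne_zero] at this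
      have h2 : a i = 0 := by tauto
      simpa [h2] using hone
    · have hfin : IsOfFinOrder (g i) := orderOf_pos_iff.1 (he ▸ pow_pos hq.pos _)
      obtain ⟨m, hm⟩ : ∃ m : ℕ, g i ^ a i = g i ^ m := by
        obtain ⟨m, hm⟩ := hfin.mem_powers_iff_mem_zpowers.2 ⟨a i, rfl⟩
        exact ⟨m, hm.symm⟩
      rw [hm]
      exact pow_mem_of_primePow_closed hone hq hpow (fun k l g h => hlt q k l g h hq)
        (fun k g h => heq q k g h hq) m (g i) e he (hgS i hfin)
  have hord : ∀ u : K, u ^ p ^ k = 1 → ∃ l, orderOf u = p ^ l := fun u hu => by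
    obtain ⟨l, -, hl⟩ := (Nat.dvd_prime_pow hp).1 (orderOf_dvd_iff_pow_eq_one.2 hu)
    exact ⟨l, hl⟩
  suffices H : ∀ s : Finset ι, ∏ i ∈ s, g i ^ a i ∈ S from H Finset.univ
  intro s
  induction s using Finset.induction_on with
  | empty => simpa using hone
  | insert j s hj ih =>
    obtain ⟨k', hu⟩ := hord (∏ i ∈ s, g i ^ a i) (by
      rw [← Finset.prod_pow]; exact Finset.prod_eq_one fun i _ => hk i)
    obtain ⟨l, hv⟩ := hord _ (hk j)
    rw [Finset.prod_insert hj]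
    rcases lt_trichotomy k' l with h | rfl | h
    · exact hlt p _ _ _ _ hp hv hu h (hS j) ih
    · rcases Nat.eq_zero_or_pos k' with rfl | hpos
      · rw [pow_zero, orderOf_eq_one_iff] at hu hv
        simpa [hu, hv] using hone
      refine heq p k' _ _ hp hpos hv hu (Nat.dvd_antisymm ?_ ?_) (hS j) ih
      · rw [orderOf_dvd_iff_pow_eq_one, mul_pow, ← hu, pow_orderOf_eq_one, hu, ← hv,
          pow_orderOf_eq_one, one_mul]
      · rw [← hv, orderOf_dvd_iff_pow_eq_one]
        set m := orderOf (g j ^ a j * ∏ i ∈ s, g i ^ a i) with hm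
        have h1 : (∏ i ∈ insert j s, g i ^ a i) ^ m = 1 := by
          rw [Finset.prod_insert hj, hm, pow_orderOf_eq_one]
        have := hind (fun i => if i ∈ insert j s then a i * m else 0) (by
          rw [← h1, ← Finset.prod_pow, ← Finset.prod_subset (Finset.subset_univ (insert j s))]
          · refine Finset.prod_congr rfl fun i hi => ?_
            rw [if_pos hi, zpow_mul, zpow_natCast]
          · intro i _ hi
            rw [if_neg hi, zpow_zero]) j
        simpa [zpow_mul] using this
    · rw [mul_comm]
      exact hlt p _ _ _ _ hp hu hv h ih (hS j)

namespace GradedDivAlg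

variable {𝒞 : GradedDivAlg L K}

theorem exists_mem_ne_zero {t : K} (hd : Module.finrank L (𝒞.comp t) = 1) :
    ∃ x ∈ 𝒞.comp t, x ≠ 0 := by
  have : Nontrivial (𝒞.comp t) := Module.nontrivial_of_finrank_pos (R := L) (by omega)
  obtain ⟨x, hx⟩ := exists_ne (0 : 𝒞.comp t)
  exact ⟨x, x.2, by simpa using hx⟩

theorem nontrivial_carrier {t : K} (hd : Module.finrank L (𝒞.comp t) = 1) :
    Nontrivial 𝒞.carrier :=
  let ⟨_, _, hx⟩ := exists_mem_ne_zero hd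
  nontrivial_of_ne _ _ hx

theorem exists_smul_eq {t : K} (hd : Module.finrank L (𝒞.comp t) = 1) {x y : 𝒞.carrier}
    (hx : x ∈ 𝒞.comp t) (hx0 : x ≠ 0) (hy : y ∈ 𝒞.comp t) : ∃ c : L, c • x = y := by
  obtain ⟨c, hc⟩ := (finrank_eq_one_iff_of_nonzero' (⟨x, hx⟩ : 𝒞.comp t)
    (by simpa using hx0)).1 hd ⟨y, hy⟩
  exact ⟨c, congrArg Subtype.val hc⟩

theorem exists_unit_smul_eq {t : K} (hd : Module.finrank L (𝒞.comp t) = 1) {x y : 𝒞.carrier}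
    (hx : x ∈ 𝒞.comp t) (hx0 : x ≠ 0) (hy : y ∈ 𝒞.comp t) (hy0 : y ≠ 0) :
    ∃ c : Lˣ, (c : L) • x = y := by
  obtain ⟨c, hc⟩ := exists_smul_eq hd hx hx0 hy
  exact ⟨Units.mk0 c (by rintro rfl; exact hy0 (by simpa using hc.symm)), hc⟩

theorem mul_ne_zero {s : K} {x y : 𝒞.carrier} (hx : x ∈ 𝒞.comp s) (hx0 : x ≠ 0) (hy0 : y ≠ 0) :
    x * y ≠ 0 := by
  rw [Ne, (𝒞.div s x hx hx0).mul_right_eq_zero]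
  exact hy0

theorem pow_mem {t : K} {x : 𝒞.carrier} (hx : x ∈ 𝒞.comp t) (n : ℕ) : x ^ n ∈ 𝒞.comp (t ^ n) := by
  induction n with
  | zero => simpa using 𝒞.one_mem
  | succ n ih => rw [pow_succ, pow_succ]; exact 𝒞.mul_mem ih hx

theorem pow_ne_zero {t : K} {x : 𝒞.carrier} (hx : x ∈ 𝒞.comp t) (hx0 : x ≠ 0) (n : ℕ) :
    x ^ n ≠ 0 :=
  have : Nontrivial 𝒞.carrier := nontrivial_of_ne _ _ hx0
  ((𝒞.div t x hx hx0).pow n).ne_zero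

theorem exists_pow_eq_algebraMap {t : K} (hd : Module.finrank L (𝒞.comp 1) = 1) {x : 𝒞.carrier}
    (hx : x ∈ 𝒞.comp t) (hx0 : x ≠ 0) {n : ℕ} (hn : t ^ n = 1) :
    ∃ m : Lˣ, x ^ n = algebraMap L 𝒞.carrier m := by
  have := nontrivial_carrier hd
  obtain ⟨m, hm⟩ := exists_unit_smul_eq hd 𝒞.one_mem one_ne_zero (hn ▸ pow_mem hx n)
    (pow_ne_zero hx hx0 n)
  exact ⟨m, by rw [← hm, Algebra.algebraMap_eq_smul_one]⟩

theorem unit_smul_injective {x : 𝒞.carrier} (hx : x ≠ 0) {a b : Lˣ}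
    (h : (a : L) • x = (b : L) • x) : a = b :=
  Units.ext (smul_left_injective L hx h)

/-- A nonzero vector in each component, equal to `1` in degree `1`. -/
theorem exists_frame (hd : ∀ t : K, Module.finrank L (𝒞.comp t) = 1) :
    ∃ X : K → 𝒞.carrier, X 1 = 1 ∧ (∀ t, X t ∈ 𝒞.comp t) ∧ ∀ t, X t ≠ 0 := by
  choose X hX hX0 using fun t => exists_mem_ne_zero (hd t)
  have := nontrivial_carrier (hd 1)
  refine ⟨Function.update X 1 1, by simp, fun t => ?_, fun t => ?_⟩ <;>
    rcases eq_or_ne t 1 with rfl | h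
  · simpa using 𝒞.one_mem
  · simpa [h] using hX t
  · simp
  · simpa [h] using hX0 t

theorem exists_commutation (hd : ∀ t : K, Module.finrank L (𝒞.comp t) = 1) :
    ∃ β : K → K → Lˣ, ∀ (s t : K) (x y : 𝒞.carrier), x ∈ 𝒞.comp s → y ∈ 𝒞.comp t →
      x * y = ((β s t : Lˣ) : L) • (y * x) := by
  obtain ⟨X, -, hX, hX0⟩ := exists_frame hd
  choose β hβ using fun s t => exists_unit_smul_eq (hd (s * t))
    (mul_comm s t ▸ 𝒞.mul_mem (hX t) (hX s)) (mul_ne_zero (hX t) (hX0 t) (hX0 s))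
    (𝒞.mul_mem (hX s) (hX t)) (mul_ne_zero (hX s) (hX0 s) (hX0 t))
  refine ⟨β, fun s t x y hx hy => ?_⟩
  obtain ⟨a, rfl⟩ := exists_smul_eq (hd s) (hX s) (hX0 s) hx
  obtain ⟨b, rfl⟩ := exists_smul_eq (hd t) (hX t) (hX0 t) hy
  simp only [smul_mul_smul_comm, ← hβ s t, smul_smul]
  congr 1
  ring

theorem exists_satisfiesData (hd : ∀ t : K, Module.finrank L (𝒞.comp t) = 1) :
    ∃ (β : K → K → Lˣ) (μ : K → Lˣ), SatisfiesData 𝒞 β μ := by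
  obtain ⟨β, hβ⟩ := exists_commutation hd
  obtain ⟨X, -, hX, hX0⟩ := exists_frame hd
  choose μ hμ using fun t => exists_pow_eq_algebraMap (hd 1) (hX t) (hX0 t) (pow_orderOf_eq_one t)
  refine ⟨β, μ, hd, hβ, fun t _ x hx hx0 => ?_⟩
  obtain ⟨c, rfl⟩ := exists_unit_smul_eq (hd t) (hX t) (hX0 t) hx hx0
  refine ⟨c, ?_⟩
  rw [smul_pow, hμ, mul_comm, map_mul, Algebra.smul_def]

end GradedDivAlg

theorem pow_mul_pow_of_mul_eq_smul {R A : Type*} [CommSemiring R] [Semiring A] [Algebra R A]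
    {x y : A} {b : R} (h : x * y = b • (y * x)) (n : ℕ) :
    x ^ n * y ^ n = b ^ n.choose 2 • (x * y) ^ n := by
  have hxy : ∀ n : ℕ, x * y ^ n = b ^ n • (y ^ n * x) := by
    intro n
    induction n with
    | zero => simp
    | succ n ih =>
      rw [pow_succ, ← mul_assoc, ih, smul_mul_assoc, mul_assoc, h, mul_smul_comm, smul_smul,
        ← pow_succ, mul_assoc]
  induction n with
  | zero => simp
  | succ n ih =>
    rw [pow_succ x, pow_succ y, mul_assoc, ← mul_assoc x, hxy, smul_mul_assoc, mul_smul_comm,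
      mul_assoc, ← mul_assoc (x ^ n), ih, smul_mul_assoc, smul_smul, ← pow_add, ← pow_succ,
      Nat.choose_succ_succ' n 1, Nat.choose_one_right]

theorem pow_eq_algebraMap_of_dvd {L A : Type*} [Field L] [Ring A] [Algebra L A] {x : A}
    {m n : ℕ} {a : Lˣ}
    (ha : x ^ m = algebraMap L A a) (hmn : m ∣ n) :
    x ^ n = algebraMap L A ((a ^ (n / m) : Lˣ) : L) := by
  conv_lhs => rw [← Nat.mul_div_cancel' hmn, pow_mul, ha]
  simp

theorem dvd_choose_two_of_odd {n : ℕ} (hn : Odd n) : n ∣ n.choose 2 := by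
  obtain ⟨m, rfl⟩ := hn
  rw [Nat.choose_two_right, Nat.add_sub_cancel, Nat.mul_div_assoc _ (dvd_mul_right 2 m)]
  exact dvd_mul_right _ _

theorem two_pow_succ_choose_two (k : ℕ) :
    (2 ^ (k + 1)).choose 2 = 2 ^ k * (2 ^ (k + 1) - 1) := by
  rw [Nat.choose_two_right, pow_succ, mul_right_comm, Nat.mul_div_cancel _ two_pos]

theorem orderOf_mul_eq_of_primePow_lt {G : Type*} [CommGroup G] {p k l : ℕ} {g h : G}
    (hp : p.Prime) (hg : orderOf g = p ^ k) (hh : orderOf h = p ^ l) (hlt : l < k) :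
    orderOf (g * h) = p ^ k := by
  obtain ⟨k, rfl⟩ : ∃ k', k = k' + 1 := ⟨k - 1, by omega⟩
  have h1 : h ^ p ^ k = 1 := orderOf_dvd_iff_pow_eq_one.1 (hh ▸ pow_dvd_pow p (by omega))
  have := Fact.mk hp
  refine orderOf_eq_prime_pow ?_ ?_
  · rw [mul_pow, h1, mul_one, ← orderOf_dvd_iff_pow_eq_one, hg,
      Nat.pow_dvd_pow_iff_le_right hp.one_lt]
    omega
  · rw [mul_pow, pow_succ, pow_mul h, h1, one_pow, mul_one, ← pow_succ, ← hg, pow_orderOf_eq_one]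

namespace IsAltBichar

variable {L : Type*} [Field L] {K : Type*} [CommGroup K] {β : K → K → Lˣ}

/-- An alternating bicharacter as a bimultiplicative homomorphism. -/
def hom (hβ : IsAltBichar β) : K →* K →* Lˣ :=
  MonoidHom.mk' (fun s => MonoidHom.mk' (β s) (hβ.2.1 s)) fun s t =>
    MonoidHom.ext fun u => hβ.1 s t u

theorem hom_apply (hβ : IsAltBichar β) (s t : K) : hβ.hom s t = β s t := rfl

theorem pow_left (hβ : IsAltBichar β) (s t : K) (n : ℕ) : β (s ^ n) t = β s t ^ n := by
  simp [← hβ.hom_apply]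

theorem pow_right (hβ : IsAltBichar β) (s t : K) (n : ℕ) : β s (t ^ n) = β s t ^ n := by
  simp [← hβ.hom_apply]

theorem one_left (hβ : IsAltBichar β) (t : K) : β 1 t = 1 := by
  simp [← hβ.hom_apply]

theorem one_right (hβ : IsAltBichar β) (t : K) : β t 1 = 1 := by
  simp [← hβ.hom_apply]

theorem mul_swap (hβ : IsAltBichar β) (s t : K) : β s t * β t s = 1 := by
  have h := hβ.2.2 (s * t)
  rw [hβ.1, hβ.2.1, hβ.2.1, hβ.2.2, hβ.2.2, one_mul, mul_one] at h
  exact h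

end IsAltBichar

namespace SatisfiesData

variable {𝒞 : GradedDivAlg L K} {β : K → K → Lˣ} {μ : K → Lˣ}

theorem eq_of_comm (h : SatisfiesData 𝒞 β μ) {s t : K} {x y : 𝒞.carrier} (hx : x ∈ 𝒞.comp s)
    (hx0 : x ≠ 0) (hy : y ∈ 𝒞.comp t) (hy0 : y ≠ 0) {b : Lˣ} (hb : x * y = (b : L) • (y * x)) :
    β s t = b :=
  GradedDivAlg.unit_smul_injective (GradedDivAlg.mul_ne_zero hy hy0 hx0)
    (by rw [← hb, h.2.1 s t x y hx hy])

theorem isAltBichar (h : SatisfiesData 𝒞 β μ) : IsAltBichar β := by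
  obtain ⟨X, -, hX, hX0⟩ := GradedDivAlg.exists_frame h.1
  have hne : ∀ s t, X s * X t ≠ 0 := fun s t =>
    GradedDivAlg.mul_ne_zero (hX s) (hX0 s) (hX0 t)
  refine ⟨fun s t u => ?_, fun s t u => ?_, fun t => ?_⟩
  · refine h.eq_of_comm (𝒞.mul_mem (hX s) (hX t)) (hne s t) (hX u) (hX0 u) ?_
    rw [mul_assoc, h.2.1 t u _ _ (hX t) (hX u), mul_smul_comm, ← mul_assoc,
      h.2.1 s u _ _ (hX s) (hX u), smul_mul_assoc, smul_smul, mul_assoc, mul_comm (β s u),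
      Units.val_mul]
  · refine h.eq_of_comm (hX s) (hX0 s) (𝒞.mul_mem (hX t) (hX u)) (hne t u) ?_
    rw [← mul_assoc, h.2.1 s t _ _ (hX s) (hX t), smul_mul_assoc, mul_assoc,
      h.2.1 s u _ _ (hX s) (hX u), mul_smul_comm, smul_smul, mul_assoc, Units.val_mul]
  · exact h.eq_of_comm (hX t) (hX0 t) (hX t) (hX0 t) (by simp)

theorem exists_of_pow_eq (h : SatisfiesData 𝒞 β μ) {t : K} (ht : IsOfFinOrder t) {x : 𝒞.carrier}
    (hx : x ∈ 𝒞.comp t) (hx0 : x ≠ 0) {m : Lˣ}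
    (hm : x ^ orderOf t = algebraMap L 𝒞.carrier m) : ∃ c : Lˣ, μ t = m * c ^ orderOf t := by
  have := GradedDivAlg.nontrivial_carrier (h.1 1)
  obtain ⟨c, hc⟩ := h.2.2 t ht x hx hx0
  have := FaithfulSMul.algebraMap_injective L 𝒞.carrier (hm.symm.trans hc)
  refine ⟨c⁻¹, ?_⟩
  rw [inv_pow, eq_mul_inv_iff_mul_eq]
  exact Units.ext (by simpa using this.symm)

theorem exists_pow_eq (h : SatisfiesData 𝒞 β μ) {t : K} (ht : IsOfFinOrder t) :
    ∃ x ∈ 𝒞.comp t, x ≠ 0 ∧ x ^ orderOf t = algebraMap L 𝒞.carrier (μ t) := by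
  obtain ⟨x, hx, hx0⟩ := GradedDivAlg.exists_mem_ne_zero (h.1 t)
  obtain ⟨c, hc⟩ := h.2.2 t ht x hx hx0
  refine ⟨((c⁻¹ : Lˣ) : L) • x, Submodule.smul_mem _ _ hx, by simpa using hx0, ?_⟩
  rw [smul_pow, hc, Algebra.smul_def, ← map_mul]
  congr 1
  rw [mul_left_comm, ← mul_pow, Units.inv_mul, one_pow, mul_one]

theorem exists_mul_eq (h : SatisfiesData 𝒞 β μ) {g k : K} {x y : 𝒞.carrier} (hx : x ∈ 𝒞.comp g)
    (hx0 : x ≠ 0) (hy : y ∈ 𝒞.comp k) (hy0 : y ≠ 0) {n : ℕ} (hn : orderOf (g * k) = n)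
    (hn0 : 0 < n) {a b : Lˣ} (ha : x ^ n = algebraMap L 𝒞.carrier a)
    (hb : y ^ n = algebraMap L 𝒞.carrier b) :
    ∃ c : Lˣ, μ (g * k) = (β g k ^ n.choose 2)⁻¹ * (a * b) * c ^ n := by
  subst hn
  refine h.exists_of_pow_eq (orderOf_pos_iff.1 hn0) (𝒞.mul_mem hx hy)
    (GradedDivAlg.mul_ne_zero hx hx0 hy0) ?_
  have := pow_mul_pow_of_mul_eq_smul (h.2.1 g k x y hx hy) (orderOf (g * k))
  rw [ha, hb, ← map_mul, ← Units.val_pow_eq_pow_val] at this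
  rw [Units.val_mul, map_mul, Units.val_mul, this, ← Algebra.smul_def, smul_smul, Units.inv_mul,
    one_smul]

theorem muConds (h : SatisfiesData 𝒞 β μ) : MuConds β μ := by
  have hβ := h.isAltBichar
  refine ⟨fun g n hg hn => ?_, fun g k hg hk hgk => ?_, fun p k l g g' hp hg hg' hlt => ?_,
    fun p k g g' hp hk hg hg' hgg => ?_⟩
  · obtain ⟨x, hx, hx0, hxp⟩ := h.exists_pow_eq hg
    have hord : orderOf (g ^ n) = orderOf g / n :=
      orderOf_pow_of_dvd (by rintro rfl; exact hg.orderOf_pos.ne' (zero_dvd_iff.1 hn)) hn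
    rw [← hord]
    refine h.exists_of_pow_eq hg.pow (GradedDivAlg.pow_mem hx n) (GradedDivAlg.pow_ne_zero hx hx0 n)
      ?_
    rw [hord, ← pow_mul, Nat.mul_div_cancel' hn, hxp]
  · obtain ⟨x, hx, hx0, hxp⟩ := h.exists_pow_eq hg
    obtain ⟨y, hy, hy0, hyp⟩ := h.exists_pow_eq hk
    have hb : β g k = 1 := by
      have h1 : β g k ^ orderOf g = 1 := by
        rw [← hβ.pow_left, pow_orderOf_eq_one, hβ.one_left]
      have h2 : β g k ^ orderOf k = 1 := by
        rw [← hβ.pow_right, pow_orderOf_eq_one, hβ.one_right]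
      exact orderOf_eq_one_iff.1 (Nat.eq_one_of_dvd_coprimes hgk
        (orderOf_dvd_of_pow_eq_one h1) (orderOf_dvd_of_pow_eq_one h2))
    have := h.exists_mul_eq hx hx0 hy hy0
      ((Commute.all g k).orderOf_mul_eq_mul_orderOf_of_coprime hgk)
      (Nat.mul_pos hg.orderOf_pos hk.orderOf_pos)
      (pow_eq_algebraMap_of_dvd hxp (dvd_mul_right _ _))
      (pow_eq_algebraMap_of_dvd hyp (dvd_mul_left _ _))
    rwa [hb, one_pow, inv_one, one_mul, Nat.mul_div_cancel_left _ hg.orderOf_pos,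
      Nat.mul_div_cancel _ hk.orderOf_pos] at this
  · have hgf : IsOfFinOrder g := orderOf_pos_iff.1 (hg ▸ pow_pos hp.pos _)
    have hgf' : IsOfFinOrder g' := orderOf_pos_iff.1 (hg' ▸ pow_pos hp.pos _)
    obtain ⟨x, hx, hx0, hxp⟩ := h.exists_pow_eq hgf
    obtain ⟨y, hy, hy0, hyp⟩ := h.exists_pow_eq hgf'
    obtain ⟨k, rfl⟩ : ∃ k', k = k' + 1 := ⟨k - 1, by omega⟩
    have hg1 : g' ^ p ^ k = 1 :=
      orderOf_dvd_iff_pow_eq_one.1 (hg' ▸ pow_dvd_pow p (by omega))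
    have hord := orderOf_mul_eq_of_primePow_lt hp hg hg' hlt
    have hb : β g g' ^ (p ^ (k + 1)).choose 2 = 1 := by
      have h1 : β g g' ^ p ^ k = 1 := by rw [← hβ.pow_right, hg1, hβ.one_right]
      have h2 : p ^ k ∣ (p ^ (k + 1)).choose 2 := by
        rcases hp.eq_two_or_odd' with rfl | hodd
        · exact two_pow_succ_choose_two k ▸ dvd_mul_right _ _
        · exact (pow_dvd_pow p k.le_succ).trans (dvd_choose_two_of_odd hodd.pow)
      obtain ⟨d, hd⟩ := h2
      rw [hd, pow_mul, h1, one_pow]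
    have := h.exists_mul_eq hx hx0 hy hy0 hord (pow_pos hp.pos _) (hg ▸ hxp)
      (pow_eq_algebraMap_of_dvd hyp (hg' ▸ pow_dvd_pow p hlt.le))
    rwa [hb, inv_one, one_mul, hg', Nat.pow_div hlt.le hp.pos] at this
  · have hgf : IsOfFinOrder g := orderOf_pos_iff.1 (hg ▸ pow_pos hp.pos _)
    have hgf' : IsOfFinOrder g' := orderOf_pos_iff.1 (hg' ▸ pow_pos hp.pos _)
    obtain ⟨x, hx, hx0, hxp⟩ := h.exists_pow_eq hgf
    obtain ⟨y, hy, hy0, hyp⟩ := h.exists_pow_eq hgf'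
    have hb : β g g' ^ p ^ k = 1 := by
      rw [← hβ.pow_left, ← hg, pow_orderOf_eq_one, hβ.one_left]
    have := h.exists_mul_eq hx hx0 hy hy0 hgg (pow_pos hp.pos _) (hg ▸ hxp) (hg' ▸ hyp)
    refine ⟨fun hp2 => ?_, ?_⟩
    · have h1 : p ^ k ∣ (p ^ k).choose 2 := dvd_choose_two_of_odd (hp.odd_of_ne_two hp2).pow
      obtain ⟨d, hd⟩ := h1
      rwa [hd, pow_mul, hb, one_pow, inv_one, one_mul] at this
    · rintro rfl
      have h1 : (β g g' ^ (2 ^ k).choose 2)⁻¹ = β g g' ^ 2 ^ (k - 1) := by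
        obtain ⟨k, rfl⟩ : ∃ k', k = k' + 1 := ⟨k - 1, by omega⟩
        rw [two_pow_succ_choose_two, inv_eq_iff_mul_eq_one, ← pow_add, Nat.add_sub_cancel,
          ← Nat.mul_succ, Nat.succ_eq_add_one, Nat.sub_add_cancel Nat.one_le_two_pow, mul_comm,
          pow_mul, hb, one_pow]
      rwa [h1] at this

end SatisfiesData

theorem MuConds.eq_of_generators {L : Type*} [Field L] {K : Type*} [CommGroup K] {ι : Type*}
    [Fintype ι] {g : ι → K}
    (hg : ∀ i, orderOf (g i) = 0 ∨ ∃ p e : ℕ, p.Prime ∧ orderOf (g i) = p ^ e)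
    (hspan : ∀ t, ∃ a : ι → ℤ, ∏ i, g i ^ a i = t)
    (hind : ∀ a : ι → ℤ, ∏ i, g i ^ a i = 1 → ∀ i, g i ^ a i = 1)
    {β : K → K → Lˣ} {μ μ' : K → Lˣ} (h : MuConds β μ) (h' : MuConds β μ')
    (hgen : ∀ i, IsOfFinOrder (g i) → ∃ c : Lˣ, μ' (g i) = μ (g i) * c ^ orderOf (g i))
    (t : K) (ht : IsOfFinOrder t) : ∃ c : Lˣ, μ' t = μ t * c ^ orderOf t := by
  obtain ⟨h0, h1, h2, h3⟩ := h
  obtain ⟨h0', h1', h2', h3'⟩ := h'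
  refine mem_of_generators_of_closed (S := {t | ∃ c : Lˣ, μ' t = μ t * c ^ orderOf t}) hg hspan hind
    ⟨(μ 1)⁻¹ * μ' 1, by simp⟩ hgen ?_ ?_ ?_ ?_ t ht
  · rintro g n hgf hn ⟨c, hc⟩
    obtain ⟨d, hd⟩ := h0 g n hgf hn
    obtain ⟨d', hd'⟩ := h0' g n hgf hn
    have hord : orderOf (g ^ n) = orderOf g / n :=
      orderOf_pow_of_dvd (by rintro rfl; exact hgf.orderOf_pos.ne' (zero_dvd_iff.1 hn)) hn
    refine ⟨c ^ n * d' * d⁻¹, ?_⟩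
    rw [hd', hc, hd, hord, mul_pow, mul_pow, ← pow_mul, Nat.mul_div_cancel' hn, inv_pow]
    ext
    push_cast
    field_simp
  · rintro g k hgf hkf hgk ⟨a, ha⟩ ⟨b, hb⟩
    obtain ⟨d, hd⟩ := h1 g k hgf hkf hgk
    obtain ⟨d', hd'⟩ := h1' g k hgf hkf hgk
    have hord := (Commute.all g k).orderOf_mul_eq_mul_orderOf_of_coprime hgk
    refine ⟨a * b * d' * d⁻¹, ?_⟩
    rw [hd', ha, hb, hd, hord]
    simp only [mul_pow, ← pow_mul, mul_comm (orderOf k), inv_pow]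
    ext
    push_cast
    field_simp
  · rintro p k l g g' hp hg hg' hlt ⟨a, ha⟩ ⟨b, hb⟩
    obtain ⟨d, hd⟩ := h2 p k l g g' hp hg hg' hlt
    obtain ⟨d', hd'⟩ := h2' p k l g g' hp hg hg' hlt
    rw [Set.mem_ofPred_eq, orderOf_mul_eq_of_primePow_lt hp hg hg' hlt]
    refine ⟨a * b * d' * d⁻¹, ?_⟩
    rw [hd', ha, hb, hd, hg, hg']
    simp only [mul_pow, ← pow_mul, ← pow_add, Nat.add_sub_cancel' hlt.le, inv_pow]
    ext
    push_cast
    field_simp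
  · rintro p k g g' hp hk hg hg' hgg ⟨a, ha⟩ ⟨b, hb⟩
    rw [Set.mem_ofPred_eq, hgg]
    rw [hg] at ha
    rw [hg'] at hb
    by_cases hp2 : p = 2
    · obtain ⟨d, hd⟩ := (h3 p k g g' hp hk hg hg' hgg).2 hp2
      obtain ⟨d', hd'⟩ := (h3' p k g g' hp hk hg hg' hgg).2 hp2
      subst hp2
      refine ⟨a * b * d' * d⁻¹, ?_⟩
      rw [hd', ha, hb, hd]
      simp only [mul_pow, inv_pow]
      ext
      push_cast
      field_simp
    · obtain ⟨d, hd⟩ := (h3 p k g g' hp hk hg hg' hgg).1 hp2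
      obtain ⟨d', hd'⟩ := (h3' p k g g' hp hk hg hg' hgg).1 hp2
      refine ⟨a * b * d' * d⁻¹, ?_⟩
      rw [hd', ha, hb, hd]
      simp only [mul_pow, inv_pow]
      ext
      push_cast
      field_simp

/-- The `2`-cocycle identity, for trivial action. -/
def IsTwoCocycle {G A : Type*} [Mul G] [Mul A] (σ : G → G → A) : Prop :=
  ∀ s t u, σ s t * σ (s * t) u = σ t u * σ s (t * u)

namespace IsTwoCocycle

variable {G A : Type*} [CommGroup G] [CommGroup A] {σ : G → G → A}

theorem one_left (hσ : IsTwoCocycle σ) (t : G) : σ 1 t = σ 1 1 := by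
  simpa using (hσ 1 1 t).symm

theorem one_right (hσ : IsTwoCocycle σ) (t : G) : σ t 1 = σ 1 1 := by
  simpa using hσ t 1 1

theorem mul {τ : G → G → A} (hσ : IsTwoCocycle σ) (hτ : IsTwoCocycle τ) :
    IsTwoCocycle fun s t => σ s t * τ s t := fun s t u => by
  rw [mul_mul_mul_comm, hσ, hτ, mul_mul_mul_comm]

theorem div {τ : G → G → A} (hσ : IsTwoCocycle σ) (hτ : IsTwoCocycle τ) :
    IsTwoCocycle fun s t => σ s t / τ s t := fun s t u => by
  rw [div_mul_div_comm, hσ, hτ, div_mul_div_comm]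

/-- The underlying type of the extension of `G` by `A` attached to a cocycle `σ`. -/
@[ext]
structure Extension (_hσ : IsTwoCocycle σ) where
  /-- The coordinate in `A`. -/
  fst : A
  /-- The coordinate in `G`. -/
  snd : G

instance (hσ : IsTwoCocycle σ) : Mul hσ.Extension :=
  ⟨fun x y => ⟨x.fst * y.fst * σ x.snd y.snd, x.snd * y.snd⟩⟩

instance (hσ : IsTwoCocycle σ) : One hσ.Extension := ⟨⟨(σ 1 1)⁻¹, 1⟩⟩

instance (hσ : IsTwoCocycle σ) : Inv hσ.Extension :=
  ⟨fun x => ⟨x.fst⁻¹ * (σ x.snd⁻¹ x.snd)⁻¹ * (σ 1 1)⁻¹, x.snd⁻¹⟩⟩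

theorem Extension.mul_def {hσ : IsTwoCocycle σ} (x y : hσ.Extension) :
    x * y = ⟨x.fst * y.fst * σ x.snd y.snd, x.snd * y.snd⟩ := rfl

theorem Extension.one_def {hσ : IsTwoCocycle σ} : (1 : hσ.Extension) = ⟨(σ 1 1)⁻¹, 1⟩ := rfl

theorem Extension.inv_def {hσ : IsTwoCocycle σ} (x : hσ.Extension) :
    x⁻¹ = ⟨x.fst⁻¹ * (σ x.snd⁻¹ x.snd)⁻¹ * (σ 1 1)⁻¹, x.snd⁻¹⟩ := rfl

/-- A symmetric cocycle defines an abelian extension. -/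
abbrev Extension.commGroup (hσ : IsTwoCocycle σ) (hsymm : ∀ s t, σ s t = σ t s) :
    CommGroup hσ.Extension :=
  { Group.ofLeftAxioms (G := hσ.Extension)
      (fun x y z => by
        simp only [Extension.mul_def]
        ext
        · have := hσ x.snd y.snd z.snd
          calc _ = x.fst * y.fst * z.fst * (σ x.snd y.snd * σ (x.snd * y.snd) z.snd) := by
                simp only; ac_rfl
            _ = _ := by rw [this]; simp only; ac_rfl
        · exact mul_assoc _ _ _)
      (fun x => by
        simp only [Extension.mul_def, Extension.one_def]
        ext
        · simp [hσ.one_left]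
        · simp)
      (fun x => by
        simp only [Extension.mul_def, Extension.one_def, Extension.inv_def]
        ext
        · calc _ = x.fst⁻¹ * x.fst * ((σ x.snd⁻¹ x.snd)⁻¹ * σ x.snd⁻¹ x.snd) * (σ 1 1)⁻¹ := by
                simp only; ac_rfl
            _ = _ := by simp
        · simp) with
    mul_comm := fun x y => by
      simp only [Extension.mul_def]
      rw [hsymm, mul_comm x.fst, mul_comm x.snd] }

end IsTwoCocycle

theorem exists_multiplicative_section {G E ι : Type*} [CommGroup G] [CommGroup E] [Fintype ι]
    {g : ι → G} (hspan : ∀ t, ∃ a : ι → ℤ, ∏ i, g i ^ a i = t)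
    (hind : ∀ a : ι → ℤ, ∏ i, g i ^ a i = 1 → ∀ i, g i ^ a i = 1)
    (π : E →* G) (ε : ι → E) (hε : ∀ i, π (ε i) = g i) (hord : ∀ i, ε i ^ orderOf (g i) = 1) :
    ∃ f : G → E, (∀ s t, f (s * t) = f s * f t) ∧ ∀ t, π (f t) = t := by
  choose a ha using hspan
  refine ⟨fun t => ∏ i, ε i ^ a t i, fun s t => ?_, fun t => ?_⟩
  · have h1 : ∀ i, g i ^ (a (s * t) i - (a s i + a t i)) = 1 := by
      refine hind (fun i => a (s * t) i - (a s i + a t i)) ?_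
      simp only [zpow_sub, zpow_add, Finset.prod_mul_distrib, Finset.prod_inv_distrib, ha,
        mul_inv_cancel]
    rw [← Finset.prod_mul_distrib]
    refine Finset.prod_congr rfl fun i _ => ?_
    rw [← zpow_add, ← div_eq_one, div_eq_mul_inv, ← zpow_sub]
    obtain ⟨c, hc⟩ := orderOf_dvd_iff_zpow_eq_one.2 (h1 i)
    rw [hc, zpow_mul, zpow_natCast, hord, one_zpow]
  · simp [hε, ha]

theorem IsTwoCocycle.exists_eq_coboundary {G A ι : Type*} [CommGroup G] [CommGroup A] [Fintype ι]
    {g : ι → G} (hspan : ∀ t, ∃ a : ι → ℤ, ∏ i, g i ^ a i = t)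
    (hind : ∀ a : ι → ℤ, ∏ i, g i ^ a i = 1 → ∀ i, g i ^ a i = 1)
    {ρ : G → G → A} (hρ : IsTwoCocycle ρ) (hsymm : ∀ s t, ρ s t = ρ t s)
    (hpow : ∀ i, ∃ a : A, a ^ orderOf (g i) *
      ∏ j ∈ Finset.range (orderOf (g i)), ρ (g i ^ j) (g i) = 1) :
    ∃ f : G → A, ∀ s t, f (s * t) = f s * f t * ρ s t := by
  let _ : CommGroup hρ.Extension := Extension.commGroup hρ hsymm
  let π : hρ.Extension →* G := MonoidHom.mk' Extension.snd fun _ _ => rfl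
  choose a ha using hpow
  have hpow' : ∀ (b : A) (s : G) (n : ℕ), (⟨b, s⟩ : hρ.Extension) ^ n =
      ⟨b ^ n * (∏ j ∈ Finset.range n, ρ (s ^ j) s) * (ρ 1 1)⁻¹, s ^ n⟩ := by
    intro b s n
    induction n with
    | zero => simpa using Extension.one_def
    | succ n ih =>
      rw [pow_succ, ih, Extension.mul_def]
      ext
      · simp only [pow_succ, Finset.prod_range_succ]
        ac_rfl
      · simp [pow_succ]
  obtain ⟨f, hf, hfπ⟩ := exists_multiplicative_section hspan hind π (fun i => ⟨a i, g i⟩)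
    (fun _ => rfl) fun i => by
      rw [hpow', ha, one_mul, pow_orderOf_eq_one]
      rfl
  refine ⟨fun t => (f t).fst, fun s t => ?_⟩
  have h1 : ∀ t, (f t).snd = t := hfπ
  simp only [hf, Extension.mul_def, h1]

namespace GradedDivAlg

variable {𝒞 𝒟 : GradedDivAlg L K}

/-- The basis formed by one nonzero vector in each one-dimensional component. -/
theorem exists_basis (hd : ∀ t : K, Module.finrank L (𝒞.comp t) = 1) {X : K → 𝒞.carrier}
    (hX : ∀ t, X t ∈ 𝒞.comp t) (hX0 : ∀ t, X t ≠ 0) :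
    ∃ b : Module.Basis K L 𝒞.carrier, ∀ t, b t = X t := by
  refine ⟨Module.Basis.mk (v := X) (𝒞.internal.submodule_iSupIndep.linearIndependent _ hX hX0) ?_,
    fun t => Module.Basis.mk_apply _ _ t⟩
  rw [← 𝒞.internal.submodule_iSup_eq_top]
  refine iSup_le fun t y hy => ?_
  obtain ⟨c, rfl⟩ := exists_smul_eq (hd t) (hX t) (hX0 t) hy
  exact Submodule.smul_mem _ _ (Submodule.subset_span ⟨t, rfl⟩)

theorem gradedIso_of_frames (hd : ∀ t : K, Module.finrank L (𝒞.comp t) = 1)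
    (hd' : ∀ t : K, Module.finrank L (𝒟.comp t) = 1) {X : K → 𝒞.carrier} {Y : K → 𝒟.carrier}
    (hX : ∀ t, X t ∈ 𝒞.comp t) (hX0 : ∀ t, X t ≠ 0) (hY : ∀ t, Y t ∈ 𝒟.comp t)
    (hY0 : ∀ t, Y t ≠ 0) {σ : K → K → Lˣ}
    (hXσ : ∀ s t, X s * X t = (σ s t : L) • X (s * t))
    (hYσ : ∀ s t, Y s * Y t = (σ s t : L) • Y (s * t)) : GradedIso 𝒞 𝒟 := by
  obtain ⟨b, hb⟩ := exists_basis hd hX hX0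
  obtain ⟨b', hb'⟩ := exists_basis hd' hY hY0
  let e : 𝒞.carrier ≃ₗ[L] 𝒟.carrier := b.equiv b' (Equiv.refl K)
  have he : ∀ t, e (X t) = Y t := fun t => by simp [e, ← hb, ← hb']
  have hmul : ∀ x y, e (x * y) = e x * e y := by
    have : (LinearMap.mul L 𝒞.carrier).compr₂ e.toLinearMap =
        (LinearMap.mul L 𝒟.carrier).compl₁₂ e.toLinearMap e.toLinearMap :=
      b.ext fun s => b.ext fun t => by simp [hb, he, hXσ, hYσ]
    exact fun x y => LinearMap.congr_fun₂ this x y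
  have hone : e 1 = 1 := by
    obtain ⟨u, hu⟩ := e.surjective 1
    rw [← mul_one (e 1), ← hu, ← hmul, one_mul]
  refine ⟨AlgEquiv.ofLinearEquiv e hone hmul, fun t x hx => ?_⟩
  obtain ⟨c, rfl⟩ := exists_smul_eq (hd t) (hX t) (hX0 t) hx
  rw [AlgEquiv.ofLinearEquiv_apply, map_smul, he]
  exact Submodule.smul_mem _ _ (hY t)

theorem exists_structure_constants (hd : ∀ t : K, Module.finrank L (𝒞.comp t) = 1)
    {X : K → 𝒞.carrier} (hX : ∀ t, X t ∈ 𝒞.comp t) (hX0 : ∀ t, X t ≠ 0) :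
    ∃ σ : K → K → Lˣ, IsTwoCocycle σ ∧ ∀ s t, X s * X t = (σ s t : L) • X (s * t) := by
  choose σ hσ using fun s t => exists_unit_smul_eq (hd (s * t)) (hX (s * t)) (hX0 (s * t))
    (𝒞.mul_mem (hX s) (hX t)) (mul_ne_zero (hX s) (hX0 s) (hX0 t))
  refine ⟨σ, fun s t u => unit_smul_injective (hX0 (s * t * u)) ?_, fun s t => (hσ s t).symm⟩
  rw [Units.val_mul, Units.val_mul, mul_smul, mul_smul, hσ, mul_assoc s, hσ, ← smul_mul_assoc,
    ← mul_smul_comm, hσ, hσ, mul_assoc]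

end GradedDivAlg

theorem pow_eq_prod_structure_constants {L A K : Type*} [Field L] [Ring A] [Algebra L A]
    [CommGroup K] {X : K → A} {σ : K → K → Lˣ}
    (hσ : ∀ s t, X s * X t = (σ s t : L) • X (s * t)) {κ : Lˣ} (h1 : X 1 = (κ : L) • 1)
    {s : K} {n : ℕ} (hn : s ^ n = 1) :
    X s ^ n = algebraMap L A ((∏ j ∈ Finset.range n, σ (s ^ j) s : Lˣ) : L) := by
  have key : ∀ n : ℕ, (κ : L) • X s ^ n =
      ((∏ j ∈ Finset.range n, σ (s ^ j) s : Lˣ) : L) • X (s ^ n) := by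
    intro n
    induction n with
    | zero => simp [h1]
    | succ n ih =>
      rw [pow_succ, ← smul_mul_assoc, ih, smul_mul_assoc, hσ, smul_smul, Finset.prod_range_succ,
        Units.val_mul, pow_succ]
  have h2 := congrArg (((κ⁻¹ : Lˣ) : L) • ·) (key n)
  simp only [smul_smul] at h2
  rw [Units.inv_mul, one_smul, hn, h1, smul_smul, mul_right_comm, Units.inv_mul, one_mul] at h2
  rw [h2, Algebra.algebraMap_eq_smul_one]

theorem SatisfiesData.gradedIso [Group.FG K] {𝒟 𝒟' : GradedDivAlg L K} {β : K → K → Lˣ}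
    {μ : K → Lˣ} (h : SatisfiesData 𝒟 β μ) (h' : SatisfiesData 𝒟' β μ) : GradedIso 𝒟 𝒟' := by
  obtain ⟨ι, _, g, -, hspan, hind⟩ := exists_independent_generators K
  obtain ⟨X, hX1, hX, hX0⟩ := GradedDivAlg.exists_frame h.1
  obtain ⟨Y, hY1, hY, hY0⟩ := GradedDivAlg.exists_frame h'.1
  obtain ⟨σ, hσ, hXσ⟩ := GradedDivAlg.exists_structure_constants h.1 hX hX0
  obtain ⟨τ, hτ, hYτ⟩ := GradedDivAlg.exists_structure_constants h'.1 hY hY0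
  have hσβ : ∀ s t, σ s t = β s t * σ t s := fun s t => by
    refine GradedDivAlg.unit_smul_injective (hX0 (s * t)) ?_
    rw [← hXσ, h.2.1 s t _ _ (hX s) (hX t), hXσ, smul_smul, Units.val_mul, mul_comm t]
  have hτβ : ∀ s t, τ s t = β s t * τ t s := fun s t => by
    refine GradedDivAlg.unit_smul_injective (hY0 (s * t)) ?_
    rw [← hYτ, h'.2.1 s t _ _ (hY s) (hY t), hYτ, smul_smul, Units.val_mul, mul_comm t]
  obtain ⟨f, hf⟩ := (hτ.div hσ).exists_eq_coboundary hspan hind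
    (fun s t => by rw [hσβ, hτβ, mul_div_mul_left_eq_div]) (fun i => by
      rcases Nat.eq_zero_or_pos (orderOf (g i)) with h0 | hpos
      · exact ⟨1, by simp [h0]⟩
      have hfin := orderOf_pos_iff.1 hpos
      obtain ⟨a, ha⟩ := h.exists_of_pow_eq hfin (hX (g i)) (hX0 _)
        (pow_eq_prod_structure_constants hXσ (κ := 1) (by simp [hX1]) (pow_orderOf_eq_one (g i)))
      obtain ⟨b, hb⟩ := h'.exists_of_pow_eq hfin (hY (g i)) (hY0 _)
        (pow_eq_prod_structure_constants hYτ (κ := 1) (by simp [hY1]) (pow_orderOf_eq_one (g i)))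
      refine ⟨b / a, ?_⟩
      rw [Finset.prod_div_distrib, div_pow, div_mul_div_comm, div_eq_one, mul_comm, ← hb, ha,
        mul_comm])
  refine GradedDivAlg.gradedIso_of_frames h.1 h'.1 hX hX0 (Y := fun t => (f t : L) • Y t)
    (fun t => Submodule.smul_mem _ _ (hY t)) (fun t => by simpa using hY0 t) hXσ fun s t => ?_
  simp only [smul_mul_smul_comm, hYτ, smul_smul]
  congr 1
  rw [hf, ← Units.val_mul, ← Units.val_mul, ← Units.val_mul]
  congr 1
  rw [mul_left_comm, mul_div_cancel]

section TwistedGroupAlgebra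

variable {G : Type v} [CommGroup G]

/-- Left translation by `s`, twisted by `σ`, on the free module on `G`. -/
noncomputable def twistedTranslation (σ : G → G → Lˣ) (s : G) : Module.End L (G →₀ L) :=
  Finsupp.linearCombination L fun u => Finsupp.single (s * u) (σ s u : L)

theorem twistedTranslation_single (σ : G → G → Lˣ) (s u : G) (c : L) :
    twistedTranslation σ s (Finsupp.single u c) = Finsupp.single (s * u) (c * σ s u) := by
  simp [twistedTranslation]

theorem twistedTranslation_mul {σ : G → G → Lˣ} (hσ : IsTwoCocycle σ) (s t : G) :
    twistedTranslation σ s * twistedTranslation σ t =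
      (σ s t : L) • twistedTranslation σ (s * t) := by
  refine Finsupp.lhom_ext' fun u => LinearMap.ext_ring ?_
  simp only [LinearMap.comp_apply, Finsupp.lsingle_apply, Module.End.mul_apply,
    LinearMap.smul_apply, twistedTranslation_single]
  rw [Finsupp.smul_single, smul_eq_mul, one_mul, one_mul, ← Units.val_mul, ← Units.val_mul, hσ,
    mul_assoc s, mul_comm (σ t u)]

theorem twistedTranslation_one {σ : G → G → Lˣ} (hσ : IsTwoCocycle σ) :
    twistedTranslation σ 1 = (σ 1 1 : L) • 1 := by
  refine Finsupp.lhom_ext' fun u => LinearMap.ext_ring ?_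
  simp [twistedTranslation_single, hσ.one_left u]

theorem linearIndependent_twistedTranslation (σ : G → G → Lˣ) :
    LinearIndependent L (twistedTranslation σ) := by
  refine LinearIndependent.of_comp (LinearMap.applyₗ (Finsupp.single (1 : G) (1 : L))) ?_
  convert (Finsupp.basisSingleOne (R := L) (ι := G)).linearIndependent.units_smul
    (fun t => σ t 1) using 1
  ext1 t
  simp [twistedTranslation_single, Units.smul_def]

end TwistedGroupAlgebra

theorem GradedDivAlg.exists_of_basis {A : Type max u v} [Ring A] [Algebra L A] {σ : K → K → Lˣ}
    {X : K → A} (hmul : ∀ s t, X s * X t = (σ s t : L) • X (s * t))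
    (hone : X 1 = (σ 1 1 : L) • 1) (hli : LinearIndependent L X)
    (hspan : Submodule.span L (Set.range X) = ⊤) :
    ∃ (𝒟 : GradedDivAlg L K) (X : K → 𝒟.carrier), (∀ t, Module.finrank L (𝒟.comp t) = 1) ∧
      (∀ t, X t ∈ 𝒟.comp t) ∧ (∀ t, X t ≠ 0) ∧ X 1 = (σ 1 1 : L) • 1 ∧
      ∀ s t, X s * X t = (σ s t : L) • X (s * t) := by
  have hunit : ∀ t, IsUnit (X t) := fun t => by
    have h1 : X t * X t⁻¹ = ((σ t t⁻¹ * σ 1 1 : Lˣ) : L) • 1 := by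
      rw [hmul, mul_inv_cancel, hone, smul_smul, Units.val_mul]
    have h2 : X t⁻¹ * X t = ((σ t⁻¹ t * σ 1 1 : Lˣ) : L) • 1 := by
      rw [hmul, inv_mul_cancel, hone, smul_smul, Units.val_mul]
    refine isUnit_iff_exists_and_exists.2
      ⟨⟨(((σ t t⁻¹ * σ 1 1)⁻¹ : Lˣ) : L) • X t⁻¹, ?_⟩,
        ⟨(((σ t⁻¹ t * σ 1 1)⁻¹ : Lˣ) : L) • X t⁻¹, ?_⟩⟩
    · rw [mul_smul_comm, h1, smul_smul, Units.inv_mul, one_smul]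
    · rw [smul_mul_assoc, h2, smul_smul, Units.inv_mul, one_smul]
  refine ⟨
    { carrier := A
      comp := fun t => L ∙ X t
      internal := DirectSum.isInternal_submodule_of_iSupIndep_of_iSup_eq_top
        hli.iSupIndep_span_singleton (by rw [← hspan, Submodule.span_range_eq_iSup])
      one_mem := Submodule.mem_span_singleton.2 ⟨((σ 1 1)⁻¹ : Lˣ), by
        rw [hone, smul_smul, Units.inv_mul, one_smul]⟩
      mul_mem := ?_
      div := ?_ }, X, fun t => finrank_span_singleton (hli.ne_zero t),
    fun t => Submodule.mem_span_singleton_self _, fun t => hli.ne_zero t, hone, hmul⟩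
  · intro s t x y hx hy
    obtain ⟨a, rfl⟩ := Submodule.mem_span_singleton.1 hx
    obtain ⟨b, rfl⟩ := Submodule.mem_span_singleton.1 hy
    rw [smul_mul_smul_comm, hmul]
    exact Submodule.smul_mem _ _ (Submodule.smul_mem _ _ (Submodule.mem_span_singleton_self _))
  · intro t x hx hx0
    obtain ⟨a, rfl⟩ := Submodule.mem_span_singleton.1 hx
    have ha : a ≠ 0 := by
      rintro rfl
      exact hx0 (zero_smul _ _)
    exact (hunit t).smul (Units.mk0 a ha)


theorem GradedDivAlg.exists_of_linearIndependent {E : Type max u v} [Ring E] [Algebra L E]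
    {σ : K → K → Lˣ} {X : K → E} (hmul : ∀ s t, X s * X t = (σ s t : L) • X (s * t))
    (hone : X 1 = (σ 1 1 : L) • 1) (hli : LinearIndependent L X) :
    ∃ (𝒟 : GradedDivAlg L K) (X : K → 𝒟.carrier), (∀ t, Module.finrank L (𝒟.comp t) = 1) ∧
      (∀ t, X t ∈ 𝒟.comp t) ∧ (∀ t, X t ≠ 0) ∧ X 1 = (σ 1 1 : L) • 1 ∧
      ∀ s t, X s * X t = (σ s t : L) • X (s * t) := by
  have hmem : ∀ t, X t ∈ Submodule.span L (Set.range X) := fun t =>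
    Submodule.subset_span ⟨t, rfl⟩
  let A : Subalgebra L E := (Submodule.span L (Set.range X)).toSubalgebra
    (by
      have h : (1 : E) = ((σ 1 1)⁻¹ : Lˣ) • X 1 := by
        rw [hone, Units.smul_def, smul_smul, Units.inv_mul, one_smul]
      rw [h]
      exact Submodule.smul_mem _ _ (hmem 1))
    (fun x y hx hy => by
      have h := Submodule.mul_mem_mul hx hy
      rw [Submodule.span_mul_span] at h
      refine Submodule.span_le.2 ?_ h
      rintro _ ⟨_, ⟨s, rfl⟩, _, ⟨t, rfl⟩, rfl⟩
      simp only [hmul]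
      exact Submodule.smul_mem _ _ (hmem (s * t)))
  refine exists_of_basis (A := A) (X := fun t => ⟨X t, hmem t⟩)
    (fun s t => Subtype.ext (hmul s t)) (Subtype.ext hone)
    (LinearIndependent.of_comp A.val.toLinearMap hli) ?_
  refine Submodule.map_injective_of_injective (f := A.val.toLinearMap) Subtype.val_injective ?_
  rw [Submodule.map_span, ← Set.range_comp, Submodule.map_top]
  exact (Submodule.range_subtype (Submodule.span L (Set.range X))).symm

theorem GradedDivAlg.exists_of_twoCocycle {σ : K → K → Lˣ} (hσ : IsTwoCocycle σ) :
    ∃ (𝒟 : GradedDivAlg L K) (X : K → 𝒟.carrier), (∀ t, Module.finrank L (𝒟.comp t) = 1) ∧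
      (∀ t, X t ∈ 𝒟.comp t) ∧ (∀ t, X t ≠ 0) ∧ X 1 = (σ 1 1 : L) • 1 ∧
      ∀ s t, X s * X t = (σ s t : L) • X (s * t) :=
  exists_of_linearIndependent (E := Module.End L (K →₀ L)) (twistedTranslation_mul hσ)
    (twistedTranslation_one hσ) (linearIndependent_twistedTranslation σ)
/-- Multiplicativity of the projections attached to a family of independent generators. -/
theorem zpow_coordinate_mul {G ι : Type*} [CommGroup G] [Fintype ι] {g : ι → G}
    (hind : ∀ a : ι → ℤ, ∏ i, g i ^ a i = 1 → ∀ i, g i ^ a i = 1) {a b c : ι → ℤ}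
    (h : ∏ i, g i ^ a i = (∏ i, g i ^ b i) * ∏ i, g i ^ c i) (i : ι) :
    g i ^ a i = g i ^ b i * g i ^ c i := by
  have := hind (fun i => a i - (b i + c i))
    (by simp only [zpow_sub, zpow_add, Finset.prod_mul_distrib, Finset.prod_inv_distrib, h,
      mul_inv_cancel]) i
  rwa [zpow_sub, zpow_add, mul_inv_eq_one] at this

theorem IsAltBichar.exists_bicharacter {L : Type u} [Field L] {K : Type v} [CommGroup K]
    {ι : Type*} [Fintype ι] {g : ι → K}
    (hspan : ∀ t, ∃ a : ι → ℤ, ∏ i, g i ^ a i = t)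
    (hind : ∀ a : ι → ℤ, ∏ i, g i ^ a i = 1 → ∀ i, g i ^ a i = 1)
    {β : K → K → Lˣ} (hβ : IsAltBichar β) :
    ∃ γ : K → K → Lˣ, (∀ s t u, γ (s * t) u = γ s u * γ t u) ∧
      (∀ s t u, γ s (t * u) = γ s t * γ s u) ∧ (∀ s t, γ s t = β s t * γ t s) ∧
      ∀ i (n : ℕ), γ (g i ^ n) (g i) = 1 := by
  classical
  let _ : LinearOrder ι := LinearOrder.lift' (Fintype.equivFin ι) (Fintype.equivFin ι).injective
  choose a ha using hspan
  let π : K → ι → K := fun t i => g i ^ a t i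
  have hπ : ∀ s t i, π (s * t) i = π s i * π t i := fun s t i =>
    zpow_coordinate_mul hind (by rw [ha, ha, ha]) i
  have hprod : ∀ t, ∏ i, π t i = t := ha
  have hβz : ∀ (x : K) (m n : ℤ), β (x ^ m) (x ^ n) = 1 := fun x m n => by
    rw [← hβ.hom_apply, map_zpow, map_zpow, MonoidHom.zpow_apply, hβ.hom_apply, hβ.2.2, one_zpow,
      one_zpow]
  have hβprod : ∀ s t, β s t = ∏ i, ∏ j, β (π s i) (π t j) := fun s t => by
    conv_lhs => rw [← hprod s, ← hprod t, ← hβ.hom_apply, map_prod]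
    simp only [map_prod, MonoidHom.finsetProd_apply, hβ.hom_apply]
    exact Finset.prod_comm
  have hself : ∀ i j, j ≠ i → π (g i) j = 1 := fun i j hij => by
    have := zpow_coordinate_mul hind (a := a (g i)) (b := Pi.single i 1) (c := 0)
      (by
        rw [ha, Finset.prod_eq_single i (fun k _ hk => by simp [Pi.single_eq_of_ne hk]) (by simp)]
        simp) j
    simpa [π, Pi.single_eq_of_ne hij] using this
  have h1 : ∀ i, π 1 i = 1 := fun i => by simpa using hπ 1 1 i
  have hpow : ∀ t n i, π (t ^ n) i = π t i ^ n := fun t n i => by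
    induction n with
    | zero => simpa using h1 i
    | succ n ih => rw [pow_succ, hπ, ih, pow_succ]
  refine ⟨fun s t => ∏ i, ∏ j, if j < i then β (π s i) (π t j) else 1, fun s t u => ?_,
    fun s t u => ?_, fun s t => ?_, fun i n => ?_⟩
  · simp only [← Finset.prod_mul_distrib]
    refine Finset.prod_congr rfl fun i _ => Finset.prod_congr rfl fun j _ => ?_
    split_ifs
    · rw [hπ, hβ.1]
    · simp
  · simp only [← Finset.prod_mul_distrib]
    refine Finset.prod_congr rfl fun i _ => Finset.prod_congr rfl fun j _ => ?_
    split_ifs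
    · rw [hπ, hβ.2.1]
    · simp
  · dsimp only
    rw [hβprod s t, Finset.prod_comm (f := fun i j => if j < i then β (π t i) (π s j) else 1)]
    simp only [← Finset.prod_mul_distrib]
    refine Finset.prod_congr rfl fun i _ => Finset.prod_congr rfl fun j _ => ?_
    rcases lt_trichotomy i j with h | rfl | h
    · rw [if_neg h.not_gt, if_pos h, hβ.mul_swap]
    · simp [π, hβz]
    · rw [if_pos h, if_neg h.not_gt, mul_one]
  · refine Finset.prod_eq_one fun j _ => Finset.prod_eq_one fun k _ => ?_
    split_ifs with hkj
    · rw [hpow]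
      by_cases hj : j = i
      · rw [hself i k (by rintro rfl; exact hkj.ne hj.symm), hβ.one_right]
      · rw [hself i j hj, one_pow, hβ.one_left]
    · rfl

theorem exists_symmetric_twoCocycle {A G ι : Type*} [CommGroup A] [CommGroup G] [Fintype ι]
    {g : ι → G} (hspan : ∀ t, ∃ a : ι → ℤ, ∏ i, g i ^ a i = t)
    (hind : ∀ a : ι → ℤ, ∏ i, g i ^ a i = 1 → ∀ i, g i ^ a i = 1) (μ : ι → A) :
    ∃ τ : G → G → A, IsTwoCocycle τ ∧ (∀ s t, τ s t = τ t s) ∧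
      ∀ i, IsOfFinOrder (g i) →
        ∃ c : A, ∏ j ∈ Finset.range (orderOf (g i)), τ (g i ^ j) (g i) =
          μ i * c ^ orderOf (g i) := by
  classical
  choose a ha using hspan
  let χ : (ι → ℤ) → A := fun b => ∏ i, μ i ^ (b i / orderOf (g i))
  let N : AddSubgroup (ι → ℤ) :=
    { carrier := {b | ∀ i, (orderOf (g i) : ℤ) ∣ b i}
      zero_mem' := fun i => dvd_zero _
      add_mem' := fun hb hc i => dvd_add (hb i) (hc i)
      neg_mem' := fun hb i => (dvd_neg).2 (hb i) }
  have hχ : ∀ b ∈ N, ∀ c, χ (b + c) = χ b * χ c := fun b hb c => by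
    simp only [χ, ← Finset.prod_mul_distrib, ← zpow_add]
    refine Finset.prod_congr rfl fun i _ => ?_
    rw [Pi.add_apply, Int.add_ediv_of_dvd_left (hb i)]
  have hN : ∀ b, ∏ i, g i ^ b i = 1 → b ∈ N := fun b hb i =>
    orderOf_dvd_iff_zpow_eq_one.2 (hind b hb i)
  have hmem : ∀ s t, a s + a t - a (s * t) ∈ N := fun s t => hN _ (by
    simp only [Pi.sub_apply, Pi.add_apply, zpow_sub, zpow_add, Finset.prod_mul_distrib,
      Finset.prod_inv_distrib, ha, mul_inv_cancel])
  refine ⟨fun s t => χ (a s + a t - a (s * t)), fun s t u => ?_, fun s t => ?_, fun i hi => ?_⟩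
  · rw [← hχ _ (hmem s t), ← hχ _ (hmem t u), mul_assoc]
    congr 1
    abel
  · simp only [add_comm (a s), mul_comm s]
  · have hχ0 : χ 0 = 1 := by simp [χ]
    have htel : ∀ n : ℕ, ∏ j ∈ Finset.range n, χ (a (g i ^ j) + a (g i) - a (g i ^ j * g i)) =
        χ (n • a (g i) + a 1 - a (g i ^ n)) := fun n => by
      induction n with
      | zero => simp [hχ0]
      | succ n ih =>
        rw [Finset.prod_range_succ, ih, mul_comm, ← hχ _ (hmem _ _), pow_succ, succ_nsmul]
        congr 1
        abel
    have hb : a (g i) - Pi.single i 1 ∈ N := hN _ (by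
      simp only [Pi.sub_apply, zpow_sub, Finset.prod_mul_distrib, Finset.prod_inv_distrib, ha]
      rw [Finset.prod_eq_single i (fun k _ hk => by simp [Pi.single_eq_of_ne hk]) (by simp)]
      simp)
    have hχn : ∀ b ∈ N, ∀ n : ℕ, χ (n • b) = χ b ^ n := fun b hb n => by
      induction n with
      | zero => simp [hχ0]
      | succ n ih => rw [succ_nsmul, hχ _ (nsmul_mem hb n), ih, pow_succ]
    refine ⟨χ (a (g i) - Pi.single i 1), ?_⟩
    have hsplit : orderOf (g i) • a (g i) + a 1 - a (g i ^ orderOf (g i)) =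
        orderOf (g i) • (a (g i) - Pi.single i 1) + orderOf (g i) • Pi.single i 1 := by
      rw [pow_orderOf_eq_one, nsmul_sub]
      abel
    rw [htel, hsplit, hχ _ (nsmul_mem hb _), hχn _ hb, mul_comm]
    congr 1
    simp only [χ]
    rw [Finset.prod_eq_single i (fun k _ hk => by simp [Pi.single_eq_of_ne hk]) (by simp)]
    simp [hi.orderOf_pos.ne']

theorem exists_satisfiesData_of_muConds [Group.FG K] {β : K → K → Lˣ} {μ : K → Lˣ}
    (hβ : IsAltBichar β) (hμ : MuConds β μ) : ∃ 𝒟 : GradedDivAlg L K, SatisfiesData 𝒟 β μ := by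
  obtain ⟨ι, _, g, hg, hspan, hind⟩ := exists_independent_generators K
  obtain ⟨γ, hγl, hγr, hγβ, hγg⟩ := hβ.exists_bicharacter hspan hind
  obtain ⟨τ, hτ, hτsymm, hτg⟩ := exists_symmetric_twoCocycle hspan hind fun i => μ (g i)
  have hγ : IsTwoCocycle γ := fun s t u => by
    rw [hγl, hγr]
    ac_rfl
  obtain ⟨𝒟, X, hd, hX, hX0, hX1, hXσ⟩ := GradedDivAlg.exists_of_twoCocycle (hγ.mul hτ)
  obtain ⟨β', μ', h⟩ := GradedDivAlg.exists_satisfiesData hd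
  obtain rfl : β' = β := funext₂ fun s t => h.eq_of_comm (hX s) (hX0 s) (hX t) (hX0 t) (by
    rw [hXσ, hXσ, smul_smul, mul_comm t, ← Units.val_mul, ← mul_assoc, ← hγβ, hτsymm])
  have hgen : ∀ i, IsOfFinOrder (g i) → ∃ c : Lˣ, μ' (g i) = μ (g i) * c ^ orderOf (g i) := by
    intro i hi
    obtain ⟨c, hc⟩ := hτg i hi
    obtain ⟨d, hd⟩ := h.exists_of_pow_eq hi (hX (g i)) (hX0 _)
      (pow_eq_prod_structure_constants hXσ hX1 (pow_orderOf_eq_one (g i)))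
    refine ⟨c * d, ?_⟩
    simp only [hd, hγg, one_mul, hc, mul_pow, mul_assoc]
  refine ⟨𝒟, hd, h.2.1, fun t ht x hx hx0 => ?_⟩
  obtain ⟨c, hc⟩ := hμ.eq_of_generators hg hspan hind h.muConds hgen t ht
  obtain ⟨d, hd⟩ := h.2.2 t ht x hx hx0
  refine ⟨c * d, ?_⟩
  rw [hd, hc]
  congr 1
  rw [Units.val_mul, Units.val_pow_eq_pow_val, Units.val_mul, mul_pow, mul_assoc]

/-- For any alternating bicharacter `β : K × K → L^×` and any
`μ ∈ F_K` satisfying conditions (0)–(3), there is a graded-division algebra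
`D(K, β, μ)` over `L`, unique up to graded isomorphism, with `1`-dimensional
components, commutation governed by `β`, and `x^{o(t)} ∈ μ(t)` for homogeneous `x`
of torsion degree `t`.  Moreover every graded-division algebra over `L` with
`1`-dimensional components (support `K`) arises this way for exactly one pair
`(β, μ)` (with `μ` unique as an element of `F_K`, i.e. modulo `o(t)`-th powers). -/
theorem stmt6 [Group.FG K]
    (β : K → K → Lˣ) (μ : K → Lˣ) (hβ : IsAltBichar β) (hμ : MuConds β μ) :
    (∃ 𝒟 : GradedDivAlg L K, SatisfiesData 𝒟 β μ) ∧
    (∀ 𝒟 𝒟' : GradedDivAlg L K, SatisfiesData 𝒟 β μ → SatisfiesData 𝒟' β μ →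
      GradedIso 𝒟 𝒟') ∧
    (∀ 𝒞 : GradedDivAlg L K, (∀ t : K, Module.finrank L (𝒞.comp t) = 1) →
      ∃ (β' : K → K → Lˣ) (μ' : K → Lˣ), IsAltBichar β' ∧ MuConds β' μ' ∧
        SatisfiesData 𝒞 β' μ' ∧
        ∀ (β'' : K → K → Lˣ) (μ'' : K → Lˣ), SatisfiesData 𝒞 β'' μ'' →
          β'' = β' ∧ ∀ t : K, IsOfFinOrder t → ∃ c : Lˣ, μ'' t = μ' t * c ^ orderOf t) := by
  refine ⟨exists_satisfiesData_of_muConds hβ hμ, fun _ _ h h' => h.gradedIso h', fun 𝒞 hd => ?_⟩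
  obtain ⟨β', μ', h⟩ := GradedDivAlg.exists_satisfiesData hd
  refine ⟨β', μ', h.isAltBichar, h.muConds, h, fun β'' μ'' h'' => ⟨?_, fun t ht => ?_⟩⟩
  · obtain ⟨X, -, hX, hX0⟩ := GradedDivAlg.exists_frame hd
    exact funext₂ fun s t =>
      h''.eq_of_comm (hX s) (hX0 s) (hX t) (hX0 t) (h.2.1 s t _ _ (hX s) (hX t))
  · obtain ⟨x, hx, hx0, hxp⟩ := h.exists_pow_eq ht
    exact h''.exists_of_pow_eq ht hx hx0 hxp
end
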